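/- Fix A > 0. For x large and x^{0.51} ≤ Q ≤ x, the variance of the von Mangoldt function satisfies V(Λ,x,Q) = (Q/2) Σ_{n ≤ x} Λ(n)² + O_A( x²/log^A x + Q x log²(2x/Q) ) = (Q x log x)/2 + O_A( x²/log^A x + Q x log²(2x/Q) ), where the implied constants depend only on A. -/

import Mathlib

open scoped Classical

/-- `𝒜(z;q,b) := Σ_{n ≤ z, n ≡ b (mod q)} a_n`, for a real sequence `a`. -/
noncomputable def seqSum (a : ℕ → ℝ) (z : ℝ) (q b : ℕ) : ℝ :=
  ∑ n ∈ (Finset.Icc 1 ⌊z⌋₊).filter (fun n => n % q = b % q), a n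

/-- `Aver(𝒜,z;q,h) := (1/φ(q/h)) Σ_{1 ≤ b ≤ q, (b,q)=h} 𝒜(z;q,b)`, for `h ∣ q`. -/
noncomputable def seqAver (a : ℕ → ℝ) (z : ℝ) (q h : ℕ) : ℝ :=
  (1 / (Nat.totient (q / h) : ℝ)) *
    ∑ b ∈ (Finset.Icc 1 q).filter (fun b => Nat.gcd b q = h), seqSum a z q b

/-- The Barban–Davenport–Halberstam type variance
`V(𝒜,x,Q) := Σ_{Q/2 < q ≤ Q} Σ_{1 ≤ b ≤ q} |𝒜(x;q,b) − Aver(𝒜,x;q,(b,q))|²`. -/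
noncomputable def varV (a : ℕ → ℝ) (x Q : ℝ) : ℝ :=
  ∑ q ∈ Finset.Ioc ⌊Q / 2⌋₊ ⌊Q⌋₊, ∑ b ∈ Finset.Icc 1 q,
    (seqSum a x q b - seqAver a x q (Nat.gcd b q)) ^ 2

namespace VarianceBDH

open Complex MeasureTheory Set Filter Topology

/-- The remainder `∑_{N < k ≤ t} c k - δ (t - N)`, set to `0` for `t < N`. -/
noncomputable def tailSum (c : ℕ → ℂ) (δ : ℂ) (N : ℕ) (t : ℝ) : ℂ :=
  if (N : ℝ) ≤ t then
    ∑ k ∈ Finset.Icc 1 ⌊t⌋₊, c k - ∑ k ∈ Finset.Icc 1 N, c k - δ * ((t : ℂ) - N) else 0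

lemma measurable_tailSum (c : ℕ → ℂ) (δ : ℂ) (N : ℕ) : Measurable (tailSum c δ N) := by
  unfold tailSum
  refine Measurable.ite measurableSet_Ici ?_ measurable_const
  have h : Measurable (fun t : ℝ => ∑ k ∈ Finset.Icc 1 ⌊t⌋₊, c k) :=
    (measurable_from_top (f := fun n : ℕ => ∑ k ∈ Finset.Icc 1 n, c k)).comp Nat.measurable_floor
  fun_prop

lemma norm_tailSum_le {c : ℕ → ℂ} {δ : ℂ} {B : ℝ}
    (hB : ∀ n : ℕ, ‖∑ k ∈ Finset.Icc 1 n, c k - δ * n‖ ≤ B) (N : ℕ) (t : ℝ) :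
    ‖tailSum c δ N t‖ ≤ 2 * B + ‖δ‖ := by
  have hB0 : 0 ≤ B := (norm_nonneg _).trans (hB 0)
  unfold tailSum
  split_ifs with h
  · have h0 : 0 ≤ t := (Nat.cast_nonneg N).trans h
    have e : ∑ k ∈ Finset.Icc 1 ⌊t⌋₊, c k - ∑ k ∈ Finset.Icc 1 N, c k - δ * ((t : ℂ) - N)
        = (∑ k ∈ Finset.Icc 1 ⌊t⌋₊, c k - δ * (⌊t⌋₊ : ℂ)) - (∑ k ∈ Finset.Icc 1 N, c k - δ * N)
          - δ * ((t - ⌊t⌋₊ : ℝ) : ℂ) := by push_cast; ring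
    rw [e]
    refine (norm_sub_le _ _).trans ?_
    have h1 := (norm_sub_le _ _).trans (add_le_add (hB ⌊t⌋₊) (hB N))
    have h2 : ‖δ * ((t - ⌊t⌋₊ : ℝ) : ℂ)‖ ≤ ‖δ‖ := by
      rw [norm_mul, Complex.norm_real]
      refine mul_le_of_le_one_right (norm_nonneg _) ?_
      rw [Real.norm_eq_abs, abs_le]
      constructor <;> linarith [Nat.floor_le h0, Nat.lt_floor_add_one t]
    linarith
  · simp; positivity

lemma tailSum_eq_zero (c : ℕ → ℂ) (δ : ℂ) {N : ℕ} {t : ℝ} (h : t ≤ N) : tailSum c δ N t = 0 := by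
  unfold tailSum
  split_ifs with h'
  · obtain rfl : t = N := le_antisymm h h'
    simp
  · rfl

lemma mellin_tailSum_eq (c : ℕ → ℂ) (δ : ℂ) (N : ℕ) (s : ℂ) :
    mellin (tailSum c δ N) (-s) = ∫ t in Ioi (N : ℝ), tailSum c δ N t * (t : ℂ) ^ (-(s + 1)) := by
  unfold mellin
  have : ∀ t : ℝ, tailSum c δ N t * (t : ℂ) ^ (-(s + 1)) =
      (t : ℂ) ^ (-s - 1) • tailSum c δ N t := by
    intro t; rw [smul_eq_mul, mul_comm]; ring_nf
  simp_rw [this]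
  apply setIntegral_eq_of_subset_of_forall_sdiff_eq_zero measurableSet_Ioi
  · exact Ioi_subset_Ioi (Nat.cast_nonneg N)
  · intro t ht
    rw [tailSum_eq_zero c δ (by simpa using ht.2), smul_zero]

lemma norm_mellin_tailSum_le {c : ℕ → ℂ} {δ : ℂ} {B : ℝ}
    (hB : ∀ n : ℕ, ‖∑ k ∈ Finset.Icc 1 n, c k - δ * n‖ ≤ B) {N : ℕ} (hN : 1 ≤ N) {s : ℂ}
    (hs : 0 < s.re) :
    ‖mellin (tailSum c δ N) (-s)‖ ≤ (2 * B + ‖δ‖) * ((N : ℝ) ^ (-s.re) / s.re) := by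
  have hN0 : (0 : ℝ) < N := by exact_mod_cast hN
  rw [mellin_tailSum_eq]
  have hInt : IntegrableOn (fun t : ℝ => (2 * B + ‖δ‖) * t ^ (-(s.re + 1))) (Ioi (N : ℝ)) :=
    (integrableOn_Ioi_rpow_of_lt (by linarith) hN0).const_mul _
  refine (norm_integral_le_of_norm_le hInt ?_).trans ?_
  · filter_upwards [ae_restrict_mem measurableSet_Ioi] with t ht
    have ht0 : 0 < t := hN0.trans ht
    rw [norm_mul, Complex.norm_cpow_eq_rpow_re_of_pos ht0]
    have : (-(s + 1)).re = -(s.re + 1) := by simp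
    rw [this]
    exact mul_le_mul_of_nonneg_right (norm_tailSum_le hB N t) (by positivity)
  · rw [integral_const_mul, integral_Ioi_rpow_of_lt (by linarith) hN0]
    have : -(s.re + 1) + 1 = -s.re := by ring
    rw [this, div_neg, neg_div, neg_neg]

lemma differentiableAt_mellin_tailSum {c : ℕ → ℂ} {δ : ℂ} {B : ℝ}
    (hB : ∀ n : ℕ, ‖∑ k ∈ Finset.Icc 1 n, c k - δ * n‖ ≤ B) {N : ℕ} (hN : 1 ≤ N) {s : ℂ}
    (hs : 0 < s.re) : DifferentiableAt ℂ (fun s => mellin (tailSum c δ N) (-s)) s := by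
  have hN0 : (0 : ℝ) < N := by exact_mod_cast hN
  have : DifferentiableAt ℂ (mellin (tailSum c δ N)) (-s) := by
    refine mellin_differentiableAt_of_isBigO_rpow (a := 0) (b := -s.re - 1) ?_ ?_ ?_ ?_ ?_
    · refine LocallyIntegrable.locallyIntegrableOn ?_ _
      refine (locallyIntegrable_const (2 * B + ‖δ‖)).mono
        (measurable_tailSum c δ N).aestronglyMeasurable (ae_of_all _ fun t => ?_)
      rw [Real.norm_of_nonneg ((norm_nonneg _).trans (norm_tailSum_le hB N t))]
      exact norm_tailSum_le hB N t
    · simp only [neg_zero, Real.rpow_zero]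
      exact Asymptotics.isBigO_of_le' (c := 2 * B + ‖δ‖) _ fun t => by
        simpa using norm_tailSum_le hB N t
    · simpa using hs
    · refine Asymptotics.IsBigO.of_bound 1 ?_
      have : ∀ᶠ t : ℝ in 𝓝[>] 0, t < N :=
        mem_nhdsWithin_of_mem_nhds (Iio_mem_nhds hN0)
      filter_upwards [this] with t ht
      rw [tailSum_eq_zero c δ ht.le]; simp
    · simp
  exact this.comp s differentiableAt_id.neg

lemma integral_sub_mul_cpow {N : ℕ} (hN : 1 ≤ N) {s : ℂ} (hs : 1 < s.re) :
    IntegrableOn (fun t : ℝ => ((t : ℂ) - N) * (t : ℂ) ^ (-(s + 1))) (Ioi (N : ℝ)) ∧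
    s * ∫ t in Ioi (N : ℝ), ((t : ℂ) - N) * (t : ℂ) ^ (-(s + 1)) = (N : ℂ) ^ (1 - s) / (s - 1) := by
  have hN0 : (0 : ℝ) < N := by exact_mod_cast hN
  have hNc : (N : ℂ) ≠ 0 := by exact_mod_cast hN0.ne'
  have e : EqOn (fun t : ℝ => ((t : ℂ) - N) * (t : ℂ) ^ (-(s + 1)))
      (fun t : ℝ => (t : ℂ) ^ (-s) - N * (t : ℂ) ^ (-(s + 1))) (Ioi (N : ℝ)) := by
    intro t ht
    have ht0 : (t : ℂ) ≠ 0 := by exact_mod_cast (hN0.trans ht).ne'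
    have : (t : ℂ) ^ (-s) = t * (t : ℂ) ^ (-(s + 1)) := by
      have : -s = 1 + (-(s + 1)) := by ring
      rw [this, cpow_add _ _ ht0, cpow_one]
    simp only [this]; ring
  have i1 : IntegrableOn (fun t : ℝ => (t : ℂ) ^ (-s)) (Ioi (N : ℝ)) :=
    integrableOn_Ioi_cpow_of_lt (by simpa using hs) hN0
  have i2 : IntegrableOn (fun t : ℝ => (N : ℂ) * (t : ℂ) ^ (-(s + 1))) (Ioi (N : ℝ)) :=
    (integrableOn_Ioi_cpow_of_lt (by simp; linarith) hN0).const_mul _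
  have hs0 : s ≠ 0 := by rintro rfl; simp at hs; linarith
  have hs1 : s - 1 ≠ 0 := by
    intro h; have : s = 1 := by linear_combination h
    rw [this] at hs; simp at hs
  have hs1' : -s + 1 ≠ 0 := by intro h; apply hs1; linear_combination -h
  refine ⟨(integrableOn_congr_fun e measurableSet_Ioi).2 (i1.sub i2), ?_⟩
  rw [setIntegral_congr_fun measurableSet_Ioi e, integral_sub i1 i2, integral_const_mul,
    integral_Ioi_cpow_of_lt (by simpa using hs) hN0,
    integral_Ioi_cpow_of_lt (by simp; linarith) hN0]
  have e1 : (-(s + 1) + 1 : ℂ) = -s := by ring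
  have e2 : ((N : ℝ) : ℂ) ^ (-s + 1) = (N : ℂ) ^ (1 - s) := by rw [neg_add_eq_sub]; simp
  have e3 : (N : ℂ) * ((N : ℝ) : ℂ) ^ (-s) = (N : ℂ) ^ (1 - s) := by
    rw [sub_eq_add_neg, cpow_add _ _ hNc, cpow_one]; simp
  rw [e1, e2, neg_div_neg_eq]
  have : (N : ℂ) * (((N : ℝ) : ℂ) ^ (-s) / s) = (N : ℂ) ^ (1 - s) / s := by
    rw [← e3]; ring
  rw [this]
  field_simp
  ring

lemma LSeries_eq_sum_add_mellin_tailSum {c : ℕ → ℂ} {δ : ℂ} {B : ℝ} (hc : ∀ n, ‖c n‖ ≤ 1)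
    (hB : ∀ n : ℕ, ‖∑ k ∈ Finset.Icc 1 n, c k - δ * n‖ ≤ B) {N : ℕ} (hN : 1 ≤ N) {s : ℂ}
    (hs : 1 < s.re) :
    LSeries c s = ∑ n ∈ Finset.Icc 1 N, c n * (n : ℂ) ^ (-s) + δ * ((N : ℂ) ^ (1 - s) / (s - 1))
      + s * mellin (tailSum c δ N) (-s) := by
  have hN0 : (0 : ℝ) < N := by exact_mod_cast hN
  set f : ℕ → ℂ := fun n => if n ≤ N then 0 else c n with hf
  set g : ℕ → ℂ := fun n => if n ≤ N then c n else 0 with hg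
  have hfb : ∀ n, ‖f n‖ ≤ 1 := fun n => by
    simp only [hf]; split_ifs <;> simp [hc]
  have hgb : ∀ n, ‖g n‖ ≤ 1 := fun n => by
    simp only [hg]; split_ifs <;> simp [hc]
  have hfs : LSeriesSummable f s := LSeriesSummable_of_bounded_of_one_lt_re (fun n _ => hfb n) hs
  have hgs : LSeriesSummable g s := LSeriesSummable_of_bounded_of_one_lt_re (fun n _ => hgb n) hs
  have hsplit : LSeries c s = LSeries g s + LSeries f s := by
    rw [← LSeries_add hgs hfs]
    congr 1; ext n; simp only [Pi.add_apply, hf, hg]; split_ifs <;> simp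
  have hgsum : LSeries g s = ∑ n ∈ Finset.Icc 1 N, c n * (n : ℂ) ^ (-s) := by
    unfold LSeries
    rw [tsum_eq_sum (s := Finset.Icc 1 N)]
    · refine Finset.sum_congr rfl fun n hn => ?_
      rw [Finset.mem_Icc] at hn
      rw [LSeries.term_of_ne_zero (by lia), hg]
      simp only [hn.2, if_true]
      rw [cpow_neg, div_eq_mul_inv]
    · intro n hn
      rw [Finset.mem_Icc] at hn
      rcases Nat.eq_zero_or_pos n with rfl | h
      · simp
      · rw [LSeries.term_of_ne_zero h.ne', hg]
        have : ¬ n ≤ N := by lia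
        simp [this]
  rw [hsplit, hgsum, add_assoc]
  congr 1
  have hO : (fun n ↦ ∑ k ∈ Finset.Icc 1 n, ‖f k‖) =O[atTop] fun n ↦ (n : ℝ) ^ (1 : ℝ) := by
    refine Asymptotics.IsBigO.of_bound 1 (Eventually.of_forall fun n => ?_)
    rw [Real.rpow_one, Real.norm_of_nonneg (Finset.sum_nonneg fun _ _ => norm_nonneg _), one_mul,
      Real.norm_of_nonneg (Nat.cast_nonneg n)]
    refine (Finset.sum_le_sum fun k _ => hfb k).trans ?_
    simp
  rw [LSeries_eq_mul_integral' f zero_le_one hs hO]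
  obtain ⟨hi, he⟩ := integral_sub_mul_cpow hN hs
  rw [← he, mellin_tailSum_eq]
  have hval : ∀ t : ℝ, (N : ℝ) < t → ∑ k ∈ Finset.Icc 1 ⌊t⌋₊, f k =
      tailSum c δ N t + δ * ((t : ℂ) - N) := by
    intro t ht
    have hle : N ≤ ⌊t⌋₊ := Nat.le_floor ht.le
    rw [tailSum, if_pos ht.le, sub_add_cancel, eq_sub_iff_add_eq']
    have h1 : ∑ k ∈ Finset.Icc 1 N, c k = ∑ k ∈ Finset.Icc 1 ⌊t⌋₊, g k := by
      rw [← Finset.sum_subset (Finset.Icc_subset_Icc_right hle) (f := g)]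
      · refine Finset.sum_congr rfl fun n hn => ?_
        simp [hg, (Finset.mem_Icc.1 hn).2]
      · intro n _ hn
        simp only [hg]; rw [if_neg]; intro h; simp_all
    rw [h1, ← Finset.sum_add_distrib]
    refine Finset.sum_congr rfl fun n hn => ?_
    simp only [hf, hg]; split_ifs <;> simp
  have hcut : ∫ t in Ioi (1 : ℝ), (∑ k ∈ Finset.Icc 1 ⌊t⌋₊, f k) * (t : ℂ) ^ (-(s + 1)) =
      ∫ t in Ioi (N : ℝ), (∑ k ∈ Finset.Icc 1 ⌊t⌋₊, f k) * (t : ℂ) ^ (-(s + 1)) := by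
    apply setIntegral_eq_of_subset_of_forall_sdiff_eq_zero measurableSet_Ioi
    · exact Ioi_subset_Ioi (by exact_mod_cast hN)
    · intro t ht
      have : t ≤ N := by simpa using ht.2
      rw [Finset.sum_eq_zero, zero_mul]
      intro n hn
      simp only [hf]; rw [if_pos]
      have h2 := (Finset.mem_Icc.1 hn).2
      have : ⌊t⌋₊ ≤ N := by simpa using Nat.floor_mono this
      lia
  have hi2 : IntegrableOn (fun t : ℝ => tailSum c δ N t * (t : ℂ) ^ (-(s + 1))) (Ioi (N : ℝ)) := by
    refine (integrableOn_Ioi_cpow_of_lt (a := -(s + 1)) (by simp; linarith) hN0).bdd_mul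
      (c := 2 * B + ‖δ‖)
      (measurable_tailSum c δ N).aestronglyMeasurable (ae_of_all _ fun t => norm_tailSum_le hB N t)
  have e : EqOn (fun t : ℝ => (∑ k ∈ Finset.Icc 1 ⌊t⌋₊, f k) * (t : ℂ) ^ (-(s + 1)))
      (fun t : ℝ => tailSum c δ N t * (t : ℂ) ^ (-(s + 1)) +
        δ * (((t : ℂ) - N) * (t : ℂ) ^ (-(s + 1)))) (Ioi (N : ℝ)) := by
    intro t ht
    simp only [hval t ht]; ring
  rw [hcut, setIntegral_congr_fun measurableSet_Ioi e, integral_add hi2 (hi.const_mul _),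
    integral_const_mul]
  ring

/-- Partial sum approximation for a Dirichlet series with mean value `δ`, valid for `0 < re s`;
here `F₁ s = (s - 1) * F s` where `F` continues the Dirichlet series. -/
lemma norm_sub_partial_sum_le {c : ℕ → ℂ} {δ : ℂ} {B : ℝ} (hc : ∀ n, ‖c n‖ ≤ 1)
    (hB : ∀ n : ℕ, ‖∑ k ∈ Finset.Icc 1 n, c k - δ * n‖ ≤ B) {F₁ : ℂ → ℂ}
    (hF : Differentiable ℂ F₁) (hFc : ∀ s : ℂ, 1 < s.re → F₁ s = (s - 1) * LSeries c s)
    {N : ℕ} (hN : 1 ≤ N) {s : ℂ} (hs : 0 < s.re) :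
    ‖F₁ s - (s - 1) * ∑ n ∈ Finset.Icc 1 N, c n * (n : ℂ) ^ (-s) - δ * (N : ℂ) ^ (1 - s)‖
      ≤ ‖s - 1‖ * (‖s‖ * ((2 * B + ‖δ‖) * ((N : ℝ) ^ (-s.re) / s.re))) := by
  have hNc : (N : ℂ) ≠ 0 := by exact_mod_cast (by lia : N ≠ 0)
  set U : Set ℂ := {s | 0 < s.re}
  have hU : IsOpen U := isOpen_lt continuous_const Complex.continuous_re
  set G : ℂ → ℂ := fun s => (s - 1) * ∑ n ∈ Finset.Icc 1 N, c n * (n : ℂ) ^ (-s)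
    + δ * (N : ℂ) ^ (1 - s) + (s - 1) * (s * mellin (tailSum c δ N) (-s)) with hG
  have hsum : Differentiable ℂ (fun s : ℂ => ∑ n ∈ Finset.Icc 1 N, c n * (n : ℂ) ^ (-s)) := by
    refine Differentiable.fun_sum fun n hn => ?_
    have : (n : ℂ) ≠ 0 := by
      have := (Finset.mem_Icc.1 hn).1
      exact_mod_cast (by lia : n ≠ 0)
    exact (differentiable_id.neg.const_cpow (Or.inl this)).const_mul _
  have hGd : DifferentiableOn ℂ G U := by
    intro z hz
    refine DifferentiableAt.differentiableWithinAt ?_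
    have h1 := differentiableAt_mellin_tailSum hB hN hz
    have h2 : DifferentiableAt ℂ (fun s : ℂ => (N : ℂ) ^ (1 - s)) z :=
      (differentiableAt_id.const_sub 1).const_cpow (Or.inl hNc)
    have h3 := hsum z
    simp only [hG]
    fun_prop
  have heq : EqOn F₁ G U := by
    refine (hF.differentiableOn.analyticOnNhd hU).eqOn_of_preconnected_of_eventuallyEq
      (hGd.analyticOnNhd hU) ?_ (z₀ := 2) (by simp [U]) ?_
    · exact (convex_halfSpace_re_gt 0).isPreconnected
    · have : ∀ᶠ z : ℂ in 𝓝 2, 1 < z.re :=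
        (isOpen_lt continuous_const Complex.continuous_re).mem_nhds (by simp)
      filter_upwards [this] with z hz
      have hz1 : z - 1 ≠ 0 := by
        intro h; have : z = 1 := by linear_combination h
        rw [this] at hz; simp at hz
      rw [hFc z hz, LSeries_eq_sum_add_mellin_tailSum hc hB hN hz, hG]
      field_simp
  have : F₁ s - (s - 1) * ∑ n ∈ Finset.Icc 1 N, c n * (n : ℂ) ^ (-s) - δ * (N : ℂ) ^ (1 - s) =
      (s - 1) * (s * mellin (tailSum c δ N) (-s)) := by
    rw [heq hs, hG]; ring
  rw [this, norm_mul, norm_mul]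
  gcongr
  exact norm_mellin_tailSum_le hB hN hs

/-- The mean value of a Dirichlet character. -/
noncomputable def charMean {q : ℕ} (χ : DirichletCharacter ℂ q) : ℂ :=
  if χ = 1 then (q.totient : ℂ) / q else 0

lemma norm_charMean_le {q : ℕ} (χ : DirichletCharacter ℂ q) : ‖charMean χ‖ ≤ 1 := by
  unfold charMean
  split_ifs
  · rw [norm_div, Complex.norm_natCast, Complex.norm_natCast]
    exact div_le_one_of_le₀ (by exact_mod_cast Nat.totient_le q) (Nat.cast_nonneg q)
  · simp

lemma sum_char_period {q : ℕ} [NeZero q] (χ : DirichletCharacter ℂ q) :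
    ∑ k ∈ Finset.Icc 1 q, χ k = charMean χ * q := by
  have hq : (q : ℂ) ≠ 0 := by exact_mod_cast NeZero.ne q
  have h : ∑ k ∈ Finset.Icc 1 q, χ k = ∑ z : ZMod q, χ z := by
    refine Finset.sum_bij' (fun k _ => (k : ZMod q))
      (fun z _ => if z = 0 then q else z.val) ?_ ?_ ?_ ?_ ?_
    · simp
    · intro z _
      simp only [Finset.mem_Icc]
      split_ifs with h
      · exact ⟨NeZero.one_le, le_rfl⟩
      · have := ZMod.val_lt z
        have : z.val ≠ 0 := by simpa using h
        lia
    · intro k hk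
      rw [Finset.mem_Icc] at hk
      split_ifs with h
      · rw [ZMod.natCast_eq_zero_iff] at h
        exact le_antisymm (Nat.le_of_dvd (by lia) h) hk.2
      · rw [ZMod.natCast_eq_zero_iff] at h
        rw [ZMod.val_natCast, Nat.mod_eq_of_lt]
        refine lt_of_le_of_ne hk.2 ?_
        rintro rfl
        exact h dvd_rfl
    · intro z _
      split_ifs with h
      · simp [h]
      · simp
    · simp
  rw [h, charMean]
  split_ifs with h1
  · rw [h1, MulChar.sum_one_eq_card_units, ZMod.card_units_eq_totient, div_mul_cancel₀ _ hq]
  · rw [MulChar.sum_eq_zero_of_ne_one h1, zero_mul]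

lemma norm_sum_char_sub_le {q : ℕ} [NeZero q] (χ : DirichletCharacter ℂ q) (n : ℕ) :
    ‖∑ k ∈ Finset.Icc 1 n, χ k - charMean χ * n‖ ≤ 2 * q := by
  induction n using Nat.strong_induction_on with
  | _ n ih =>
    rcases lt_or_ge n q with h | h
    · refine (norm_sub_le _ _).trans ?_
      have h1 : ‖∑ k ∈ Finset.Icc 1 n, χ k‖ ≤ n := by
        refine (norm_sum_le_of_le (Finset.Icc 1 n) (f := fun k : ℕ => χ k) (n := fun _ => (1 : ℝ))
          fun k _ => χ.norm_le_one _).trans ?_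
        simp
      have h2 : ‖charMean χ * n‖ ≤ n := by
        rw [norm_mul, Complex.norm_natCast]
        exact mul_le_of_le_one_left (Nat.cast_nonneg n) (norm_charMean_le χ)
      have h3 : (n : ℝ) ≤ q := by exact_mod_cast h.le
      linarith
    · have hq : 0 < q := NeZero.pos q
      have hs : ∑ k ∈ Finset.Icc 1 n, χ k =
          ∑ k ∈ Finset.Icc 1 q, χ k + ∑ k ∈ Finset.Icc 1 (n - q), χ k := by
        have e1 : Finset.Icc 1 n = Finset.Ioc 0 n := rfl
        have e2 : Finset.Icc 1 q = Finset.Ioc 0 q := rfl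
        rw [e1, e2, ← Finset.sum_Ioc_consecutive _ (Nat.zero_le q) h]
        congr 1
        symm
        refine Finset.sum_bij' (fun k _ => k + q) (fun k _ => k - q) ?_ ?_ ?_ ?_ ?_
        · intro k hk; simp only [Finset.mem_Icc, Finset.mem_Ioc] at *; lia
        · intro k hk; simp only [Finset.mem_Icc, Finset.mem_Ioc] at *; lia
        · intro k hk; simp
        · intro k hk; simp only [Finset.mem_Ioc] at hk; lia
        · intro k hk; simp
      have hd : ∑ k ∈ Finset.Icc 1 n, χ k - charMean χ * n =
          ∑ k ∈ Finset.Icc 1 (n - q), χ k - charMean χ * ((n - q : ℕ) : ℂ) := by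
        rw [hs, sum_char_period, Nat.cast_sub h]; ring
      rw [hd]
      exact ih (n - q) (by lia)

lemma norm_LFunction_sub_partial_sum_le {q : ℕ} [NeZero q] (χ : DirichletCharacter ℂ q)
    {N : ℕ} (hN : 1 ≤ N) {s : ℂ} (hs : 0 < s.re) (hs1 : s ≠ 1) :
    ‖χ.LFunction s - ∑ n ∈ Finset.Icc 1 N, χ n * (n : ℂ) ^ (-s)
      - charMean χ * (N : ℂ) ^ (1 - s) / (s - 1)‖
      ≤ ‖s‖ * (5 * q * ((N : ℝ) ^ (-s.re) / s.re)) := by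
  have hs1' : s - 1 ≠ 0 := sub_ne_zero.2 hs1
  have key : ∃ F₁ : ℂ → ℂ, Differentiable ℂ F₁ ∧ ∀ s ≠ 1, F₁ s = (s - 1) * χ.LFunction s := by
    by_cases h : χ = 1
    · subst h
      refine ⟨_, DirichletCharacter.differentiable_LFunctionTrivChar₁ q, fun s hs => ?_⟩
      rw [DirichletCharacter.LFunctionTrivChar₁, Function.update_of_ne hs]
    · refine ⟨fun s => (s - 1) * χ.LFunction s, ?_, fun s _ => rfl⟩
      exact (differentiable_id.sub_const 1).mul (DirichletCharacter.differentiable_LFunction h)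
  obtain ⟨F₁, hF, hFs⟩ := key
  have h := norm_sub_partial_sum_le (c := fun n => χ n) (fun n => χ.norm_le_one n)
    (norm_sum_char_sub_le χ) hF (fun z hz => by
      rw [hFs z (by rintro rfl; simp at hz), DirichletCharacter.LFunction_eq_LSeries χ hz]) hN hs
  rw [hFs s hs1] at h
  have e : (s - 1) * χ.LFunction s - (s - 1) * ∑ n ∈ Finset.Icc 1 N, χ n * (n : ℂ) ^ (-s)
      - charMean χ * (N : ℂ) ^ (1 - s) = (s - 1) * (χ.LFunction s -
        ∑ n ∈ Finset.Icc 1 N, χ n * (n : ℂ) ^ (-s)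
      - charMean χ * (N : ℂ) ^ (1 - s) / (s - 1)) := by
    field_simp
  rw [e, norm_mul] at h
  have h' := le_of_mul_le_mul_left h (norm_pos_iff.2 hs1')
  refine h'.trans ?_
  have hq : (1 : ℝ) ≤ q := by exact_mod_cast NeZero.one_le
  have := norm_charMean_le χ
  gcongr
  linarith

/-- The analytic conductor of `L(s, χ)` in height aspect. -/
noncomputable def tau (q : ℕ) (t : ℝ) : ℝ := q * (|t| + 4)

lemma four_le_tau {q : ℕ} [NeZero q] (t : ℝ) : 4 ≤ tau q t := by
  have hq : (1 : ℝ) ≤ q := by exact_mod_cast NeZero.one_le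
  unfold tau
  nlinarith [abs_nonneg t]

lemma norm_sum_char_cpow_le {q : ℕ} (χ : DirichletCharacter ℂ q) {N : ℕ} (hN : 1 ≤ N) {s : ℂ}
    {ε : ℝ} (hε : 0 < ε) (hs : 1 - ε ≤ s.re) :
    ‖∑ n ∈ Finset.Icc 1 N, χ n * (n : ℂ) ^ (-s)‖ ≤ (1 + 1 / ε) * (N : ℝ) ^ (2 * ε) := by
  have hN1 : (1 : ℝ) ≤ N := by exact_mod_cast hN
  have hN0 : (0 : ℝ) < N := by linarith
  have hterm : ∀ n ∈ Finset.Icc 1 N, ‖χ n * (n : ℂ) ^ (-s)‖ ≤ (N : ℝ) ^ ε * (n : ℝ)⁻¹ := by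
    intro n hn
    rw [Finset.mem_Icc] at hn
    have hn1 : (1 : ℝ) ≤ n := by exact_mod_cast hn.1
    have hn0 : (0 : ℝ) < n := by linarith
    rw [norm_mul, Complex.norm_natCast_cpow_of_pos (by lia)]
    calc ‖χ n‖ * (n : ℝ) ^ (-s).re ≤ 1 * (n : ℝ) ^ (ε - 1) := by
          gcongr
          · exact χ.norm_le_one n
          · simp; linarith
      _ = (n : ℝ) ^ ε * (n : ℝ)⁻¹ := by rw [one_mul, Real.rpow_sub_one hn0.ne']; rfl
      _ ≤ _ := by
          gcongr
          exact_mod_cast hn.2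
  refine (norm_sum_le_of_le _ hterm).trans ?_
  rw [← Finset.mul_sum]
  have h1 : ∑ n ∈ Finset.Icc 1 N, (n : ℝ)⁻¹ ≤ 1 + Real.log N := by
    have := harmonic_le_one_add_log N
    rw [harmonic_eq_sum_Icc] at this
    push_cast at this
    exact this
  have h2 : Real.log N ≤ (N : ℝ) ^ ε / ε := Real.log_le_rpow_div hN0.le hε
  have h3 : 1 ≤ (N : ℝ) ^ ε := Real.one_le_rpow hN1 hε.le
  calc (N : ℝ) ^ ε * ∑ n ∈ Finset.Icc 1 N, (n : ℝ)⁻¹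
      ≤ (N : ℝ) ^ ε * ((N : ℝ) ^ ε + (N : ℝ) ^ ε / ε) := by gcongr; linarith
    _ = (1 + 1 / ε) * ((N : ℝ) ^ ε * (N : ℝ) ^ ε) := by ring
    _ = _ := by rw [← Real.rpow_add hN0]; ring_nf

lemma norm_LFunction_le_aux {ε : ℝ} (hε : 0 < ε) (hε2 : ε ≤ 1 / 2) {q : ℕ} [NeZero q]
    (χ : DirichletCharacter ℂ q) {s : ℂ} (hs : 1 - ε ≤ s.re) (hs4 : s.re ≤ 4) (hs1 : s ≠ 1) :
    ‖χ.LFunction s‖ ≤ (2 * (11 + 1 / ε)) * tau q s.im ^ (2 * ε) *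
      (1 + if χ = 1 then 1 / ‖s - 1‖ else 0) := by
  have ht4 := four_le_tau (q := q) s.im
  set N := ⌈tau q s.im⌉₊ with hNdef
  have hNτ : tau q s.im ≤ N := Nat.le_ceil _
  have hN2 : (N : ℝ) ≤ 2 * tau q s.im := by
    have := (Nat.ceil_lt_add_one (by linarith : 0 ≤ tau q s.im)).le
    linarith
  have hN1r : (1 : ℝ) ≤ N := by linarith
  have hN0 : (0 : ℝ) < N := by linarith
  have hN : 1 ≤ N := by exact_mod_cast hN1r
  have hre : 0 < s.re := by linarith
  have h1 := norm_LFunction_sub_partial_sum_le χ hN hre hs1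
  have h2 := norm_sum_char_cpow_le χ hN hε hs
  have hsn : ‖s‖ ≤ |s.im| + 4 := by
    refine (Complex.norm_le_abs_re_add_abs_im s).trans ?_
    rw [abs_of_pos hre]; linarith
  have hpow : (N : ℝ) ^ (-s.re) ≤ (N : ℝ) ^ (2 * ε) * (N : ℝ)⁻¹ := by
    rw [← Real.rpow_neg_one (N : ℝ), ← Real.rpow_add hN0]
    exact Real.rpow_le_rpow_of_exponent_le hN1r (by linarith)
  have h3 : ‖s‖ * (5 * q * ((N : ℝ) ^ (-s.re) / s.re)) ≤ 10 * (N : ℝ) ^ (2 * ε) := by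
    have hq0 : (0 : ℝ) ≤ q := Nat.cast_nonneg q
    have : (N : ℝ) ^ (-s.re) / s.re ≤ 2 * ((N : ℝ) ^ (2 * ε) * (N : ℝ)⁻¹) := by
      rw [div_le_iff₀ hre]
      have : 0 ≤ (N : ℝ) ^ (2 * ε) * (N : ℝ)⁻¹ := by positivity
      nlinarith
    calc ‖s‖ * (5 * q * ((N : ℝ) ^ (-s.re) / s.re))
        ≤ (|s.im| + 4) * (5 * q * (2 * ((N : ℝ) ^ (2 * ε) * (N : ℝ)⁻¹))) := by gcongr
      _ = 10 * (N : ℝ) ^ (2 * ε) * (tau q s.im * (N : ℝ)⁻¹) := by unfold tau; ring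
      _ ≤ 10 * (N : ℝ) ^ (2 * ε) * 1 := by
          gcongr
          rw [← div_eq_mul_inv]
          exact div_le_one_of_le₀ hNτ hN0.le
      _ = _ := by ring
  have h4 : ‖charMean χ * (N : ℂ) ^ (1 - s) / (s - 1)‖ ≤
      (N : ℝ) ^ (2 * ε) * (if χ = 1 then 1 / ‖s - 1‖ else 0) := by
    split_ifs with h
    · rw [norm_div, norm_mul, Complex.norm_natCast_cpow_of_pos (by lia), div_eq_mul_one_div]
      gcongr
      calc ‖charMean χ‖ * (N : ℝ) ^ (1 - s).re ≤ 1 * (N : ℝ) ^ (2 * ε) := by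
            gcongr
            · exact norm_charMean_le χ
            · simp; linarith
        _ = _ := one_mul _
    · simp [charMean, h]
  have h5 : (N : ℝ) ^ (2 * ε) ≤ 2 * tau q s.im ^ (2 * ε) := by
    calc (N : ℝ) ^ (2 * ε) ≤ (2 * tau q s.im) ^ (2 * ε) := by gcongr
      _ = 2 ^ (2 * ε) * tau q s.im ^ (2 * ε) := Real.mul_rpow (by norm_num) (by linarith)
      _ ≤ 2 ^ (1 : ℝ) * tau q s.im ^ (2 * ε) := by
          gcongr
          · norm_num
          · linarith
      _ = _ := by rw [Real.rpow_one]
  set E : ℝ := if χ = 1 then 1 / ‖s - 1‖ else 0 with hE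
  have hE0 : 0 ≤ E := by rw [hE]; split_ifs <;> positivity
  have e : χ.LFunction s = (χ.LFunction s - ∑ n ∈ Finset.Icc 1 N, χ n * (n : ℂ) ^ (-s)
      - charMean χ * (N : ℂ) ^ (1 - s) / (s - 1)) + ∑ n ∈ Finset.Icc 1 N, χ n * (n : ℂ) ^ (-s)
      + charMean χ * (N : ℂ) ^ (1 - s) / (s - 1) := by ring
  rw [e]
  refine (norm_add₃_le).trans ?_
  have hP : 0 ≤ (N : ℝ) ^ (2 * ε) := by positivity
  have hτ : 0 ≤ tau q s.im ^ (2 * ε) := by positivity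
  have h6 : 0 ≤ 1 / ε := by positivity
  calc _ ≤ 10 * (N : ℝ) ^ (2 * ε) + (1 + 1 / ε) * (N : ℝ) ^ (2 * ε) + (N : ℝ) ^ (2 * ε) * E := by
        linarith
    _ = (N : ℝ) ^ (2 * ε) * ((11 + 1 / ε) + E) := by ring
    _ ≤ (2 * tau q s.im ^ (2 * ε)) * ((11 + 1 / ε) * (1 + E)) := by
        gcongr
        nlinarith
    _ = _ := by ring

lemma norm_LFunction_le_of_ne_one {ε : ℝ} (hε : 0 < ε) (hε2 : ε ≤ 1 / 2) {q : ℕ} [NeZero q]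
    {χ : DirichletCharacter ℂ q} (hχ : χ ≠ 1) {s : ℂ} (hs : 1 - ε ≤ s.re) (hs4 : s.re ≤ 4) :
    ‖χ.LFunction s‖ ≤ (2 * (11 + 1 / ε)) * tau q s.im ^ (2 * ε) := by
  rcases eq_or_ne s 1 with rfl | h
  · have hc : Continuous (fun u : ℝ => ‖χ.LFunction (1 + u * I)‖) :=
      ((DirichletCharacter.differentiable_LFunction hχ).continuous.comp (by fun_prop)).norm
    have hc2 : Continuous (fun u : ℝ => (2 * (11 + 1 / ε)) * tau q u ^ (2 * ε)) := by
      refine continuous_const.mul (Continuous.rpow_const ?_ fun u => Or.inr (by positivity))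
      unfold tau; fun_prop
    have hev : ∀ᶠ u : ℝ in 𝓝[≠] 0, ‖χ.LFunction (1 + u * I)‖ ≤
        (2 * (11 + 1 / ε)) * tau q u ^ (2 * ε) := by
      filter_upwards [self_mem_nhdsWithin] with u hu
      have := norm_LFunction_le_aux hε hε2 χ (s := 1 + u * I) (by simp; linarith)
        (by simp) (by
          intro h
          have := congrArg Complex.im h
          simp at this
          exact hu this)
      simpa [hχ] using this
    have := le_of_tendsto_of_tendsto (hc.continuousAt.mono_left nhdsWithin_le_nhds)
      (hc2.continuousAt.mono_left nhdsWithin_le_nhds) hev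
    simpa using this
  · simpa [hχ] using norm_LFunction_le_aux hε hε2 χ hs hs4 h

lemma norm_LFunction_le {ε : ℝ} (hε : 0 < ε) (hε2 : ε ≤ 1 / 2) {q : ℕ} [NeZero q]
    (χ : DirichletCharacter ℂ q) {s : ℂ} (hs : 1 - ε ≤ s.re) (hs4 : s.re ≤ 4) (hs1 : s ≠ 1) :
    ‖χ.LFunction s‖ ≤ (2 * (11 + 1 / ε)) * tau q s.im ^ (2 * ε) * (1 + 1 / ‖s - 1‖) := by
  refine (norm_LFunction_le_aux hε hε2 χ hs hs4 hs1).trans ?_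
  have := four_le_tau (q := q) s.im
  gcongr
  split_ifs <;> simp

end VarianceBDH

namespace VarianceBDH

open Complex MeasureTheory Set Filter Topology
open scoped ComplexOrder

lemma iteratedDeriv_alternating_of_deriv_eq {F : ℂ → ℂ} {h : ℕ → ℂ} (h0 : 0 ≤ h) {x : ℝ}
    (hx : LSeries.abscissaOfAbsConv h < x) (hF : AnalyticAt ℂ F x)
    (hd : deriv F =ᶠ[𝓝 (x : ℂ)] fun s => -(LSeries h s * F s)) (hF0 : 0 ≤ F x) (m : ℕ) :
    0 ≤ (-1) ^ m * iteratedDeriv m F x := by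
  have hH : AnalyticAt ℂ (LSeries h) x := LSeries_analyticOnNhd h x (by simpa using hx)
  induction m using Nat.strong_induction_on with
  | _ m ih =>
    rcases m with _ | m
    · simpa using hF0
    · have e : (-1) ^ (m + 1) * iteratedDeriv (m + 1) F x = ∑ i ∈ Finset.range (m + 1),
          (m.choose i : ℂ) * ((-1) ^ i * iteratedDeriv i (LSeries h) x) *
            ((-1) ^ (m - i) * iteratedDeriv (m - i) F x) := by
        rw [iteratedDeriv_succ', hd.iteratedDeriv_eq, iteratedDeriv_fun_neg,
          iteratedDeriv_fun_mul hH.contDiffAt hF.contDiffAt, pow_succ, mul_neg_one, neg_mul_neg,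
          Finset.mul_sum]
        refine Finset.sum_congr rfl fun i hi => ?_
        have : (-1 : ℂ) ^ m = (-1) ^ i * (-1) ^ (m - i) := by
          rw [← pow_add, Nat.add_sub_cancel' (by simpa [Nat.lt_succ_iff] using hi)]
        rw [this]; ring
      rw [e]
      refine Finset.sum_nonneg fun i hi => mul_nonneg (mul_nonneg ?_ ?_) ?_
      · positivity
      · exact LSeries.iteratedDeriv_alternating h0 hx i
      · exact ih (m - i) (by lia)

/-- Estermann's device: a lower bound for the residue of a Dirichlet series with nonnegative
coefficients which is nonpositive at a point `β < 1` close to `1`. -/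
lemma residue_lower_bound {F f : ℂ → ℂ} {h : ℕ → ℂ} {lam : ℂ} {B : ℝ} (h0 : 0 ≤ h)
    (hx : LSeries.abscissaOfAbsConv h < (2 : ℝ)) (hf : Differentiable ℂ f)
    (hFf : ∀ s ≠ 1, F s = f s + lam / (s - 1))
    (hd : deriv F =ᶠ[𝓝 (2 : ℂ)] fun s => -(LSeries h s * F s)) {c : ℝ} (hc : 0 < c)
    (hF0 : (c : ℂ) ≤ F 2) (hB1 : c ≤ B) (hB : ∀ s : ℂ, ‖s - 2‖ = 3 / 2 → ‖f s‖ ≤ B)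
    {β : ℝ} (hβ : 7 / 8 ≤ β) (hβ1 : β < 1) (hFβ : (F β).re ≤ 0) :
    c * (1 - β) / 4 * (8 * B / c) ^ (-(4 * (1 - β))) ≤ ‖lam‖ := by
  have hB0 : 0 < B := hc.trans_le hB1
  set b : ℕ → ℂ := fun m => (-1) ^ m * iteratedDeriv m f 2 / m.factorial with hb
  set a : ℕ → ℂ := fun m => (-1) ^ m * iteratedDeriv m F 2 / m.factorial with ha
  have hsum : ∀ z : ℂ, HasSum (fun m => b m * (2 - z) ^ m) (f z) := by
    intro z
    refine (Complex.hasSum_taylorSeries_of_entire hf 2 z).congr_fun ?_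
    intro m
    simp only [hb, smul_eq_mul]
    rw [show (z - 2) = (-1) * (2 - z) by ring, mul_pow]
    ring
  have hbB : ∀ m, ‖b m‖ ≤ B * (2 / 3) ^ m := by
    intro m
    have := Complex.norm_iteratedDeriv_le_of_forall_mem_sphere_norm_le m (R := 3 / 2) (C := B)
      (c := 2) (by norm_num) hf.diffContOnCl (fun z hz => hB z (by simpa [dist_eq_norm] using hz))
    simp only [hb, norm_div, norm_mul, norm_pow, norm_neg, norm_one, one_pow, one_mul,
      Complex.norm_natCast]
    rw [div_le_iff₀ (by positivity)]
    refine this.trans (le_of_eq ?_)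
    rw [div_eq_mul_inv, ← inv_pow]
    norm_num
    ring
  have hFan : AnalyticAt ℂ F (2 : ℝ) := by
    have h1 : AnalyticAt ℂ (fun s => f s + lam / (s - 1)) (2 : ℝ) := by
      refine (hf.analyticAt _).add (analyticAt_const.div (analyticAt_id.sub analyticAt_const) ?_)
      norm_num
    refine h1.congr ?_
    filter_upwards [isOpen_ne.mem_nhds (show ((2 : ℝ) : ℂ) ≠ 1 by norm_num)] with s hs
    exact (hFf s hs).symm
  have hF00 : 0 ≤ F 2 := le_trans (by exact_mod_cast hc.le) hF0
  have ha0 : ∀ m, 0 ≤ (a m).re := by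
    intro m
    have := iteratedDeriv_alternating_of_deriv_eq h0 hx hFan (by simpa using hd)
      (by simpa using hF00) m
    have h2 : 0 ≤ a m := by
      simp only [ha]
      refine div_nonneg (by simpa using this) (by positivity)
    exact (Complex.le_def.1 h2).1
  have hinv : ∀ m, iteratedDeriv m (fun s : ℂ => lam / (s - 1)) 2 =
      (-1) ^ m * m.factorial * lam := by
    intro m
    have h1 : ∀ m, ∀ s : ℂ, iteratedDeriv m (fun s : ℂ => lam / (s - 1)) s =
        (-1) ^ m * m.factorial * (lam / (s - 1) ^ (m + 1)) := by
      intro m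
      have h3 := iteratedDeriv_comp_sub_const (𝕜 := ℂ) (F := ℂ) m (fun s : ℂ => lam * s⁻¹) 1
      intro s
      have h4 := congrFun h3 s
      simp only [div_eq_mul_inv]
      rw [h4, iteratedDeriv_const_mul_field, iteratedDeriv_eq_iterate, iter_deriv_inv]
      rw [show (-1 - (m : ℤ)) = -((m + 1 : ℕ) : ℤ) by push_cast; ring, zpow_neg, zpow_natCast]
      ring
    rw [h1]
    norm_num
  have hab : ∀ m, b m = a m - lam := by
    intro m
    have h1 : iteratedDeriv m F 2 = iteratedDeriv m f 2 + (-1) ^ m * m.factorial * lam := by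
      rw [← hinv, ← iteratedDeriv_fun_add hf.contDiff.contDiffAt]
      · refine Filter.EventuallyEq.iteratedDeriv_eq _ ?_
        filter_upwards [isOpen_ne.mem_nhds (show (2 : ℂ) ≠ 1 by norm_num)] with s hs
        exact hFf s hs
      · refine (contDiffAt_const.div (contDiffAt_id.sub contDiffAt_const) ?_)
        norm_num
    have h2 : (m.factorial : ℂ) ≠ 0 := by exact_mod_cast m.factorial_ne_zero
    have h3 : ((-1 : ℂ) ^ m) * (-1) ^ m = 1 := by rw [← pow_add, Even.neg_one_pow ⟨m, rfl⟩]
    simp only [hb, ha, h1]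
    field_simp
    linear_combination (-lam * m.factorial) * h3
  set w : ℝ := 2 - β with hw
  have hw1 : 1 < w := by linarith
  have hw2 : w ≤ 9 / 8 := by linarith
  set M : ℕ := ⌈4 * Real.log (8 * B / c)⌉₊ with hM
  have h8B : 8 ≤ 8 * B / c := by rw [le_div_iff₀ hc]; linarith
  have hlog0 : 0 < Real.log (8 * B / c) := Real.log_pos (by linarith)
  have hMlow : 4 * Real.log (8 * B / c) ≤ M := Nat.le_ceil _
  have hMup : (M : ℝ) ≤ 4 * Real.log (8 * B / c) + 1 := (Nat.ceil_lt_add_one (by positivity)).le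
  have hM1 : 1 ≤ M := by
    rw [Nat.one_le_iff_ne_zero]; rintro h; rw [h] at hMlow; norm_num at hMlow; linarith
  -- the tail of the Taylor series
  have htail : ‖f β - ∑ m ∈ Finset.range M, b m * (w : ℂ) ^ m‖ ≤ c / 2 := by
    have hs := hsum β
    have hw' : (2 : ℂ) - β = (w : ℂ) := by rw [hw]; push_cast; ring
    rw [hw'] at hs
    have hterm : ∀ m, ‖b m * (w : ℂ) ^ m‖ ≤ B * (3 / 4) ^ m := by
      intro m
      rw [norm_mul, norm_pow, Complex.norm_real, Real.norm_of_nonneg (by linarith)]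
      calc ‖b m‖ * w ^ m ≤ (B * (2 / 3) ^ m) * (9 / 8) ^ m := by
            gcongr
            exact hbB m
        _ = B * ((2 / 3) * (9 / 8)) ^ m := by rw [mul_pow]; ring
        _ = _ := by norm_num
    have hgeo : HasSum (fun m : ℕ => B * (3 / 4 : ℝ) ^ m) (B * 4) := by
      have := (hasSum_geometric_of_lt_one (r := 3 / 4) (by norm_num) (by norm_num)).mul_left B
      norm_num at this
      norm_num
      exact this
    have hs2 := (hasSum_nat_add_iff' M).2 hs
    have hg2 : HasSum (fun m : ℕ => B * (3 / 4 : ℝ) ^ (m + M)) (B * 4 * (3 / 4) ^ M) := by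
      have := hgeo.mul_right ((3 / 4 : ℝ) ^ M)
      refine this.congr_fun ?_
      intro m
      rw [pow_add]; ring
    rw [← hs2.tsum_eq]
    refine (tsum_of_norm_bounded hg2 fun m => hterm _).trans ?_
    have h34 : (3 / 4 : ℝ) ^ M ≤ c / (8 * B) := by
      have hl : (1 / 4 : ℝ) ≤ -Real.log (3 / 4) := by
        have := Real.log_le_sub_one_of_pos (show (0 : ℝ) < 3 / 4 by norm_num)
        linarith
      rw [← Real.log_le_log_iff (by positivity) (by positivity), Real.log_pow,
        show c / (8 * B) = (8 * B / c)⁻¹ by rw [inv_div], Real.log_inv]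
      nlinarith
    calc B * 4 * (3 / 4 : ℝ) ^ M ≤ B * 4 * (c / (8 * B)) := by gcongr
      _ = c / 2 := by field_simp; norm_num
  have hmain : c / 2 ≤ ‖lam‖ * (w ^ M / (1 - β)) := by
    have hne : (β : ℂ) ≠ 1 := by exact_mod_cast hβ1.ne
    have h1 : F β = (f β - ∑ m ∈ Finset.range M, b m * (w : ℂ) ^ m) +
        ∑ m ∈ Finset.range M, a m * (w : ℂ) ^ m - lam * ((w ^ M / (1 - β) : ℝ) : ℂ) := by
      rw [hFf _ hne]
      have hgs : ∑ m ∈ Finset.range M, (w : ℂ) ^ m = ((w : ℂ) ^ M - 1) / ((w : ℂ) - 1) :=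
        geom_sum_eq (by exact_mod_cast hw1.ne') M
      simp only [hab, sub_mul, Finset.sum_sub_distrib, ← Finset.mul_sum, hgs]
      have hne1 : (1 : ℂ) - β ≠ 0 := by rw [sub_ne_zero]; exact hne.symm
      have hne2 : (β : ℂ) - 1 ≠ 0 := by rw [sub_ne_zero]; exact hne
      have : (w : ℂ) - 1 = 1 - β := by rw [hw]; push_cast; ring
      rw [this, show (β : ℂ) - 1 = -(1 - β) by ring]
      push_cast
      field_simp
      ring
    have h2 : c ≤ (∑ m ∈ Finset.range M, a m * (w : ℂ) ^ m).re := by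
      rw [Complex.re_sum]
      have h3 : ∀ m, (a m * (w : ℂ) ^ m).re = (a m).re * w ^ m := by
        intro m
        rw [← Complex.ofReal_pow, Complex.re_mul_ofReal]
      simp only [h3]
      have h4 : c ≤ (a 0).re * w ^ 0 := by
        have := (Complex.le_def.1 hF0).1
        simpa [ha] using this
      refine h4.trans (Finset.single_le_sum (f := fun m => (a m).re * w ^ m) (fun m _ =>
        mul_nonneg (ha0 m) (by positivity)) (Finset.mem_range.2 hM1))
    have h5 := (abs_le.1 ((Complex.abs_re_le_norm _).trans htail)).1
    have h6 : (lam * ((w ^ M / (1 - β) : ℝ) : ℂ)).re ≤ ‖lam‖ * (w ^ M / (1 - β)) := by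
      rw [Complex.re_mul_ofReal]
      have : 0 ≤ w ^ M / (1 - β) := div_nonneg (by positivity) (by linarith)
      gcongr
      exact (le_abs_self _).trans (Complex.abs_re_le_norm _)
    have h7 := congrArg Complex.re h1
    rw [Complex.sub_re, Complex.add_re] at h7
    linarith
  have hwM : w ^ M ≤ 2 * (8 * B / c) ^ (4 * (1 - β)) := by
    have h1 : w ≤ Real.exp (1 - β) := by
      have := Real.add_one_le_exp (1 - β); linarith
    calc w ^ M ≤ Real.exp (1 - β) ^ M := by gcongr
      _ = Real.exp (M * (1 - β)) := by rw [← Real.exp_nat_mul]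
      _ ≤ Real.exp ((4 * Real.log (8 * B / c) + 1) * (1 - β)) := by
          apply Real.exp_le_exp.2
          have : 0 ≤ 1 - β := by linarith
          gcongr
      _ = Real.exp (1 - β) * (8 * B / c) ^ (4 * (1 - β)) := by
          rw [Real.rpow_def_of_pos (by linarith), ← Real.exp_add]; ring_nf
      _ ≤ _ := by
          gcongr
          calc Real.exp (1 - β) ≤ Real.exp (1 / 8) := Real.exp_le_exp.2 (by linarith)
            _ ≤ 2 := by
              have := Real.exp_bound_div_one_sub_of_interval (x := 1 / 8) (by norm_num) (by norm_num)
              refine this.trans (by norm_num)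
  have h1β : 0 < 1 - β := by linarith
  set P := (8 * B / c) ^ (4 * (1 - β)) with hP
  have hP0 : 0 < P := by positivity
  rw [Real.rpow_neg (by linarith), ← hP, ← div_eq_mul_inv, div_le_iff₀ hP0]
  have h8 : c / 2 ≤ ‖lam‖ * (2 * P / (1 - β)) := hmain.trans (by gcongr)
  rw [← mul_div_assoc, le_div_iff₀ h1β] at h8
  linarith

end VarianceBDH

namespace VarianceBDH

open Complex MeasureTheory Set Filter Topology
open scoped ComplexOrder
open scoped ArithmeticFunction.vonMangoldt

lemma riemannZeta_two_real : ∃ r : ℝ, 1 ≤ r ∧ r ≤ 1.7 ∧ riemannZeta 2 = r := by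
  refine ⟨Real.pi ^ 2 / 6, ?_, ?_, ?_⟩
  · nlinarith [Real.pi_gt_three]
  · nlinarith [Real.pi_lt_d2, Real.pi_gt_three]
  · rw [riemannZeta_two]; push_cast; rfl

lemma norm_LFunction_two_sub_one_le {q : ℕ} [NeZero q] (χ : DirichletCharacter ℂ q) :
    ‖χ.LFunction 2 - 1‖ ≤ 0.7 := by
  have h1 : (1 : ℝ) < (2 : ℂ).re := by norm_num
  rw [DirichletCharacter.LFunction_eq_LSeries χ h1]
  have hs : HasSum (LSeries.term (fun n => χ n) 2) (LSeries (fun n => χ n) 2) :=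
    (DirichletCharacter.LSeriesSummable_of_one_lt_re χ h1).hasSum
  have hs1 := hs.sub (hasSum_ite_eq (1 : ℕ) (1 : ℂ))
  have hz := (hasSum_zeta_two).sub (hasSum_ite_eq (1 : ℕ) (1 : ℝ))
  rw [← hs1.tsum_eq]
  refine (tsum_of_norm_bounded hz fun n => ?_).trans ?_
  · rcases eq_or_ne n 0 with rfl | hn
    · simp
    by_cases hn1 : n = 1
    · subst hn1; simp [LSeries.term]
    · rw [if_neg hn1, if_neg hn1, sub_zero, sub_zero, LSeries.term_of_ne_zero hn, norm_div]
      have : ‖(n : ℂ) ^ (2 : ℂ)‖ = (n : ℝ) ^ 2 := by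
        rw [show (2 : ℂ) = ((2 : ℕ) : ℂ) by norm_num, Complex.cpow_natCast, norm_pow,
          Complex.norm_natCast]
      rw [this]
      gcongr
      exact χ.norm_le_one n
  · nlinarith [Real.pi_lt_d2, Real.pi_gt_three]

lemma LFunction_real_of_quadratic {q : ℕ} [NeZero q] {χ : DirichletCharacter ℂ q} (hχ : χ ≠ 1)
    (hq : MulChar.IsQuadratic χ) {s : ℝ} (hs : 0 < s) : (χ.LFunction s).im = 0 := by
  by_cases hs1 : (s : ℂ) = 1
  · -- by continuity from the points to the right of `1`
    have hs1' : s = 1 := by exact_mod_cast hs1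
    subst hs1'
    have hc : Continuous (fun u : ℝ => (χ.LFunction (u : ℂ)).im) :=
      Complex.continuous_im.comp
        ((DirichletCharacter.differentiable_LFunction hχ).continuous.comp Complex.continuous_ofReal)
    have h2 : Tendsto (fun u : ℝ => (χ.LFunction (u : ℂ)).im) (𝓝[>] 1) (𝓝 0) := by
      refine tendsto_const_nhds.congr' ?_
      filter_upwards [self_mem_nhdsWithin] with u hu
      have hu : 1 < u := hu
      rw [DirichletCharacter.LFunction_eq_LSeries χ (by simpa using hu), LSeries,
        Complex.im_tsum]
      · symm
        rw [← tsum_zero (β := ℕ)]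
        refine tsum_congr fun n => ?_
        rcases eq_or_ne n 0 with rfl | hn
        · simp
        · rw [LSeries.term_of_ne_zero hn, ← Complex.ofReal_natCast, ← Complex.ofReal_cpow
            (Nat.cast_nonneg n), Complex.div_ofReal_im]
          rcases hq n with h | h | h <;> simp [h]
      · exact DirichletCharacter.LSeriesSummable_of_one_lt_re χ (by simpa using hu)
    exact tendsto_nhds_unique (hc.continuousAt.mono_left nhdsWithin_le_nhds) h2
  · have hlim : Tendsto (fun N : ℕ => (∑ n ∈ Finset.Icc 1 N, χ n * (n : ℂ) ^ (-(s : ℂ))))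
        atTop (𝓝 (χ.LFunction s)) := by
      rw [tendsto_iff_norm_sub_tendsto_zero]
      have hb : Tendsto (fun N : ℕ => ‖(s : ℂ)‖ * (5 * q * ((N : ℝ) ^ (-s) / s))) atTop
          (𝓝 (‖(s : ℂ)‖ * (5 * q * (0 / s)))) := by
        refine Tendsto.const_mul _ (Tendsto.const_mul _ (Tendsto.div_const ?_ _))
        exact (tendsto_rpow_neg_atTop hs).comp tendsto_natCast_atTop_atTop
      simp only [zero_div, mul_zero] at hb
      refine tendsto_of_tendsto_of_tendsto_of_le_of_le' tendsto_const_nhds hb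
        (Eventually.of_forall fun _ => norm_nonneg _) ?_
      filter_upwards [eventually_ge_atTop 1] with N hN
      have := norm_LFunction_sub_partial_sum_le χ hN (s := s) (by simpa using hs) hs1
      rw [norm_sub_rev]
      simpa [charMean, hχ] using this
    have him := (Complex.continuous_im.tendsto _).comp hlim
    refine tendsto_nhds_unique him (tendsto_const_nhds.congr fun N => ?_)
    simp only [Function.comp, Complex.im_sum]
    symm
    refine Finset.sum_eq_zero fun n _ => ?_
    rw [← Complex.ofReal_natCast, ← Complex.ofReal_neg, ← Complex.ofReal_cpow
            (Nat.cast_nonneg n), Complex.im_mul_ofReal]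
    rcases hq n with h | h | h <;> simp [h]

lemma LFunction_two_quadratic {q : ℕ} [NeZero q] {χ : DirichletCharacter ℂ q} (hχ : χ ≠ 1)
    (hq : MulChar.IsQuadratic χ) :
    ∃ r : ℝ, 1 / 4 ≤ r ∧ χ.LFunction 2 = r := by
  refine ⟨(χ.LFunction 2).re, ?_, ?_⟩
  · have h1 := norm_LFunction_two_sub_one_le χ
    have h2 := (abs_le.1 ((Complex.abs_re_le_norm _).trans h1)).1
    rw [Complex.sub_re, Complex.one_re] at h2
    linarith
  · have := LFunction_real_of_quadratic hχ hq (s := 2) (by norm_num)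
    apply Complex.ext
    · simp
    · simpa using this

lemma deriv_LFunction_eq_neg_mul {q : ℕ} [NeZero q] (χ : DirichletCharacter ℂ q) {s : ℂ}
    (hs : 1 < s.re) :
    deriv χ.LFunction s = -(LSeries (fun n => χ n * (Λ n : ℂ)) s * χ.LFunction s) := by
  have h1 := DirichletCharacter.LSeries_twist_vonMangoldt_eq χ hs
  have h2 : χ.LFunction s ≠ 0 := by
    apply DirichletCharacter.LFunction_ne_zero_of_one_le_re χ (Or.inr ?_) hs.le
    rintro rfl; simp at hs
  rw [← DirichletCharacter.deriv_LFunction_eq_deriv_LSeries χ hs,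
    ← DirichletCharacter.LFunction_eq_LSeries χ hs] at h1
  have h3 : LSeries (fun n => χ n * (Λ n : ℂ)) s = -deriv χ.LFunction s / χ.LFunction s := h1
  rw [h3]; field_simp

/-- The entire function `(s - 1) ζ(s)`. -/
noncomputable def zetaOne : ℂ → ℂ := DirichletCharacter.LFunctionTrivChar₁ 1

lemma differentiable_zetaOne : Differentiable ℂ zetaOne :=
  DirichletCharacter.differentiable_LFunctionTrivChar₁ 1

lemma zetaOne_of_ne {s : ℂ} (hs : s ≠ 1) : zetaOne s = (s - 1) * riemannZeta s := by
  rw [zetaOne, DirichletCharacter.LFunctionTrivChar₁, Function.update_of_ne hs,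
    DirichletCharacter.LFunctionTrivChar, DirichletCharacter.LFunction_modOne_eq]

lemma zetaOne_one : zetaOne 1 = 1 := by
  rw [zetaOne, DirichletCharacter.LFunctionTrivChar₁, Function.update_self]
  simp

lemma norm_riemannZeta_le {ε : ℝ} (hε : 0 < ε) (hε2 : ε ≤ 1 / 2) {s : ℂ} (hs : 1 - ε ≤ s.re)
    (hs4 : s.re ≤ 4) (hs1 : s ≠ 1) :
    ‖riemannZeta s‖ ≤ (2 * (11 + 1 / ε)) * tau 1 s.im ^ (2 * ε) * (1 + 1 / ‖s - 1‖) := by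
  rw [← DirichletCharacter.LFunction_modOne_eq (χ := 1)]
  exact norm_LFunction_le hε hε2 _ hs hs4 hs1

lemma sphere_two_bounds {s : ℂ} (hs : ‖s - 2‖ = 3 / 2) :
    1 / 2 ≤ s.re ∧ s.re ≤ 4 ∧ |s.im| ≤ 3 / 2 ∧ 1 / 2 ≤ ‖s - 1‖ := by
  have h1 := abs_le.1 ((Complex.abs_re_le_norm (s - 2)).trans hs.le)
  have h2 := (Complex.abs_im_le_norm (s - 2)).trans hs.le
  simp at h1 h2
  refine ⟨by linarith, by linarith, h2, ?_⟩
  have h3 : ‖s - 2‖ ≤ ‖s - 1‖ + ‖(1 : ℂ)‖ := by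
    refine le_trans (le_of_eq ?_) (norm_sub_le (s - 1) 1)
    ring_nf
  rw [hs, norm_one] at h3
  linarith

lemma zeta_mul_lower_bound {P : ℂ → ℂ} {g : ℕ → ℂ} {B c : ℝ} (hP : Differentiable ℂ P)
    (hPd : ∀ s : ℂ, 1 < s.re → deriv P s = -(LSeries g s * P s))
    (hg : ∀ n, 0 ≤ (Λ n : ℂ) + g n) (hgs : ∀ s : ℂ, 1 < s.re → LSeriesSummable g s)
    (hc : 0 < c) (hP2 : (c : ℂ) ≤ P 2) (hcB : c ≤ B)
    (hPB : ∀ s : ℂ, 1 / 2 ≤ s.re → s.re ≤ 4 → |s.im| ≤ 3 / 2 → ‖P s‖ ≤ B)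
    {β : ℝ} (hβ : 7 / 8 ≤ β) (hβ1 : β < 1) (hFβ : (riemannZeta β * P β).re ≤ 0) :
    c * (1 - β) / 4 * (8 * (500 * B) / c) ^ (-(4 * (1 - β))) ≤ ‖P 1‖ := by
  have hB0 : 0 < B := hc.trans_le hcB
  set f : ℂ → ℂ := dslope (fun s => zetaOne s * P s) 1 with hf
  have hfd : Differentiable ℂ f := by
    rw [← differentiableOn_univ, hf, Complex.differentiableOn_dslope univ_mem]
    exact (differentiable_zetaOne.mul hP).differentiableOn
  have hfF : ∀ s ≠ 1, riemannZeta s * P s = f s + P 1 / (s - 1) := by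
    intro s hs
    have hs' : s - 1 ≠ 0 := sub_ne_zero.2 hs
    rw [hf, dslope_of_ne _ hs, slope_def_field, zetaOne_of_ne hs, zetaOne_one]
    field_simp
    ring
  have hsum : ∀ s : ℂ, 1 < s.re → LSeriesSummable (fun n => (Λ n : ℂ) + g n) s := fun s hs =>
    LSeriesSummable.add (ArithmeticFunction.LSeriesSummable_vonMangoldt hs) (hgs s hs)
  refine residue_lower_bound (F := fun s => riemannZeta s * P s) (f := f)
    (h := fun n => (Λ n : ℂ) + g n) (fun n => hg n) ?_ hfd hfF ?_ hc ?_ (by linarith) ?_ hβ hβ1 hFβ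
  · refine lt_of_le_of_lt (LSeries.abscissaOfAbsConv_le_of_forall_lt_LSeriesSummable (x := 1)
      fun y hy => hsum y (by simpa using hy)) ?_
    exact_mod_cast (by norm_num : (1 : ℝ) < 2)
  · have hopen : IsOpen {s : ℂ | 1 < s.re} := isOpen_lt continuous_const Complex.continuous_re
    filter_upwards [hopen.mem_nhds (show (2 : ℂ) ∈ {s : ℂ | 1 < s.re} by norm_num)] with s hs
    have hs : 1 < s.re := hs
    have hs1 : s ≠ 1 := by rintro rfl; simp at hs
    have hz0 : riemannZeta s ≠ 0 := riemannZeta_ne_zero_of_one_lt_re hs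
    have hz := ArithmeticFunction.LSeries_vonMangoldt_eq_deriv_riemannZeta_div hs
    have hz' : deriv riemannZeta s = -(LSeries (fun n => (Λ n : ℂ)) s * riemannZeta s) := by
      rw [hz]; field_simp
    have hadd : LSeries (fun n => (Λ n : ℂ) + g n) s =
        LSeries (fun n => (Λ n : ℂ)) s + LSeries g s :=
      LSeries_add (ArithmeticFunction.LSeriesSummable_vonMangoldt hs) (hgs s hs)
    rw [deriv_fun_mul (differentiableAt_riemannZeta hs1) (hP s), hz', hPd s hs, hadd]
    ring
  · obtain ⟨r, hr1, -, hr⟩ := riemannZeta_two_real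
    simp only [hr]
    have h1 : (1 : ℂ) ≤ r := by exact_mod_cast hr1
    have h0 : (0 : ℂ) ≤ P 2 := le_trans (by exact_mod_cast hc.le) hP2
    calc (c : ℂ) ≤ 1 * P 2 := by rw [one_mul]; exact hP2
      _ ≤ r * P 2 := mul_le_mul_of_nonneg_right h1 h0
  · intro s hs
    obtain ⟨h1, h2, h3, h4⟩ := sphere_two_bounds hs
    have hs1 : s ≠ 1 := by rintro rfl; norm_num at h4
    have e : f s = riemannZeta s * P s - P 1 / (s - 1) := by rw [hfF s hs1]; ring
    have hz := norm_riemannZeta_le (ε := 1 / 2) (by norm_num) le_rfl (s := s) (by linarith) h2 hs1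
    have hz2 : ‖riemannZeta s‖ ≤ 430 := by
      refine hz.trans ?_
      norm_num
      unfold tau
      push_cast
      have : ‖s - 1‖⁻¹ ≤ 2 := by
        rw [inv_le_comm₀ (by linarith) (by norm_num)]; linarith
      calc 26 * (1 * (|s.im| + 4)) * (1 + ‖s - 1‖⁻¹) ≤ 26 * (1 * (3 / 2 + 4)) * (1 + 2) := by
            gcongr
        _ ≤ 430 := by norm_num
    rw [e]
    refine (norm_sub_le _ _).trans ?_
    rw [norm_mul, norm_div]
    have hPs := hPB s h1 h2 h3
    have hP1 := hPB 1 (by norm_num) (by norm_num) (by norm_num)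
    calc ‖riemannZeta s‖ * ‖P s‖ + ‖P 1‖ / ‖s - 1‖ ≤ 430 * B + B / (1 / 2) := by gcongr
      _ ≤ 500 * B := by linarith

lemma changeLevel_apply_natCast {n m : ℕ} [NeZero m] (h : n ∣ m) (χ : DirichletCharacter ℂ n)
    (a : ℕ) : DirichletCharacter.changeLevel h χ a = if a.Coprime m then χ a else 0 := by
  split_ifs with hc
  · have hu : IsUnit (a : ZMod m) := (ZMod.isUnit_iff_coprime a m).2 hc
    obtain ⟨u, hu⟩ := hu
    rw [← hu, DirichletCharacter.changeLevel_eq_cast_of_dvd, hu, ZMod.cast_natCast h]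
  · exact MulChar.map_nonunit _ (by rwa [ZMod.isUnit_iff_coprime])

lemma apply_natCast_eq_zero {n : ℕ} (χ : DirichletCharacter ℂ n) {a : ℕ} (h : ¬ a.Coprime n) :
    χ a = 0 := MulChar.map_nonunit _ (by rwa [ZMod.isUnit_iff_coprime])

/-- The product of two Dirichlet characters, as a character modulo the product of the levels. -/
noncomputable def charMul {m n : ℕ} (χ : DirichletCharacter ℂ m) (ψ : DirichletCharacter ℂ n) :
    DirichletCharacter ℂ (m * n) :=
  DirichletCharacter.changeLevel (Nat.dvd_mul_right m n) χ *
    DirichletCharacter.changeLevel (Nat.dvd_mul_left n m) ψ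

lemma charMul_apply {m n : ℕ} [NeZero m] [NeZero n] (χ : DirichletCharacter ℂ m)
    (ψ : DirichletCharacter ℂ n) (a : ℕ) : charMul χ ψ a = χ a * ψ a := by
  rw [charMul, MulChar.mul_apply, changeLevel_apply_natCast, changeLevel_apply_natCast]
  split_ifs with h
  · rfl
  · rw [Nat.coprime_mul_iff_right, not_and_or] at h
    rcases h with h | h <;> simp [apply_natCast_eq_zero _ h]

lemma charMul_ne_one {m n : ℕ} [NeZero m] [NeZero n] {χ : DirichletCharacter ℂ m}
    {ψ : DirichletCharacter ℂ n} (hχ : χ.IsPrimitive) (hψ : ψ.IsPrimitive) (hmn : m ≠ n) :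
    charMul χ ψ ≠ 1 := by
  intro h
  apply hmn
  have h1 := DirichletCharacter.conductor_changeLevel (χ := χ) (Nat.dvd_mul_right m n)
  have h2 := DirichletCharacter.conductor_changeLevel (χ := ψ) (Nat.dvd_mul_left n m)
  rw [charMul] at h
  have h3 := eq_inv_of_mul_eq_one_left h
  rw [h3, DirichletCharacter.conductor_inv, h2] at h1
  rw [DirichletCharacter.isPrimitive_def] at hχ hψ
  rw [← hχ, ← hψ, h1]

lemma isQuadratic_charMul {m n : ℕ} [NeZero m] [NeZero n] {χ : DirichletCharacter ℂ m}
    {ψ : DirichletCharacter ℂ n} (hχ : MulChar.IsQuadratic χ) (hψ : MulChar.IsQuadratic ψ) :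
    MulChar.IsQuadratic (charMul χ ψ) := by
  intro a
  obtain ⟨k, rfl⟩ := ZMod.natCast_zmod_surjective a
  rw [charMul_apply]
  rcases hχ k with h | h | h <;> rcases hψ k with h' | h' | h' <;> simp [h, h']

lemma norm_LFunction_le_box {q : ℕ} [NeZero q] {χ : DirichletCharacter ℂ q} (hχ : χ ≠ 1) {s : ℂ}
    (h1 : 1 / 2 ≤ s.re) (h2 : s.re ≤ 4) (h3 : |s.im| ≤ 3 / 2) :
    ‖χ.LFunction s‖ ≤ 143 * q := by
  have := norm_LFunction_le_of_ne_one (ε := 1 / 2) (by norm_num) le_rfl hχ (s := s) (by linarith) h2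
  refine this.trans ?_
  norm_num
  unfold tau
  calc 26 * (q * (|s.im| + 4)) ≤ 26 * (q * (3 / 2 + 4)) := by gcongr
    _ = 143 * (q : ℝ) := by ring

lemma riemannZeta_re_nonpos {β : ℝ} (hβ : 7 / 8 ≤ β) (hβ1 : β < 1) : (riemannZeta β).re ≤ 0 := by
  have hne : (β : ℂ) ≠ 1 := by exact_mod_cast hβ1.ne
  have h := norm_LFunction_sub_partial_sum_le (1 : DirichletCharacter ℂ 1) (N := 1) le_rfl
    (s := β) (by simpa using by linarith) hne
  rw [DirichletCharacter.LFunction_modOne_eq] at h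
  have hβ0 : 0 < β := by linarith
  have h10 : (1 : DirichletCharacter ℂ 1) 0 = 1 := map_one _
  simp [charMean, abs_of_pos hβ0, h10] at h
  have h2 := (abs_le.1 ((Complex.abs_re_le_norm _).trans h)).2
  have h3 : ((β : ℂ) - 1)⁻¹ = (((β - 1)⁻¹ : ℝ) : ℂ) := by push_cast; rfl
  rw [h3] at h2
  simp only [Complex.sub_re, Complex.one_re, Complex.ofReal_re] at h2
  have h4 : β * (5 * β⁻¹) = 5 := by field_simp
  rw [h4] at h2
  have h5 : (β - 1)⁻¹ ≤ -8 := by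
    rw [← neg_sub, inv_neg]
    have : 8 ≤ (1 - β)⁻¹ := by
      rw [le_inv_comm₀ (by norm_num) (by linarith)]; linarith
    linarith
  linarith

lemma isPreconnected_sign {u : ℝ → ℝ} (hu : Continuous u) {a b : ℝ} (hab : a ≤ b) (hb : 0 < u b)
    (hne : ∀ x ∈ Set.Icc a b, u x ≠ 0) : 0 < u a := by
  by_contra h
  obtain ⟨x, hx, hx0⟩ := intermediate_value_Icc hab hu.continuousOn ⟨not_lt.1 h, hb.le⟩
  exact hne x hx hx0

lemma LFunction_quadratic_pos {q : ℕ} [NeZero q] {χ : DirichletCharacter ℂ q} (hχ : χ ≠ 1)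
    (hq : MulChar.IsQuadratic χ) {β : ℝ} (hβ : 0 < β) (hβ1 : β ≤ 1)
    (hne : ∀ x : ℝ, β ≤ x → x < 1 → χ.LFunction x ≠ 0) : 0 < (χ.LFunction β).re := by
  have hc : Continuous (fun u : ℝ => (χ.LFunction (u : ℂ)).re) :=
    Complex.continuous_re.comp
      ((DirichletCharacter.differentiable_LFunction hχ).continuous.comp Complex.continuous_ofReal)
  refine isPreconnected_sign hc (b := 2) (by linarith) ?_ ?_
  · obtain ⟨r, hr, h⟩ := LFunction_two_quadratic hχ hq
    have : (χ.LFunction ((2 : ℝ) : ℂ)).re = r := by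
      rw [show ((2 : ℝ) : ℂ) = 2 by norm_num, h]; simp
    simp only [this]
    linarith
  · intro x hx h0
    have h0' : χ.LFunction x = 0 := Complex.ext h0
      (LFunction_real_of_quadratic hχ hq (hβ.trans_le hx.1))
    rcases lt_or_ge x 1 with h | h
    · exact hne x hx.1 h h0'
    · exact DirichletCharacter.LFunction_ne_zero_of_one_le_re χ (Or.inl hχ) (by simpa using h) h0'

lemma norm_LFunction_one_ge_of_no_zero {q : ℕ} [NeZero q] {χ : DirichletCharacter ℂ q} (hχ : χ ≠ 1)
    (hq : MulChar.IsQuadratic χ) {β : ℝ} (hβ : 7 / 8 ≤ β) (hβ1 : β < 1)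
    (hne : ∀ x : ℝ, β ≤ x → x < 1 → χ.LFunction x ≠ 0) :
    (1 / 4) * (1 - β) / 4 * (8 * (500 * (143 * q)) / (1 / 4)) ^ (-(4 * (1 - β))) ≤
      ‖χ.LFunction 1‖ := by
  have hq1 : (1 : ℝ) ≤ q := by exact_mod_cast NeZero.one_le
  refine zeta_mul_lower_bound (g := fun n => χ n * (Λ n : ℂ))
    (DirichletCharacter.differentiable_LFunction hχ)
    (fun s hs => deriv_LFunction_eq_neg_mul χ hs) ?_
    (fun s hs => DirichletCharacter.LSeriesSummable_twist_vonMangoldt χ hs) (by norm_num) ?_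
    (by linarith) (fun s h1 h2 h3 => norm_LFunction_le_box hχ h1 h2 h3) hβ hβ1 ?_
  · intro n
    have h0 : (0 : ℂ) ≤ (Λ n : ℂ) := by
      exact_mod_cast (ArithmeticFunction.vonMangoldt_nonneg (n := n))
    rcases hq n with h | h | h <;> simp [h, h0]
    exact add_nonneg h0 h0
  · obtain ⟨r, hr, h⟩ := LFunction_two_quadratic hχ hq
    rw [h]
    exact_mod_cast hr
  · have him := LFunction_real_of_quadratic hχ hq (s := β) (by linarith)
    rw [Complex.mul_re, him, mul_zero, sub_zero]
    exact mul_nonpos_of_nonpos_of_nonneg (riemannZeta_re_nonpos hβ hβ1)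
      (LFunction_quadratic_pos hχ hq (by linarith) hβ1.le hne).le

lemma norm_LFunction_one_mul_ge_of_zero {q₁ q : ℕ} [NeZero q₁] [NeZero q]
    {χ₁ : DirichletCharacter ℂ q₁} {χ : DirichletCharacter ℂ q} (hχ₁ : χ₁ ≠ 1) (hχ : χ ≠ 1)
    (hχχ : charMul χ₁ χ ≠ 1) (hq₁ : MulChar.IsQuadratic χ₁)
    (hq : MulChar.IsQuadratic χ) {β : ℝ} (hβ : 7 / 8 ≤ β) (hβ1 : β < 1)
    (h0 : χ₁.LFunction β = 0) :
    (1 / 64) * (1 - β) / 4 * (8 * (500 * (143 ^ 3 * (q₁ * q) ^ 2)) / (1 / 64)) ^ (-(4 * (1 - β))) ≤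
      ‖χ₁.LFunction 1‖ * ‖χ.LFunction 1‖ * ‖(charMul χ₁ χ).LFunction 1‖ := by
  have hq1 : (1 : ℝ) ≤ q := by exact_mod_cast NeZero.one_le
  have hq11 : (1 : ℝ) ≤ q₁ := by exact_mod_cast NeZero.one_le
  have hqq : MulChar.IsQuadratic (charMul χ₁ χ) := isQuadratic_charMul hq₁ hq
  have d1 := DirichletCharacter.differentiable_LFunction hχ₁
  have d2 := DirichletCharacter.differentiable_LFunction hχ
  have d3 := DirichletCharacter.differentiable_LFunction hχχ
  rw [← norm_mul, ← norm_mul]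
  refine zeta_mul_lower_bound (P := fun s => χ₁.LFunction s * χ.LFunction s *
    (charMul χ₁ χ).LFunction s) (g := (fun n : ℕ => χ₁ n * (Λ n : ℂ)) + (fun n : ℕ => χ n * (Λ n : ℂ)) +
    fun n : ℕ => charMul χ₁ χ n * (Λ n : ℂ)) ((d1.mul d2).mul d3) ?_ ?_ ?_ (by norm_num) ?_
    ?_ ?_ hβ hβ1 ?_
  · intro s hs
    have s1 : LSeriesSummable (fun n : ℕ => χ₁ n * (Λ n : ℂ)) s :=
      DirichletCharacter.LSeriesSummable_twist_vonMangoldt χ₁ hs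
    have s2 : LSeriesSummable (fun n : ℕ => χ n * (Λ n : ℂ)) s :=
      DirichletCharacter.LSeriesSummable_twist_vonMangoldt χ hs
    have s3 : LSeriesSummable (fun n : ℕ => charMul χ₁ χ n * (Λ n : ℂ)) s :=
      DirichletCharacter.LSeriesSummable_twist_vonMangoldt (charMul χ₁ χ) hs
    rw [LSeries_add (s1.add s2) s3, LSeries_add s1 s2, deriv_fun_mul ((d1 s).fun_mul (d2 s)) (d3 s),
      deriv_fun_mul (d1 s) (d2 s), deriv_LFunction_eq_neg_mul χ₁ hs, deriv_LFunction_eq_neg_mul χ hs,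
      deriv_LFunction_eq_neg_mul (charMul χ₁ χ) hs]
    ring
  · intro n
    have h0 : (0 : ℂ) ≤ (Λ n : ℂ) := by
      exact_mod_cast (ArithmeticFunction.vonMangoldt_nonneg (n := n))
    have e : (Λ n : ℂ) + ((fun n : ℕ => χ₁ n * (Λ n : ℂ)) + (fun n : ℕ => χ n * (Λ n : ℂ)) +
        fun n : ℕ => charMul χ₁ χ n * (Λ n : ℂ)) n = Λ n * ((1 + χ₁ n) * (1 + χ n)) := by
      simp only [Pi.add_apply, charMul_apply]; ring
    rw [e]
    refine mul_nonneg h0 ?_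
    rcases hq₁ n with h | h | h <;> rcases hq n with h' | h' | h' <;> simp [h, h']
    all_goals norm_num
  · intro s hs
    exact ((DirichletCharacter.LSeriesSummable_twist_vonMangoldt χ₁ hs).add
      (DirichletCharacter.LSeriesSummable_twist_vonMangoldt χ hs)).add
      (DirichletCharacter.LSeriesSummable_twist_vonMangoldt (charMul χ₁ χ) hs)
  · obtain ⟨r, hr, h⟩ := LFunction_two_quadratic hχ hq
    obtain ⟨r₁, hr₁, h₁⟩ := LFunction_two_quadratic hχ₁ hq₁
    obtain ⟨r₂, hr₂, h₂⟩ := LFunction_two_quadratic hχχ hqq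
    simp only [h, h₁, h₂]
    have : (1 / 64 : ℝ) ≤ r₁ * r * r₂ := by
      calc (1 / 64 : ℝ) = 1 / 4 * (1 / 4) * (1 / 4) := by norm_num
        _ ≤ _ := by gcongr
    exact_mod_cast this
  · have h2 : (1 : ℝ) ≤ (q₁ * q) ^ 2 := one_le_pow₀ (one_le_mul_of_one_le_of_one_le hq11 hq1)
    linarith
  · intro s h1 h2 h3
    have b1 := norm_LFunction_le_box hχ₁ h1 h2 h3
    have b2 := norm_LFunction_le_box hχ h1 h2 h3
    have b3 := norm_LFunction_le_box hχχ h1 h2 h3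
    rw [norm_mul, norm_mul]
    push_cast at b3
    calc _ ≤ (143 * q₁) * (143 * q) * (143 * (q₁ * q : ℝ)) := by gcongr
      _ = _ := by ring
  · simp [h0]

lemma exists_norm_LFunction_one_ge (q : ℕ) [NeZero q] :
    ∃ c : ℝ, 0 < c ∧ ∀ χ : DirichletCharacter ℂ q, χ ≠ 1 → c ≤ ‖χ.LFunction 1‖ := by
  obtain ⟨χ₀, h⟩ := Finite.exists_min (fun χ : DirichletCharacter ℂ q =>
    if χ = 1 then 1 else ‖χ.LFunction 1‖)
  refine ⟨_, ?_, fun χ hχ => (h χ).trans (by rw [if_neg hχ])⟩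
  split_ifs with h0
  · exact one_pos
  · exact norm_pos_iff.2 (DirichletCharacter.LFunction_apply_one_ne_zero h0)

/-- **Siegel's theorem**. -/
theorem siegel {ε : ℝ} (hε : 0 < ε) : ∃ c : ℝ, 0 < c ∧ ∀ (q : ℕ) [NeZero q]
    (χ : DirichletCharacter ℂ q), χ.IsPrimitive → χ ≠ 1 → MulChar.IsQuadratic χ →
    c * (q : ℝ) ^ (-ε) ≤ ‖χ.LFunction 1‖ := by
  set δ : ℝ := min (ε / 16) (1 / 8) with hδ
  have hδ0 : 0 < δ := by positivity
  have hδ8 : δ ≤ 1 / 8 := min_le_right _ _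
  have hδε : δ ≤ ε / 16 := min_le_left _ _
  by_cases h : ∃ (q₁ : ℕ) (_ : NeZero q₁) (χ₁ : DirichletCharacter ℂ q₁), χ₁.IsPrimitive ∧
      χ₁ ≠ 1 ∧ MulChar.IsQuadratic χ₁ ∧ ∃ β : ℝ, 1 - δ ≤ β ∧ β < 1 ∧ χ₁.LFunction β = 0
  · obtain ⟨q₁, _, χ₁, hp₁, hχ₁, hq₁, β, hβ, hβ1, h0⟩ := h
    obtain ⟨c₁, hc₁, hc₁'⟩ := exists_norm_LFunction_one_ge q₁
    have hq11 : (1 : ℝ) ≤ q₁ := by exact_mod_cast NeZero.one_le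
    set η : ℝ := min (ε / 4) (1 / 2) with hη
    have hη0 : 0 < η := by positivity
    set K : ℝ := 8 * (500 * (143 ^ 3 * (q₁ : ℝ) ^ 2)) / (1 / 64) with hK
    have hK1 : 1 ≤ K := by
      rw [hK, le_div_iff₀ (by norm_num)]
      have : (1 : ℝ) ≤ (q₁ : ℝ) ^ 2 := one_le_pow₀ hq11
      linarith
    set D : ℝ := (143 * q₁) * (2 * (11 + 1 / η) * ((q₁ : ℝ) * 4) ^ (2 * η)) with hD
    have hD0 : 0 < D := by positivity
    have h1β : 0 < 1 - β := by linarith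
    set c₂ : ℝ := (1 / 64) * (1 - β) / 4 * K ^ (-(4 * (1 - β))) / D with hc₂
    have hc₂0 : 0 < c₂ := by positivity
    refine ⟨min c₁ c₂, lt_min hc₁ hc₂0, ?_⟩
    intro q _ χ hp hχ hq
    have hq1 : (1 : ℝ) ≤ q := by exact_mod_cast NeZero.one_le
    have hq0 : (0 : ℝ) < q := by linarith
    rcases eq_or_ne q₁ q with rfl | hne
    · calc min c₁ c₂ * (q₁ : ℝ) ^ (-ε) ≤ c₁ * 1 := by
            gcongr
            · exact min_le_left _ _
            · exact Real.rpow_le_one_of_one_le_of_nonpos hq1 (by linarith)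
        _ ≤ _ := by rw [mul_one]; exact hc₁' χ hχ
    · have hne1 := charMul_ne_one hp₁ hp hne
      have hmain := norm_LFunction_one_mul_ge_of_zero hχ₁ hχ hne1 hq₁ hq (by linarith) hβ1 h0
      have b1 := norm_LFunction_le_box hχ₁ (s := 1) (by norm_num) (by norm_num) (by norm_num)
      have b3 := norm_LFunction_le_of_ne_one hη0 (min_le_right _ _) hne1 (s := 1)
        (by simp; linarith) (by norm_num)
      have et : tau (q₁ * q) (1 : ℂ).im = ((q₁ : ℝ) * 4) * q := by
        simp [tau]; ring
      rw [et, Real.mul_rpow (by positivity) hq0.le] at b3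
      have e1 : (8 * (500 * (143 ^ 3 * (q₁ * q : ℝ) ^ 2)) / (1 / 64)) = K * (q : ℝ) ^ 2 := by
        rw [hK]; ring
      rw [e1, Real.mul_rpow (by linarith) (by positivity), ← Real.rpow_natCast, ← Real.rpow_mul
        hq0.le] at hmain
      have hup : ‖χ₁.LFunction 1‖ * ‖χ.LFunction 1‖ * ‖(charMul χ₁ χ).LFunction 1‖ ≤
          ‖χ.LFunction 1‖ * (D * (q : ℝ) ^ (ε / 2)) := by
        have : (q : ℝ) ^ (2 * η) ≤ (q : ℝ) ^ (ε / 2) := by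
          refine Real.rpow_le_rpow_of_exponent_le hq1 ?_
          have := min_le_left (ε / 4) (1 / 2)
          linarith
        calc _ = ‖χ.LFunction 1‖ * (‖χ₁.LFunction 1‖ * ‖(charMul χ₁ χ).LFunction 1‖) := by ring
          _ ≤ ‖χ.LFunction 1‖ * ((143 * q₁) * (2 * (11 + 1 / η) * (((q₁ : ℝ) * 4) ^ (2 * η) *
              (q : ℝ) ^ (ε / 2)))) := by
              gcongr
              exact b3.trans (by gcongr)
          _ = _ := by rw [hD]; ring
      have hlow : (q : ℝ) ^ (-(ε / 2)) ≤ (q : ℝ) ^ (((2 : ℕ) : ℝ) * -(4 * (1 - β))) := by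
        refine Real.rpow_le_rpow_of_exponent_le hq1 ?_
        push_cast
        linarith
      have h3 : (1 / 64) * (1 - β) / 4 * (K ^ (-(4 * (1 - β))) * (q : ℝ) ^ (-(ε / 2))) ≤
          ‖χ.LFunction 1‖ * (D * (q : ℝ) ^ (ε / 2)) :=
        le_trans (by gcongr) (hmain.trans hup)
      have hε2 : (q : ℝ) ^ (-ε) = (q : ℝ) ^ (-(ε / 2)) * (q : ℝ) ^ (-(ε / 2)) := by
        rw [← Real.rpow_add hq0]; ring_nf
      have hqi : (q : ℝ) ^ (ε / 2) * (q : ℝ) ^ (-(ε / 2)) = 1 := by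
        rw [← Real.rpow_add hq0]; simp
      have hp0 : 0 < (q : ℝ) ^ (-(ε / 2)) := by positivity
      calc min c₁ c₂ * (q : ℝ) ^ (-ε) ≤ c₂ * (q : ℝ) ^ (-ε) := by
            gcongr; exact min_le_right _ _
        _ = ((1 / 64) * (1 - β) / 4 * (K ^ (-(4 * (1 - β))) * (q : ℝ) ^ (-(ε / 2)))) *
            ((q : ℝ) ^ (-(ε / 2)) / D) := by rw [hc₂, hε2]; ring
        _ ≤ (‖χ.LFunction 1‖ * (D * (q : ℝ) ^ (ε / 2))) * ((q : ℝ) ^ (-(ε / 2)) / D) := by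
            gcongr
        _ = ‖χ.LFunction 1‖ * ((q : ℝ) ^ (ε / 2) * (q : ℝ) ^ (-(ε / 2))) := by
            field_simp
        _ = _ := by rw [hqi, mul_one]
  · push Not at h
    refine ⟨(1 / 4) * δ / 4 * (8 * (500 * 143) / (1 / 4)) ^ (-(4 * δ)), by positivity, ?_⟩
    intro q _ χ hp hχ hq
    have hq1 : (1 : ℝ) ≤ q := by exact_mod_cast NeZero.one_le
    have := norm_LFunction_one_ge_of_no_zero hχ hq (β := 1 - δ) (by linarith) (by linarith)
      (fun x hx hx1 => h q inferInstance χ hp hχ hq x hx hx1)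
    refine le_trans ?_ this
    have h1 : (8 * (500 * (143 * q)) / (1 / 4) : ℝ) = (8 * (500 * 143) / (1 / 4)) * q := by ring
    have h2 : (q : ℝ) ^ (-ε) ≤ (q : ℝ) ^ (-(4 * δ)) :=
      Real.rpow_le_rpow_of_exponent_le hq1 (by linarith)
    rw [sub_sub_cancel, h1, Real.mul_rpow (by norm_num) (by linarith)]
    calc _ ≤ (1 / 4) * δ / 4 * (8 * (500 * 143) / (1 / 4)) ^ (-(4 * δ)) *
          (q : ℝ) ^ (-(4 * δ)) := by gcongr
      _ = _ := by ring

end VarianceBDH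

namespace VarianceBDH

open Complex MeasureTheory Set Filter Topology

lemma lower_bound_of_pow_four {g : ℝ → ℂ} {M : ℝ} (hM : 1 ≤ M)
    (h4 : ∀ x, 0 < x → x ≤ 1 → x ^ 3 / M ≤ ‖g x‖ ^ 4)
    (hL : ∀ x y, 0 < x → x ≤ y → y ≤ 1 → ‖g y - g x‖ ≤ M * (y - x)) {x : ℝ} (hx : 0 < x)
    (hx1 : x ≤ 1) : 1 / (16 * M ^ 4) ≤ ‖g x‖ := by
  set η : ℝ := 1 / (16 * M ^ 5) with hη
  have hη0 : 0 < η := by positivity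
  have hη1 : η ≤ 1 := by
    rw [hη, div_le_one (by positivity)]
    have : (1 : ℝ) ≤ M ^ 5 := one_le_pow₀ hM
    linarith
  have hMη : M * η = 1 / (16 * M ^ 4) := by rw [hη]; field_simp
  have key : ∀ y, η ≤ y → y ≤ 1 → 2 * (M * η) ≤ ‖g y‖ := by
    intro y hy hy1
    refine le_of_pow_le_pow_left₀ (n := 4) (by norm_num) (norm_nonneg _) ?_
    refine le_trans ?_ (h4 y (hη0.trans_le hy) hy1)
    calc (2 * (M * η)) ^ 4 = η ^ 3 / M * (16 * M ^ 5 * η) := by field_simp; norm_num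
      _ = η ^ 3 / M := by rw [hη]; field_simp
      _ ≤ _ := by gcongr
  rw [← hMη]
  rcases le_total η x with h | h
  · have := key x h hx1
    have : 0 < M * η := by positivity
    linarith
  · have h1 := key η le_rfl hη1
    have h2 := hL x η hx h hη1
    have h3 : ‖g η‖ ≤ ‖g x‖ + ‖g η - g x‖ := by
      refine le_trans (le_of_eq ?_) (norm_add_le _ _)
      congr 1; ring
    have h4 : M * (η - x) ≤ M * η := by gcongr; linarith
    linarith

lemma tau_pos {q : ℕ} [NeZero q] (t : ℝ) : 0 < tau q t := by
  linarith [four_le_tau (q := q) t]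

lemma tau_le_two_mul {q : ℕ} {t u : ℝ} (h : |u| ≤ |t| + 4 ∨ |u| ≤ 2 * |t|) :
    tau q u ≤ 2 * tau q t := by
  unfold tau
  have : |u| + 4 ≤ 2 * (|t| + 4) := by
    rcases h with h | h <;> linarith [abs_nonneg t]
  calc (q : ℝ) * (|u| + 4) ≤ q * (2 * (|t| + 4)) := by gcongr
    _ = _ := by ring

lemma norm_LFunction_le_tau {ε : ℝ} (hε : 0 < ε) (hε2 : ε ≤ 1 / 2) : ∃ C : ℝ, 1 ≤ C ∧
    ∀ (q : ℕ) [NeZero q] (χ : DirichletCharacter ℂ q) (s : ℂ), 1 - ε ≤ s.re → s.re ≤ 4 →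
    (χ ≠ 1 ∨ 1 / 2 ≤ |s.im|) → ‖χ.LFunction s‖ ≤ C * tau q s.im ^ (2 * ε) := by
  have h1 : 0 < 1 / ε := by positivity
  refine ⟨6 * (11 + 1 / ε), by linarith, ?_⟩
  intro q _ χ s hs hs4 h
  have ht := tau_pos (q := q) s.im
  rcases h with h | h
  · refine (norm_LFunction_le_of_ne_one hε hε2 h hs hs4).trans ?_
    gcongr
    norm_num
  · have h2 : 1 / 2 ≤ ‖s - 1‖ := by
      have := Complex.abs_im_le_norm (s - 1)
      simp at this
      linarith
    have hs1 : s ≠ 1 := by rintro rfl; norm_num at h2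
    refine (norm_LFunction_le hε hε2 χ hs hs4 hs1).trans ?_
    have h3 : 1 + 1 / ‖s - 1‖ ≤ 3 := by
      have : 1 / ‖s - 1‖ ≤ 2 := by
        rw [div_le_iff₀ (by linarith)]; linarith
      linarith
    calc _ ≤ 2 * (11 + 1 / ε) * tau q s.im ^ (2 * ε) * 3 := by gcongr
      _ = _ := by ring

lemma norm_deriv_LFunction_le_tau {ε : ℝ} (hε : 0 < ε) (hε2 : ε ≤ 1 / 2) : ∃ C : ℝ, 1 ≤ C ∧
    ∀ (q : ℕ) [NeZero q] (χ : DirichletCharacter ℂ q) (s : ℂ), 1 - ε / 2 ≤ s.re → s.re ≤ 3 →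
    (χ ≠ 1 ∨ 3 / 4 ≤ |s.im|) → ‖deriv χ.LFunction s‖ ≤ C * tau q s.im ^ (2 * ε) := by
  obtain ⟨C, hC, hC'⟩ := norm_LFunction_le_tau hε hε2
  have h2ε : 0 < 2 / ε := by positivity
  refine ⟨C * 2 / (ε / 2), ?_, ?_⟩
  · rw [le_div_iff₀ (by positivity)]; linarith
  intro q _ χ s hs hs3 h
  have hτ := tau_pos (q := q) s.im
  have hball : ∀ z : ℂ, ‖z - s‖ ≤ ε / 2 → 1 - ε ≤ z.re ∧ z.re ≤ 4 ∧ (χ ≠ 1 ∨ 1 / 2 ≤ |z.im|) ∧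
      |z.im| ≤ |s.im| + 4 := by
    intro z hz
    have h1 := abs_le.1 ((Complex.abs_re_le_norm (z - s)).trans hz)
    have h2 := (Complex.abs_im_le_norm (z - s)).trans hz
    simp at h1 h2
    have h3 : |s.im| ≤ |z.im| + |z.im - s.im| := by
      have := abs_sub_abs_le_abs_sub s.im z.im
      rw [abs_sub_comm] at this; linarith
    have h4 : |z.im| ≤ |s.im| + |z.im - s.im| := by
      have := abs_sub_abs_le_abs_sub z.im s.im
      linarith
    exact ⟨by linarith, by linarith, h.imp_right fun h => by linarith, by linarith⟩
  have hd : DiffContOnCl ℂ χ.LFunction (Metric.ball s (ε / 2)) := by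
    refine DifferentiableOn.diffContOnCl fun z hz => ?_
    have hz' := Metric.closure_ball_subset_closedBall hz
    rw [Metric.mem_closedBall, dist_eq_norm] at hz'
    obtain ⟨-, -, h3, -⟩ := hball z hz'
    refine (DirichletCharacter.differentiableAt_LFunction χ z ?_).differentiableWithinAt
    rcases h3 with h3 | h3
    · exact Or.inr h3
    · left; rintro rfl; norm_num at h3
  have := Complex.norm_deriv_le_of_forall_mem_sphere_norm_le (C := C * (2 * tau q s.im ^ (2 * ε)))
    (by positivity) hd (fun z hz => ?_)
  · refine this.trans (le_of_eq ?_); ring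
  · rw [Metric.mem_sphere, dist_eq_norm] at hz
    obtain ⟨h1, h2, h3, h4⟩ := hball z hz.le
    refine (hC' q χ z h1 h2 h3).trans ?_
    gcongr
    calc tau q z.im ^ (2 * ε) ≤ (2 * tau q s.im) ^ (2 * ε) := by
          have := tau_pos (q := q) z.im
          gcongr
          exact tau_le_two_mul (Or.inl h4)
      _ = 2 ^ (2 * ε) * tau q s.im ^ (2 * ε) := Real.mul_rpow (by norm_num) hτ.le
      _ ≤ 2 ^ (1 : ℝ) * tau q s.im ^ (2 * ε) := by
          gcongr
          · norm_num
          · linarith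
      _ = _ := by rw [Real.rpow_one]

lemma tau_rpow_le {q : ℕ} [NeZero q] {ε t u : ℝ} (hε : 0 < ε) (hε2 : ε ≤ 1 / 2)
    (h : |u| ≤ |t| + 4 ∨ |u| ≤ 2 * |t|) : tau q u ^ (2 * ε) ≤ 2 * (tau q t ^ ε) ^ 2 := by
  have hτ := tau_pos (q := q) t
  have := tau_pos (q := q) u
  calc tau q u ^ (2 * ε) ≤ (2 * tau q t) ^ (2 * ε) := by
        gcongr
        exact tau_le_two_mul h
    _ = 2 ^ (2 * ε) * tau q t ^ (2 * ε) := Real.mul_rpow (by norm_num) hτ.le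
    _ ≤ 2 ^ (1 : ℝ) * tau q t ^ (2 * ε) := by
        gcongr
        · norm_num
        · linarith
    _ = _ := by rw [Real.rpow_one, mul_comm 2 ε, Real.rpow_mul hτ.le]; norm_num

lemma one_le_tau_rpow {q : ℕ} [NeZero q] {ε : ℝ} (t : ℝ) (hε : 0 < ε) : 1 ≤ tau q t ^ ε :=
  Real.one_le_rpow (by linarith [four_le_tau (q := q) t]) hε.le

lemma three_four_one {ε : ℝ} (hε : 0 < ε) (hε2 : ε ≤ 1 / 2) : ∃ C : ℝ, 1 ≤ C ∧
    ∀ (q : ℕ) [NeZero q] (χ : DirichletCharacter ℂ q) (t x K : ℝ), 0 < x → x ≤ 1 →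
    ‖(χ ^ 2).LFunction (1 + x + 2 * I * t)‖ ≤ K →
    x ^ 3 ≤ C * (tau q t ^ ε) ^ 6 * K * ‖χ.LFunction (1 + x + I * t)‖ ^ 4 := by
  have h1 : 0 < 1 / ε := by positivity
  refine ⟨(2 * (11 + 1 / ε) * 2 * 2) ^ 3, one_le_pow₀ (by linarith), ?_⟩
  intro q _ χ t x K hx hx1 hK
  have h := χ.norm_LFunction_product_ge_one hx t
  have h0 : ‖DirichletCharacter.LFunctionTrivChar q (1 + x)‖ ≤
      2 * (11 + 1 / ε) * 2 * 2 * (tau q t ^ ε) ^ 2 / x := by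
    have hne : (1 : ℂ) + x ≠ 1 := by
      intro h; simp at h; exact hx.ne' h
    have := norm_LFunction_le hε hε2 (1 : DirichletCharacter ℂ q) (s := 1 + x) (by simp; linarith)
      (by simp; linarith) hne
    refine this.trans ?_
    have e : ‖(1 : ℂ) + x - 1‖ = x := by simp [abs_of_pos hx]
    rw [e]
    have e2 : ((1 : ℂ) + x).im = 0 := by simp
    rw [e2]
    have e3 := tau_rpow_le (q := q) (t := t) (u := 0) hε hε2 (Or.inl (by simp; positivity))
    calc 2 * (11 + 1 / ε) * tau q 0 ^ (2 * ε) * (1 + 1 / x)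
        ≤ 2 * (11 + 1 / ε) * (2 * (tau q t ^ ε) ^ 2) * (2 / x) := by
          gcongr
          rw [← sub_nonneg]
          have : 2 / x - (1 + 1 / x) = (1 - x) / x := by field_simp; ring
          rw [this]
          exact div_nonneg (by linarith) hx.le
      _ = _ := by ring
  rw [norm_mul, norm_mul, norm_pow, norm_pow] at h
  have h2 : (1 : ℝ) ≤ (2 * (11 + 1 / ε) * 2 * 2 * (tau q t ^ ε) ^ 2 / x) ^ 3 *
      ‖χ.LFunction (1 + x + I * t)‖ ^ 4 * K := by
    refine le_trans h ?_
    have := tau_pos (q := q) t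
    gcongr
  rw [div_pow, div_mul_eq_mul_div, div_mul_eq_mul_div, le_div_iff₀ (by positivity), one_mul] at h2
  refine h2.trans (le_of_eq ?_)
  ring

lemma norm_LFunction_sub_le {ε : ℝ} (hε : 0 < ε) (hε2 : ε ≤ 1 / 2) : ∃ C : ℝ, 1 ≤ C ∧
    ∀ (q : ℕ) [NeZero q] (χ : DirichletCharacter ℂ q) (t : ℝ) (S : Set ℂ), Convex ℝ S →
    (∀ z ∈ S, 1 ≤ z.re ∧ z.re ≤ 2 ∧ |z.im| ≤ |t| + 4 ∧ (χ ≠ 1 ∨ 3 / 4 ≤ |z.im|)) →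
    ∀ z ∈ S, ∀ w ∈ S,
      ‖χ.LFunction w - χ.LFunction z‖ ≤ C * (tau q t ^ ε) ^ 2 * ‖w - z‖ := by
  obtain ⟨C, hC, hC'⟩ := norm_deriv_LFunction_le_tau hε hε2
  refine ⟨2 * C, by linarith, ?_⟩
  intro q _ χ t S hS hSz z hz w hw
  refine hS.norm_image_sub_le_of_norm_deriv_le (fun y hy => ?_) (fun y hy => ?_) hz hw
  · refine DirichletCharacter.differentiableAt_LFunction χ y ?_
    rcases (hSz y hy).2.2.2 with h3 | h3
    · exact Or.inr h3
    · left; rintro rfl; norm_num at h3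
  · obtain ⟨h1, h2, h3, h4⟩ := hSz y hy
    refine (hC' q χ y (by linarith) (by linarith) h4).trans ?_
    calc C * tau q y.im ^ (2 * ε) ≤ C * (2 * (tau q t ^ ε) ^ 2) := by
          gcongr
          exact tau_rpow_le hε hε2 (Or.inl h3)
      _ = _ := by ring

lemma convex_horizontal (t : ℝ) : Convex ℝ {z : ℂ | 1 ≤ z.re ∧ z.re ≤ 2 ∧ z.im = t} := by
  have h1 : Convex ℝ {z : ℂ | 1 ≤ z.re} := convex_halfSpace_re_ge 1
  have h2 : Convex ℝ {z : ℂ | z.re ≤ 2} := convex_halfSpace_re_le 2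
  have h3 : Convex ℝ {z : ℂ | z.im ≤ t} := convex_halfSpace_im_le t
  have h4 : Convex ℝ {z : ℂ | t ≤ z.im} := convex_halfSpace_im_ge t
  convert ((h1.inter h2).inter h3).inter h4 using 1
  ext z
  simp only [mem_ofPred_eq, mem_inter_iff, le_antisymm_iff (a := z.im), and_assoc]

lemma convex_box : Convex ℝ {z : ℂ | 1 ≤ z.re ∧ z.re ≤ 2 ∧ |z.im| ≤ 1} := by
  have h1 : Convex ℝ {z : ℂ | 1 ≤ z.re} := convex_halfSpace_re_ge 1
  have h2 : Convex ℝ {z : ℂ | z.re ≤ 2} := convex_halfSpace_re_le 2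
  have h3 : Convex ℝ {z : ℂ | z.im ≤ 1} := convex_halfSpace_im_le 1
  have h4 : Convex ℝ {z : ℂ | -1 ≤ z.im} := convex_halfSpace_im_ge (-1)
  convert ((h1.inter h2).inter h3).inter h4 using 1
  ext z
  simp only [mem_ofPred_eq, mem_inter_iff, abs_le, and_assoc, and_comm (a := -1 ≤ z.im)]

/-- Lower bound for `L(s, χ)` given an upper bound for `L(s, χ²)`. -/
lemma norm_LFunction_ge_of_sq_le {ε : ℝ} (hε : 0 < ε) (hε2 : ε ≤ 1 / 2) : ∃ C : ℝ, 1 ≤ C ∧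
    ∀ (q : ℕ) [NeZero q] (χ : DirichletCharacter ℂ q) (t x K : ℝ), 0 < x → x ≤ 1 → 1 ≤ K →
    (χ ≠ 1 ∨ 1 ≤ |t|) →
    (∀ y : ℝ, 0 < y → y ≤ 1 → ‖(χ ^ 2).LFunction (1 + y + 2 * I * t)‖ ≤ K) →
    1 / (C * (tau q t ^ ε) ^ 24 * K ^ 4) ≤ ‖χ.LFunction (1 + x + I * t)‖ := by
  obtain ⟨C₁, hC₁, h341⟩ := three_four_one hε hε2
  obtain ⟨C₂, hC₂, hlip⟩ := norm_LFunction_sub_le hε hε2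
  refine ⟨16 * (C₁ * C₂) ^ 4, ?_, ?_⟩
  · have : 1 ≤ (C₁ * C₂) ^ 4 := one_le_pow₀ (one_le_mul_of_one_le_of_one_le hC₁ hC₂)
    linarith
  intro q _ χ t x K hx hx1 hK hχ hsq
  have hT := one_le_tau_rpow (q := q) t hε
  set T := tau q t ^ ε with hTdef
  have hM : 1 ≤ C₁ * C₂ * T ^ 6 * K :=
    one_le_mul_of_one_le_of_one_le (one_le_mul_of_one_le_of_one_le
      (one_le_mul_of_one_le_of_one_le hC₁ hC₂) (one_le_pow₀ hT)) hK
  have := lower_bound_of_pow_four (g := fun x : ℝ => χ.LFunction (1 + x + I * t)) hM ?_ ?_ hx hx1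
  · refine le_trans (le_of_eq ?_) this
    congr 1; ring
  · intro y hy hy1
    have h := h341 q χ t y K hy hy1 (hsq y hy hy1)
    rw [div_le_iff₀ (by linarith)]
    refine h.trans ?_
    rw [mul_comm _ (C₁ * C₂ * T ^ 6 * K)]
    gcongr
    exact le_mul_of_one_le_right (by linarith) hC₂
  · intro y z hy hyz hz
    have h := hlip q χ t _ (convex_horizontal t) (fun w hw => ⟨hw.1, hw.2.1, by
      rw [hw.2.2]; linarith, hχ.imp_right fun h => by rw [hw.2.2]; linarith⟩)
      (1 + y + I * t) (by simp; constructor <;> linarith)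
      (1 + z + I * t) (by simp; constructor <;> linarith)
    have e : ‖(1 + z + I * t : ℂ) - (1 + y + I * t)‖ = z - y := by
      rw [show (1 + z + I * t : ℂ) - (1 + y + I * t) = ((z - y : ℝ) : ℂ) by push_cast; ring,
        Complex.norm_real, Real.norm_of_nonneg (by linarith)]
    rw [e] at h
    refine h.trans ?_
    have : 0 ≤ z - y := by linarith
    refine mul_le_mul_of_nonneg_right ?_ this
    have h26 : T ^ 2 ≤ T ^ 6 := pow_le_pow_right₀ hT (by norm_num)
    calc C₂ * T ^ 2 ≤ (C₁ * C₂) * T ^ 6 :=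
          mul_le_mul (le_mul_of_one_le_left (by linarith) hC₁) h26 (by positivity) (by positivity)
      _ ≤ _ := le_mul_of_one_le_right (by positivity) hK

lemma norm_LFunction_one_ge_of_quadratic {ε : ℝ} (hε : 0 < ε) : ∃ c : ℝ, 0 < c ∧ c ≤ 1 ∧
    ∀ (q : ℕ) [NeZero q] (χ : DirichletCharacter ℂ q) (t : ℝ), χ.IsPrimitive → χ ≠ 1 →
    χ ^ 2 = 1 → c / tau q t ^ ε ≤ ‖χ.LFunction 1‖ := by
  obtain ⟨c, hc, h⟩ := siegel hε
  refine ⟨min c 1, lt_min hc one_pos, min_le_right _ _, ?_⟩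
  intro q _ χ t hp hχ hsq
  have hq : (0 : ℝ) < q := by exact_mod_cast NeZero.pos q
  refine le_trans ?_ (h q χ hp hχ (MulChar.isQuadratic_iff_sq_eq_one.2 hsq))
  rw [Real.rpow_neg hq.le, ← div_eq_mul_inv]
  have : (q : ℝ) ≤ tau q t := by
    unfold tau
    nlinarith [abs_nonneg t]
  gcongr
  exact min_le_left _ _

/-- For `χ² = 1` the function `L(s, χ²)` is bounded in terms of the distance to the pole. -/
lemma norm_LFunction_sq_le {ε : ℝ} (hε : 0 < ε) (hε2 : ε ≤ 1 / 2) {q : ℕ} [NeZero q]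
    (χ : DirichletCharacter ℂ q) {t y θ : ℝ} (hθ : 0 < θ) (hθ1 : θ ≤ 1) (hy : 0 < y) (hy1 : y ≤ 1)
    (h : θ / 2 ≤ |t| ∨ θ / 2 ≤ y) :
    ‖χ.LFunction (1 + y + 2 * I * t)‖ ≤ 12 * (11 + 1 / ε) * (tau q t ^ ε) ^ 2 / θ := by
  have h1 : 0 < 1 / ε := by positivity
  have hτ := tau_pos (q := q) t
  have him : (1 + y + 2 * I * t : ℂ).im = 2 * t := by simp
  have hre : (1 + y + 2 * I * t : ℂ).re = 1 + y := by simp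
  have hdist : θ / 2 ≤ ‖(1 + y + 2 * I * t : ℂ) - 1‖ := by
    rcases h with h | h
    · refine h.trans (le_trans ?_ (Complex.abs_im_le_norm _))
      rw [Complex.sub_im, him, Complex.one_im, sub_zero, abs_mul, abs_two]
      linarith [abs_nonneg t]
    · refine h.trans (le_trans ?_ (Complex.abs_re_le_norm _))
      rw [Complex.sub_re, hre, Complex.one_re, add_sub_cancel_left]
      exact le_abs_self y
  have hne : (1 + y + 2 * I * t : ℂ) ≠ 1 := by
    intro h; rw [h] at hdist; simp at hdist; linarith
  have := norm_LFunction_le hε hε2 χ (s := 1 + y + 2 * I * t) (by rw [hre]; linarith)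
    (by rw [hre]; linarith) hne
  refine this.trans ?_
  rw [him]
  have e3 := tau_rpow_le (q := q) (t := t) (u := 2 * t) hε hε2
    (Or.inr (by rw [abs_mul]; norm_num))
  have e4 : 1 + 1 / ‖(1 + y + 2 * I * t : ℂ) - 1‖ ≤ 3 / θ := by
    have : 1 / ‖(1 + y + 2 * I * t : ℂ) - 1‖ ≤ 1 / (θ / 2) := by gcongr
    have h5 : 1 ≤ 1 / θ := by rw [le_div_iff₀ hθ]; linarith
    calc _ ≤ 1 / θ + 1 / (θ / 2) := by linarith
      _ = _ := by field_simp; norm_num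
  calc _ ≤ 2 * (11 + 1 / ε) * (2 * (tau q t ^ ε) ^ 2) * (3 / θ) := by gcongr
    _ = _ := by ring

lemma norm_LFunction_ge_pow {ε : ℝ} (hε : 0 < ε) (hε2 : ε ≤ 1 / 2) : ∃ C : ℝ, 1 ≤ C ∧
    ∀ (q : ℕ) [NeZero q] (χ : DirichletCharacter ℂ q) (t x : ℝ), χ.IsPrimitive → 0 < x → x ≤ 1 →
    (χ ≠ 1 ∨ 1 ≤ |t|) → 1 / (C * (tau q t ^ ε) ^ 44) ≤ ‖χ.LFunction (1 + x + I * t)‖ := by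
  obtain ⟨C₀, hC₀, hge⟩ := norm_LFunction_ge_of_sq_le hε hε2
  obtain ⟨C₁, hC₁, h341⟩ := three_four_one hε hε2
  obtain ⟨C₂, hC₂, hlip⟩ := norm_LFunction_sub_le hε hε2
  obtain ⟨C₃, hC₃, hup⟩ := norm_LFunction_le_tau hε hε2
  obtain ⟨c₀, hc₀, hc₀1, hsieg⟩ := norm_LFunction_one_ge_of_quadratic hε
  have h1ε : 0 < 1 / ε := by positivity
  set D := 12 * (11 + 1 / ε) with hD
  have hD1 : 1 ≤ D := by linarith
  set κ := c₀ / (2 * C₂) with hκ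
  have hκ0 : 0 < κ := by positivity
  have hκ1 : κ ≤ 1 / 2 := by
    rw [hκ, div_le_iff₀ (by positivity)]; linarith
  obtain ⟨B₁, hB₁⟩ : ∃ B, B = C₀ * (2 * C₃) ^ 4 := ⟨_, rfl⟩
  obtain ⟨B₂, hB₂⟩ : ∃ B, B = 2 / c₀ := ⟨_, rfl⟩
  obtain ⟨B₃, hB₃⟩ : ∃ B, B = C₀ * (D / κ) ^ 4 := ⟨_, rfl⟩
  obtain ⟨B₄, hB₄⟩ : ∃ B, B = 8 * C₁ * D / κ := ⟨_, rfl⟩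
  have hB₁0 : 0 < B₁ := by rw [hB₁]; positivity
  have hB₂0 : 0 < B₂ := by rw [hB₂]; positivity
  have hB₃0 : 0 < B₃ := by rw [hB₃]; positivity
  have hB₄0 : 0 < B₄ := by rw [hB₄]; positivity
  refine ⟨1 + B₁ + B₂ + B₃ + B₄, by linarith, ?_⟩
  intro q _ χ t x hp hx hx1 hχ
  have hT := one_le_tau_rpow (q := q) t hε
  set T := tau q t ^ ε with hTdef
  have hT0 : 0 < T := by linarith
  have fin : ∀ (B : ℝ) (k : ℕ), 0 < B → B ≤ 1 + B₁ + B₂ + B₃ + B₄ → k ≤ 44 →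
      1 / ((1 + B₁ + B₂ + B₃ + B₄) * T ^ 44) ≤ 1 / (B * T ^ k) := by
    intro B k hB hB' hk
    have := pow_le_pow_right₀ hT hk
    gcongr
  by_cases hcase : χ ^ 2 ≠ 1 ∨ 1 / 2 ≤ |t|
  · have := hge q χ t x (2 * C₃ * T ^ 2) hx hx1
      (one_le_mul_of_one_le_of_one_le (by linarith) (one_le_pow₀ hT)) hχ ?_
    · refine le_trans ?_ this
      refine (fin B₁ 32 hB₁0 (by linarith) (by norm_num)).trans (le_of_eq ?_)
      rw [hB₁]; ring
    · intro y hy hy1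
      have him : (1 + y + 2 * I * t : ℂ).im = 2 * t := by simp
      have hre : (1 + y + 2 * I * t : ℂ).re = 1 + y := by simp
      have := hup q (χ ^ 2) (1 + y + 2 * I * t) (by rw [hre]; linarith) (by rw [hre]; linarith)
        (hcase.imp_right fun h => by
          rw [him, abs_mul, abs_two]; linarith)
      refine this.trans ?_
      rw [him]
      have e3 := tau_rpow_le (q := q) (t := t) (u := 2 * t) hε hε2
        (Or.inr (by rw [abs_mul]; norm_num))
      calc _ ≤ C₃ * (2 * T ^ 2) := by gcongr
        _ = _ := by ring
  · push Not at hcase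
    obtain ⟨hsq, ht⟩ := hcase
    have hχ1 : χ ≠ 1 := by
      rcases hχ with h | h
      · exact h
      · linarith
    set θ := κ / T ^ 3 with hθ
    have hT3 : 1 ≤ T ^ 3 := one_le_pow₀ hT
    have hθ0 : 0 < θ := by positivity
    have hθ1 : θ ≤ 1 := by rw [hθ, div_le_one (by positivity)]; linarith
    have hθinv : T ^ 2 / θ = T ^ 5 / κ := by rw [hθ]; field_simp
    by_cases h1 : θ / 2 ≤ |t|
    · have := hge q χ t x (D * T ^ 2 / θ) hx hx1 ?_ hχ ?_
      · refine le_trans ?_ this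
        refine (fin B₃ 44 hB₃0 (by linarith) le_rfl).trans (le_of_eq ?_)
        rw [hB₃, mul_div_assoc D (T ^ 2), hθinv, ← hTdef]
        congr 1
        field_simp
      · rw [le_div_iff₀ hθ0, one_mul]
        exact hθ1.trans (one_le_mul_of_one_le_of_one_le hD1 (one_le_pow₀ hT))
      · intro y hy hy1
        exact norm_LFunction_sq_le hε hε2 _ hθ0 hθ1 hy hy1 (Or.inl h1)
    by_cases h2 : θ / 2 ≤ x
    · have h := h341 q χ t x (D * T ^ 2 / θ) hx hx1
        (norm_LFunction_sq_le hε hε2 _ hθ0 hθ1 hx hx1 (Or.inr h2))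
      refine (fin B₄ 5 hB₄0 (by linarith) (by norm_num)).trans ?_
      by_contra hlt
      push Not at hlt
      have h4 : ‖χ.LFunction (1 + x + I * t)‖ ^ 4 < (1 / (B₄ * T ^ 5)) ^ 4 := by
        gcongr
      have h3 : (θ / 2) ^ 3 ≤ x ^ 3 := by gcongr
      have h5 : C₁ * T ^ 6 * (D * T ^ 2 / θ) * ‖χ.LFunction (1 + x + I * t)‖ ^ 4 <
          C₁ * T ^ 6 * (D * T ^ 2 / θ) * (1 / (B₄ * T ^ 5)) ^ 4 := by
        gcongr
      have h6 : C₁ * T ^ 6 * (D * T ^ 2 / θ) * (1 / (B₄ * T ^ 5)) ^ 4 =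
          (θ / 2) ^ 3 * (1 / (8 * C₁ * D)) ^ 3 := by
        rw [hθ, hB₄]; field_simp; norm_num
      have h7 : (1 / (8 * C₁ * D)) ^ 3 ≤ 1 := by
        apply pow_le_one₀ (by positivity)
        rw [div_le_one (by positivity)]
        nlinarith
      have h8 : (θ / 2) ^ 3 * (1 / (8 * C₁ * D)) ^ 3 ≤ (θ / 2) ^ 3 :=
        mul_le_of_le_one_right (by positivity) h7
      linarith
    · push Not at h1 h2
      refine (fin B₂ 1 hB₂0 (by linarith) (by norm_num)).trans ?_
      have hs := hsieg q χ t hp hχ1 hsq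
      have h := hlip q χ t _ convex_box (fun w hw => ⟨hw.1, hw.2.1, by
        linarith [hw.2.2, abs_nonneg t], Or.inl hχ1⟩)
        (1 + x + I * t) (by simp; exact ⟨hx.le, by linarith, by linarith⟩)
        1 (by simp)
      have hn : ‖(1 : ℂ) - (1 + x + I * t)‖ ≤ θ := by
        have : (1 : ℂ) - (1 + x + I * t) = -((x : ℂ) + I * t) := by ring
        rw [this, norm_neg]
        refine (norm_add_le _ _).trans ?_
        simp only [norm_mul, Complex.norm_real, Complex.norm_I, one_mul, Real.norm_eq_abs,
          abs_of_pos hx]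
        linarith
      have h3 : C₂ * T ^ 2 * ‖(1 : ℂ) - (1 + x + I * t)‖ ≤ c₀ / T / 2 := by
        calc _ ≤ C₂ * T ^ 2 * θ := by gcongr
          _ = _ := by rw [hθ, hκ]; field_simp
      have h4 := norm_sub_norm_le (χ.LFunction 1) (χ.LFunction (1 + x + I * t))
      have h5 : 1 / (B₂ * T ^ 1) = c₀ / T / 2 := by rw [hB₂]; field_simp
      rw [h5]
      rw [← hTdef] at hs
      linarith

/-- Lower bound for primitive `L`-functions to the right of the line `Re s = 1`. -/
theorem norm_LFunction_ge {ε : ℝ} (hε : 0 < ε) : ∃ c : ℝ, 0 < c ∧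
    ∀ (q : ℕ) [NeZero q] (χ : DirichletCharacter ℂ q) (s : ℂ), χ.IsPrimitive → 1 < s.re →
    s.re ≤ 2 → (χ ≠ 1 ∨ 1 ≤ |s.im|) → c * tau q s.im ^ (-ε) ≤ ‖χ.LFunction s‖ := by
  have hε0 : 0 < min (ε / 44) (1 / 2) := by positivity
  obtain ⟨C, hC, h⟩ := norm_LFunction_ge_pow hε0 (min_le_right _ _)
  refine ⟨1 / C, by positivity, ?_⟩
  intro q _ χ s hp hs hs2 hχ
  have := h q χ s.im (s.re - 1) hp (by linarith) (by linarith) hχ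
  have e : (1 + (s.re - 1 : ℝ) + I * s.im : ℂ) = s := by
    apply Complex.ext <;> simp
  rw [e] at this
  refine le_trans ?_ this
  have hτ := tau_pos (q := q) s.im
  have hτ1 : 1 ≤ tau q s.im := by linarith [four_le_tau (q := q) s.im]
  rw [Real.rpow_neg hτ.le, ← div_eq_mul_inv, div_div]
  have : (tau q s.im ^ min (ε / 44) (1 / 2)) ^ 44 ≤ tau q s.im ^ ε := by
    rw [← Real.rpow_natCast, ← Real.rpow_mul hτ.le]
    apply Real.rpow_le_rpow_of_exponent_le hτ1
    have := min_le_left (ε / 44) (1 / 2)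
    push_cast
    linarith
  gcongr

end VarianceBDH

namespace VarianceBDH

open Complex MeasureTheory Set Filter Topology
open scoped ArithmeticFunction.vonMangoldt

/-- The coefficients `χ(n) (Λ(n) - 1_{χ = 1})`. -/
noncomputable def primeCoeff {q : ℕ} (χ : DirichletCharacter ℂ q) (n : ℕ) : ℂ :=
  χ n * ((Λ n : ℂ) - if χ = 1 then 1 else 0)

/-- The function `-L'/L - 1_{χ = 1} L`. -/
noncomputable def logDerivL {q : ℕ} [NeZero q] (χ : DirichletCharacter ℂ q) (s : ℂ) : ℂ :=
  -deriv χ.LFunction s / χ.LFunction s - (if χ = 1 then 1 else 0) * χ.LFunction s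

lemma LSeriesHasSum_primeCoeff {q : ℕ} [NeZero q] (χ : DirichletCharacter ℂ q) {s : ℂ}
    (hs : 1 < s.re) : LSeriesHasSum (primeCoeff χ) s (logDerivL χ s) := by
  have h1 : LSeriesHasSum ((fun n : ℕ => χ n) * fun n => (Λ n : ℂ)) s
      (-deriv χ.LFunction s / χ.LFunction s) := by
    rw [LSeriesHasSum_iff]
    refine ⟨DirichletCharacter.LSeriesSummable_twist_vonMangoldt χ hs, ?_⟩
    rw [DirichletCharacter.LSeries_twist_vonMangoldt_eq χ hs,
      ← DirichletCharacter.deriv_LFunction_eq_deriv_LSeries χ hs,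
      ← DirichletCharacter.LFunction_eq_LSeries χ hs]
  have h2 : LSeriesHasSum (fun n : ℕ => χ n) s (χ.LFunction s) := by
    rw [LSeriesHasSum_iff]
    exact ⟨DirichletCharacter.LSeriesSummable_of_one_lt_re χ hs,
      (DirichletCharacter.LFunction_eq_LSeries χ hs).symm⟩
  have h3 := h1.sub (h2.smul (if χ = 1 then 1 else 0))
  rw [logDerivL]
  convert h3 using 1
  ext n
  simp only [primeCoeff, Pi.sub_apply, Pi.mul_apply, Pi.smul_apply, smul_eq_mul]
  split_ifs <;> ring

lemma LSeries_primeCoeff {q : ℕ} [NeZero q] (χ : DirichletCharacter ℂ q) {s : ℂ}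
    (hs : 1 < s.re) : LSeries (primeCoeff χ) s = logDerivL χ s :=
  (LSeriesHasSum_iff.1 (LSeriesHasSum_primeCoeff χ hs)).2

lemma abscissa_primeCoeff_lt {q : ℕ} [NeZero q] (χ : DirichletCharacter ℂ q) {s : ℂ}
    (hs : 1 < s.re) : LSeries.abscissaOfAbsConv (primeCoeff χ) < s.re := by
  have : LSeries.abscissaOfAbsConv (primeCoeff χ) ≤ (1 : ℝ) :=
    LSeries.abscissaOfAbsConv_le_of_forall_lt_LSeriesSummable fun y hy =>
      (LSeriesHasSum_iff.1 (LSeriesHasSum_primeCoeff χ (s := y) (by simpa using hy))).1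
  exact this.trans_lt (by exact_mod_cast hs)

lemma norm_LSeries_logMul_primeCoeff {q : ℕ} [NeZero q] (χ : DirichletCharacter ℂ q) (k : ℕ) {s : ℂ}
    (hs : 1 < s.re) : ‖LSeries (LSeries.logMul^[k] (primeCoeff χ)) s‖ =
      ‖iteratedDeriv k (logDerivL χ) s‖ := by
  have h := LSeries_iteratedDeriv k (abscissa_primeCoeff_lt χ hs)
  have h2 : LSeries (primeCoeff χ) =ᶠ[𝓝 s] logDerivL χ := by
    filter_upwards [(isOpen_lt continuous_const Complex.continuous_re).mem_nhds hs] with z hz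
    exact LSeries_primeCoeff χ hz
  rw [← h2.iteratedDeriv_eq, h, norm_mul]
  simp

lemma norm_iteratedDeriv_logDerivL_le_pow {ε : ℝ} (k : ℕ) (hε : 0 < ε) (hε2 : ε ≤ 1 / 2) :
    ∃ C : ℝ, 1 ≤ C ∧
    ∀ (q : ℕ) [NeZero q] (χ : DirichletCharacter ℂ q) (s : ℂ), χ.IsPrimitive → 1 < s.re →
    s.re ≤ 2 → (χ ≠ 1 ∨ 1 ≤ |s.im|) →
    ‖iteratedDeriv k (logDerivL χ) s‖ ≤ C * (tau q s.im ^ ε) ^ (3 + 3 * k) := by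
  obtain ⟨c', hc', hlow'⟩ := norm_LFunction_ge hε
  obtain ⟨C, hC, hder⟩ := norm_deriv_LFunction_le_tau hε hε2
  obtain ⟨C₃, hC₃, hup⟩ := norm_LFunction_le_tau hε hε2
  obtain ⟨c, hc⟩ : ∃ c, c = min c' 1 := ⟨_, rfl⟩
  have hc0 : 0 < c := by rw [hc]; positivity
  have hc1 : c ≤ 1 := by rw [hc]; exact min_le_right _ _
  have hcc : c ≤ c' := by rw [hc]; exact min_le_left _ _
  set D := k.factorial * (4 * C / c + 2 * C₃) * (4 * C / (c * ε)) ^ k with hD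
  have hD0 : 0 < D := by positivity
  refine ⟨1 + D, by linarith, ?_⟩
  intro q _ χ s hp hs hs2 hχ
  have hT := one_le_tau_rpow (q := q) s.im hε
  have hlow := hlow' q χ s hp hs hs2 hχ
  rw [Real.rpow_neg (tau_pos _).le, ← div_eq_mul_inv] at hlow
  set T := tau q s.im ^ ε with hTdef
  have hT0 : 0 < T := by linarith
  replace hlow : c / T ≤ ‖χ.LFunction s‖ := le_trans (by gcongr) hlow
  obtain ⟨r, hr⟩ : ∃ r, r = c * ε / (4 * C * T ^ 3) := ⟨_, rfl⟩
  have hr0 : 0 < r := by rw [hr]; positivity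
  have hT3 : 1 ≤ T ^ 3 := one_le_pow₀ hT
  have hCT : 1 ≤ C * T ^ 3 := one_le_mul_of_one_le_of_one_le hC hT3
  have hrε : r ≤ ε / 2 := by
    rw [hr, div_le_iff₀ (by positivity)]
    nlinarith
  have hr4 : r ≤ 1 / 4 := by linarith
  have hball : ∀ z ∈ Metric.closedBall s r, 1 - ε / 2 ≤ z.re ∧ z.re ≤ 3 ∧
      (χ ≠ 1 ∨ 3 / 4 ≤ |z.im|) ∧ |z.im| ≤ |s.im| + 4 := by
    intro z hz
    rw [Metric.mem_closedBall, dist_eq_norm] at hz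
    have h1 := abs_le.1 ((Complex.abs_re_le_norm (z - s)).trans hz)
    have h2 := (Complex.abs_im_le_norm (z - s)).trans hz
    rw [Complex.sub_re] at h1
    rw [Complex.sub_im] at h2
    have h3 := abs_sub_abs_le_abs_sub z.im s.im
    have h4 := abs_sub_abs_le_abs_sub s.im z.im
    rw [abs_sub_comm] at h4
    exact ⟨by linarith, by linarith, hχ.imp_right fun h => by linarith, by linarith⟩
  have hdiff : ∀ z ∈ Metric.closedBall s r, DifferentiableAt ℂ χ.LFunction z := by
    intro z hz
    refine DirichletCharacter.differentiableAt_LFunction χ z ?_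
    rcases (hball z hz).2.2.1 with h3 | h3
    · exact Or.inr h3
    · left; rintro rfl; norm_num at h3
  have hd : ∀ z ∈ Metric.closedBall s r, ‖deriv χ.LFunction z‖ ≤ 2 * C * T ^ 2 := by
    intro z hz
    obtain ⟨h1, h2, h3, h4⟩ := hball z hz
    refine (hder q χ z h1 h2 h3).trans ?_
    calc C * tau q z.im ^ (2 * ε) ≤ C * (2 * T ^ 2) := by
          gcongr
          exact tau_rpow_le hε hε2 (Or.inl h4)
      _ = _ := by ring
  have hu : ∀ z ∈ Metric.closedBall s r, ‖χ.LFunction z‖ ≤ 2 * C₃ * T ^ 2 := by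
    intro z hz
    obtain ⟨h1, h2, h3, h4⟩ := hball z hz
    refine (hup q χ z (by linarith) (by linarith) (h3.imp_right fun h => by linarith)).trans ?_
    calc C₃ * tau q z.im ^ (2 * ε) ≤ C₃ * (2 * T ^ 2) := by
          gcongr
          exact tau_rpow_le hε hε2 (Or.inl h4)
      _ = _ := by ring
  have hl : ∀ z ∈ Metric.closedBall s r, c / (2 * T) ≤ ‖χ.LFunction z‖ := by
    intro z hz
    have h1 := (convex_closedBall s r).norm_image_sub_le_of_norm_deriv_le hdiff hd hz
      (Metric.mem_closedBall_self hr0.le)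
    rw [Metric.mem_closedBall, dist_eq_norm, norm_sub_rev] at hz
    have h2 : 2 * C * T ^ 2 * ‖s - z‖ ≤ c / (2 * T) := by
      calc _ ≤ 2 * C * T ^ 2 * r := by gcongr
        _ = c / (2 * T) * ε := by rw [hr]; field_simp; norm_num
        _ ≤ _ := mul_le_of_le_one_right (by positivity) (by linarith)
    have h3 := norm_sub_norm_le (χ.LFunction s) (χ.LFunction z)
    have h4 : c / T = c / (2 * T) + c / (2 * T) := by field_simp; norm_num
    linarith
  have hne : ∀ z ∈ Metric.closedBall s r, χ.LFunction z ≠ 0 := by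
    intro z hz h
    have := hl z hz
    rw [h, norm_zero] at this
    have : 0 < c / (2 * T) := by positivity
    linarith
  set U : Set ℂ := {z | (z ≠ 1 ∨ χ ≠ 1)} with hU
  have hUo : IsOpen U := by
    by_cases h : χ = 1
    · simp only [hU, h, ne_eq, not_true_eq_false, or_false]
      exact isOpen_ne
    · simp [hU, h]
  have hUd : DifferentiableOn ℂ χ.LFunction U := fun z hz =>
    (DirichletCharacter.differentiableAt_LFunction χ z hz).differentiableWithinAt
  have hFd : DifferentiableOn ℂ (logDerivL χ) (Metric.closedBall s r) := by
    intro z hz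
    have hzU : z ∈ U := by
      rcases (hball z hz).2.2.1 with h3 | h3
      · exact Or.inr h3
      · left; rintro rfl; norm_num at h3
    have h1 : DifferentiableAt ℂ (deriv χ.LFunction) z :=
      (hUd.deriv hUo).differentiableAt (hUo.mem_nhds hzU)
    have h2 := hdiff z hz
    exact ((h1.fun_neg.fun_div h2 (hne z hz)).fun_sub
      ((differentiableAt_const _).fun_mul h2)).differentiableWithinAt
  have hFb : ∀ z ∈ Metric.sphere s r, ‖logDerivL χ z‖ ≤ (4 * C / c + 2 * C₃) * T ^ 3 := by
    intro z hz'
    have hz := Metric.sphere_subset_closedBall hz'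
    unfold logDerivL
    refine (norm_sub_le _ _).trans ?_
    rw [norm_div, norm_neg, norm_mul, add_mul]
    refine add_le_add ?_ ?_
    · calc _ ≤ 2 * C * T ^ 2 / (c / (2 * T)) := by
            have h1 := hl z hz
            have h2 := hd z hz
            gcongr
        _ = _ := by field_simp; norm_num
    · have h1 : ‖(if χ = 1 then 1 else 0 : ℂ)‖ ≤ 1 := by split_ifs <;> simp
      have h23 : T ^ 2 ≤ T ^ 3 := pow_le_pow_right₀ hT (by norm_num)
      calc _ ≤ 1 * (2 * C₃ * T ^ 2) := mul_le_mul h1 (hu z hz) (norm_nonneg _) zero_le_one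
        _ = 2 * C₃ * T ^ 2 := one_mul _
        _ ≤ _ := by gcongr
  have := Complex.norm_iteratedDeriv_le_of_forall_mem_sphere_norm_le k hr0
    (hFd.diffContOnCl_ball subset_rfl) hFb
  refine this.trans ?_
  have e : k.factorial * ((4 * C / c + 2 * C₃) * T ^ 3) / r ^ k = D * T ^ (3 + 3 * k) := by
    have hri : 1 / r = (4 * C / (c * ε)) * T ^ 3 := by rw [hr]; field_simp
    rw [div_eq_mul_one_div, ← one_div_pow, hri, hD, mul_pow, pow_add, pow_mul]
    ring
  rw [e]
  gcongr
  linarith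

lemma zetaOne_ne_zero {s : ℂ} (hs : 1 ≤ s.re) : zetaOne s ≠ 0 := by
  by_cases h : s = 1
  · rw [h, zetaOne_one]; exact one_ne_zero
  · rw [zetaOne_of_ne h]
    exact mul_ne_zero (sub_ne_zero.2 h) (riemannZeta_ne_zero_of_one_le_re hs)

/-- The analytic continuation of `-ζ'/ζ - ζ` to the zero-free region of `ζ`. -/
noncomputable def zetaLogDeriv (s : ℂ) : ℂ := -deriv zetaOne s / zetaOne s - dslope zetaOne 1 s

lemma logDerivL_modOne (χ : DirichletCharacter ℂ 1) {s : ℂ} (hs : 1 < s.re) :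
    logDerivL χ s = zetaLogDeriv s := by
  have hχ : χ = 1 := Subsingleton.elim _ _
  have hs1 : s ≠ 1 := by rintro rfl; simp at hs
  have h0 := sub_ne_zero.2 hs1
  have hz := riemannZeta_ne_zero_of_one_le_re hs.le
  have h1 : zetaOne =ᶠ[𝓝 s] fun z => (z - 1) * riemannZeta z := by
    filter_upwards [isOpen_ne.mem_nhds hs1] with z hz
    exact zetaOne_of_ne hz
  have h2 : deriv zetaOne s = riemannZeta s + (s - 1) * deriv riemannZeta s := by
    rw [h1.deriv_eq]
    have := ((hasDerivAt_id s).sub_const 1).mul (differentiableAt_riemannZeta hs1).hasDerivAt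
    have h := this.deriv
    simp only [id, one_mul] at h
    exact h
  rw [logDerivL, zetaLogDeriv, if_pos hχ, DirichletCharacter.LFunction_modOne_eq,
    dslope_of_ne _ hs1, slope_def_field, zetaOne_one, h2, zetaOne_of_ne hs1]
  field_simp
  ring

lemma norm_iteratedDeriv_zetaLogDeriv_le (k : ℕ) : ∃ C : ℝ, ∀ s : ℂ, 1 ≤ s.re → s.re ≤ 2 →
    |s.im| ≤ 1 → ‖iteratedDeriv k zetaLogDeriv s‖ ≤ C := by
  set U : Set ℂ := {z | zetaOne z ≠ 0} with hU
  have hUo : IsOpen U := isOpen_ne.preimage differentiable_zetaOne.continuous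
  have hd : DifferentiableOn ℂ zetaLogDeriv U := by
    have h1 : Differentiable ℂ (deriv zetaOne) := by
      rw [← differentiableOn_univ]
      exact differentiable_zetaOne.differentiableOn.deriv isOpen_univ
    have h2 : Differentiable ℂ (dslope zetaOne 1) := by
      rw [← differentiableOn_univ, Complex.differentiableOn_dslope univ_mem, differentiableOn_univ]
      exact differentiable_zetaOne
    intro z hz
    exact ((h1 z).fun_neg.fun_div (differentiable_zetaOne z) hz).fun_sub (h2 z)
      |>.differentiableWithinAt
  have hcont : ContinuousOn (iteratedDeriv k zetaLogDeriv) U := by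
    have h := (hd.contDiffOn (n := k) hUo).continuousOn_iteratedDerivWithin le_rfl
      hUo.uniqueDiffOn
    exact h.congr fun z hz => (iteratedDerivWithin_of_isOpen hUo hz).symm
  have hK : IsCompact (Icc (1 : ℝ) 2 ×ℂ Icc (-1 : ℝ) 1) := isCompact_Icc.reProdIm isCompact_Icc
  obtain ⟨C, hC⟩ := hK.exists_bound_of_continuousOn (hcont.mono fun z hz => by
    rw [Complex.mem_reProdIm] at hz
    exact zetaOne_ne_zero hz.1.1)
  refine ⟨C, fun s h1 h2 h3 => hC s ?_⟩
  rw [Complex.mem_reProdIm]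
  exact ⟨⟨h1, h2⟩, abs_le.1 h3⟩

/-- Bounds for the derivatives of `-L'/L` near the line `Re s = 1`. -/
theorem norm_LSeries_logMul_primeCoeff_le {ε : ℝ} (k : ℕ) (hε : 0 < ε) : ∃ C : ℝ, 1 ≤ C ∧
    ∀ (q : ℕ) [NeZero q] (χ : DirichletCharacter ℂ q) (s : ℂ), χ.IsPrimitive → 1 < s.re →
    s.re ≤ 2 → ‖LSeries (LSeries.logMul^[k] (primeCoeff χ)) s‖ ≤ C * tau q s.im ^ ε := by
  have hk : (0 : ℝ) < 3 + 3 * k := by positivity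
  have hε0 : 0 < min (ε / (3 + 3 * k)) (1 / 2) := by positivity
  obtain ⟨C, hC, h⟩ := norm_iteratedDeriv_logDerivL_le_pow k hε0 (min_le_right _ _)
  obtain ⟨C', h'⟩ := norm_iteratedDeriv_zetaLogDeriv_le k
  refine ⟨C + |C'|, by linarith [abs_nonneg C'], ?_⟩
  intro q _ χ s hp hs hs2
  rw [norm_LSeries_logMul_primeCoeff χ k hs]
  have hτ1 : 1 ≤ tau q s.im := by linarith [four_le_tau (q := q) s.im]
  have hτ : 0 < tau q s.im := by linarith
  by_cases hχ : χ ≠ 1 ∨ 1 ≤ |s.im|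
  · refine (h q χ s hp hs hs2 hχ).trans ?_
    have : (tau q s.im ^ min (ε / (3 + 3 * k)) (1 / 2)) ^ (3 + 3 * k) ≤ tau q s.im ^ ε := by
      rw [← Real.rpow_natCast, ← Real.rpow_mul hτ.le]
      apply Real.rpow_le_rpow_of_exponent_le hτ1
      have := min_le_left (ε / (3 + 3 * k)) (1 / 2)
      push_cast
      rwa [← le_div_iff₀ hk]
    gcongr
    exact le_add_of_nonneg_right (abs_nonneg _)
  · push Not at hχ
    obtain ⟨rfl, ht⟩ := hχ
    have hq : q = 1 := by
      rw [DirichletCharacter.isPrimitive_def, DirichletCharacter.conductor_one] at hp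
      exact hp.symm
    subst hq
    have h2 : logDerivL (1 : DirichletCharacter ℂ 1) =ᶠ[𝓝 s] zetaLogDeriv := by
      filter_upwards [(isOpen_lt continuous_const Complex.continuous_re).mem_nhds hs] with z hz
      exact logDerivL_modOne _ hz
    rw [h2.iteratedDeriv_eq]
    refine (h' s hs.le hs2 ht.le).trans ?_
    calc C' ≤ C + |C'| := by linarith [le_abs_self C']
      _ ≤ _ := le_mul_of_one_le_right (by positivity) (Real.one_le_rpow hτ1 hε.le)

end VarianceBDH

namespace VarianceBDH

open Complex MeasureTheory Set Filter Topology

/-- The Mellin transform of `(1 - t)₊`. -/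
noncomputable def rieszKernel (s : ℂ) : ℂ := 1 / s - 1 / (s + 1)

lemma norm_rieszKernel_le {σ : ℝ} (hσ : 1 ≤ σ) (y : ℝ) :
    ‖rieszKernel (σ + y * I)‖ ≤ (1 + y ^ 2) ^ (-1 : ℝ) := by
  have h1 : ∀ u : ℝ, 1 ≤ u → Real.sqrt (1 + y ^ 2) ≤ ‖(u + y * I : ℂ)‖ := by
    intro u hu
    rw [Complex.norm_add_mul_I]
    apply Real.sqrt_le_sqrt
    nlinarith
  have h2 := h1 σ hσ
  have h3 := h1 (σ + 1) (by linarith)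
  have hpos : 0 < Real.sqrt (1 + y ^ 2) := Real.sqrt_pos.2 (by positivity)
  have e3 : ((σ + 1 : ℝ) + y * I : ℂ) = (σ + y * I) + 1 := by push_cast; ring
  rw [e3] at h3
  have n1 : (σ + y * I : ℂ) ≠ 0 := norm_pos_iff.1 (hpos.trans_le h2)
  have n2 : (σ + y * I : ℂ) + 1 ≠ 0 := norm_pos_iff.1 (hpos.trans_le h3)
  have e : rieszKernel (σ + y * I) = 1 / ((σ + y * I) * ((σ + y * I) + 1)) := by
    rw [rieszKernel]; field_simp; ring
  rw [e, norm_div, norm_mul, norm_one, Real.rpow_neg_one, ← one_div]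
  have : (1 + y ^ 2) ≤ ‖(σ + y * I : ℂ)‖ * ‖(σ + y * I : ℂ) + 1‖ := by
    calc 1 + y ^ 2 = Real.sqrt (1 + y ^ 2) * Real.sqrt (1 + y ^ 2) :=
          (Real.mul_self_sqrt (by positivity)).symm
      _ ≤ _ := by gcongr
  gcongr

lemma continuous_rieszKernel {σ : ℝ} (hσ : 1 ≤ σ) :
    Continuous fun y : ℝ => rieszKernel (σ + y * I) := by
  unfold rieszKernel
  have h : ∀ y : ℝ, (σ + y * I : ℂ).re = σ := by simp
  refine Continuous.sub (Continuous.div (by fun_prop) (by fun_prop) ?_)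
    (Continuous.div (by fun_prop) (by fun_prop) ?_)
  · intro y h0
    have := h y
    rw [h0, Complex.zero_re] at this; linarith
  · intro y h0
    have := congrArg Complex.re h0
    rw [Complex.add_re, h y] at this
    simp at this; linarith

lemma integrable_one_add_sq_rpow {a : ℝ} (ha : 1 / 2 < a) :
    Integrable fun y : ℝ => (1 + y ^ 2) ^ (-a) := by
  have := integrable_rpow_neg_one_add_norm_sq (E := ℝ) (μ := volume) (r := 2 * a)
    (by simp; linarith)
  convert this using 3
  · simp
  · ring

lemma integrable_rieszKernel {σ : ℝ} (hσ : 1 ≤ σ) :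
    Integrable fun y : ℝ => rieszKernel (σ + y * I) :=
  (integrable_one_add_sq_rpow (a := 1) (by norm_num)).mono'
    (continuous_rieszKernel hσ).aestronglyMeasurable (ae_of_all _ (norm_rieszKernel_le hσ))

lemma integral_rieszKernel {σ : ℝ} (hσ : 1 ≤ σ) {u : ℝ} (hu : 0 < u) :
    ∫ y : ℝ, (u : ℂ) ^ (-(σ + y * I : ℂ)) * rieszKernel (σ + y * I) =
      2 * Real.pi * (max 0 (1 - u) : ℝ) := by
  set f : ℝ → ℂ := fun t => (Ioc (0 : ℝ) 1).indicator (fun _ => (1 : ℂ)) t -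
    (Ioc (0 : ℝ) 1).indicator (fun t : ℝ => (t : ℂ) ^ (1 : ℂ)) t with hf
  have hM : ∀ s : ℂ, 0 < s.re → HasMellin f s (rieszKernel s) := by
    intro s hs
    have h1 := hasMellin_one_Ioc hs
    have h2 := hasMellin_cpow_Ioc 1 (s := s) (by simp; linarith)
    have := hasMellin_sub h1.1 h2.1
    rwa [h1.2, h2.2] at this
  have hfe : ∀ t : ℝ, 0 < t → f t = ((max 0 (1 - t) : ℝ) : ℂ) := by
    intro t ht
    by_cases h1 : t ≤ 1
    · simp only [hf, indicator_of_mem (show t ∈ Ioc (0 : ℝ) 1 from ⟨ht, h1⟩), Complex.cpow_one]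
      rw [max_eq_right (by linarith)]; push_cast; ring
    · have : t ∉ Ioc (0 : ℝ) 1 := fun h => h1 h.2
      simp only [hf, indicator_of_notMem this]
      rw [max_eq_left (by linarith)]; simp
  have hre : ∀ y : ℝ, 0 < (σ + y * I : ℂ).re := by intro y; simp; linarith
  have key := mellinInv_mellin_eq σ f hu (hM σ (by simp; linarith)).1 ?_ ?_
  · rw [hfe u hu, mellinInv] at key
    have h2 : (fun y : ℝ => (u : ℂ) ^ (-(σ + y * I : ℂ)) • mellin f (σ + y * I)) =
        fun y : ℝ => (u : ℂ) ^ (-(σ + y * I : ℂ)) * rieszKernel (σ + y * I) := by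
      ext y
      rw [(hM _ (hre y)).2, smul_eq_mul]
    rw [h2] at key
    rw [← key, Complex.real_smul]
    have : (Real.pi : ℂ) ≠ 0 := by exact_mod_cast Real.pi_pos.ne'
    generalize (∫ y : ℝ, (u : ℂ) ^ (-(σ + y * I : ℂ)) * rieszKernel (σ + y * I)) = J
    push_cast
    field_simp
  · have : (fun y : ℝ => mellin f (σ + y * I)) = fun y : ℝ => rieszKernel (σ + y * I) := by
      ext y
      rw [(hM _ (hre y)).2]
    rw [VerticalIntegrable, this]
    exact integrable_rieszKernel hσ
  · have h1 : ContinuousAt (fun t : ℝ => ((max 0 (1 - t) : ℝ) : ℂ)) u := by fun_prop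
    refine h1.congr ?_
    filter_upwards [Ioi_mem_nhds hu] with t ht
    exact (hfe t ht).symm

/-- An explicit formula for Riesz means, in the form of an upper bound. -/
lemma norm_riesz_mean_le {b : ℕ → ℂ} {σ x M : ℝ} (hσ : 1 ≤ σ) (hx : 0 < x)
    (hb : LSeriesSummable b σ)
    (hM : ∀ y : ℝ, ‖LSeries b (σ + y * I)‖ ≤ M * (1 + y ^ 2) ^ (1 / 4 : ℝ)) :
    ‖∑ n ∈ Finset.Icc 1 ⌊x⌋₊, b n * (1 - n / x)‖ ≤
      (∫ y : ℝ, (1 + y ^ 2) ^ (-(3 / 4) : ℝ)) * M * x ^ σ := by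
  set F : ℕ → ℝ → ℂ := fun n y =>
    LSeries.term b (σ + y * I) n * ((x : ℂ) ^ (σ + y * I : ℂ) * rieszKernel (σ + y * I)) with hF
  have hre : ∀ y : ℝ, (σ + y * I : ℂ).re = σ := by simp
  have hterm : ∀ n (y : ℝ), ‖LSeries.term b (σ + y * I) n‖ = ‖LSeries.term b σ n‖ := by
    intro n y
    rw [LSeries.norm_term_eq, LSeries.norm_term_eq, hre, Complex.ofReal_re]
  have hxn : ∀ y : ℝ, ‖(x : ℂ) ^ (σ + y * I : ℂ)‖ = x ^ σ := by
    intro y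
    rw [Complex.norm_cpow_eq_rpow_re_of_pos hx, hre]
  have hFn : ∀ n y, ‖F n y‖ = ‖LSeries.term b σ n‖ * (x ^ σ * ‖rieszKernel (σ + y * I)‖) := by
    intro n y
    rw [hF]
    simp only [norm_mul, hterm, hxn]
  have hxc : (x : ℂ) ≠ 0 := by exact_mod_cast hx.ne'
  have hFc : ∀ n, Continuous (F n) := by
    intro n
    have h1 : Continuous fun y : ℝ => LSeries.term b (σ + y * I) n := by
      simp only [LSeries.term_def]
      by_cases hn : n = 0
      · simp only [hn, if_true]; exact continuous_const
      · simp only [hn, if_false]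
        have hn' : (n : ℂ) ≠ 0 := by exact_mod_cast hn
        refine continuous_const.div (Continuous.const_cpow (by fun_prop) (Or.inl hn')) ?_
        intro y
        exact (Complex.cpow_ne_zero_iff_of_exponent_ne_zero (by
          intro h; have := hre y; rw [h, Complex.zero_re] at this; linarith)).2 hn'
    exact h1.mul ((Continuous.const_cpow (by fun_prop) (Or.inl hxc)).mul
      (continuous_rieszKernel hσ))
  have hInt : ∀ n, Integrable (F n) := by
    intro n
    refine (((integrable_rieszKernel hσ).norm.const_mul (x ^ σ)).const_mul
      ‖LSeries.term b σ n‖).mono' (hFc n).aestronglyMeasurable (ae_of_all _ fun y => ?_)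
    rw [hFn]
  have hsum := hasSum_integral_of_summable_integral_norm hInt (by
    simp only [hFn, integral_const_mul]
    exact hb.norm.mul_right _)
  have hval : ∀ n, ∫ y, F n y = 2 * Real.pi *
      (if n ∈ Finset.Icc 1 ⌊x⌋₊ then b n * (1 - n / x) else 0) := by
    intro n
    by_cases hn : n = 0
    · simp [hF, hn]
    · have hn0 : (0 : ℝ) < n := by exact_mod_cast Nat.pos_of_ne_zero hn
      have h1 : ∀ y, F n y =
          b n * ((((n / x : ℝ) : ℂ) ^ (-(σ + y * I : ℂ))) * rieszKernel (σ + y * I)) := by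
        intro y
        have h2 : ((n / x : ℝ) : ℂ) ^ (-(σ + y * I : ℂ)) =
            (x : ℂ) ^ (σ + y * I : ℂ) / (n : ℂ) ^ (σ + y * I : ℂ) := by
          rw [div_eq_mul_inv, Complex.ofReal_mul, Complex.mul_cpow_ofReal_nonneg hn0.le
            (by positivity), Complex.ofReal_inv, Complex.inv_cpow _ _ (by
              rw [Complex.arg_ofReal_of_nonneg hx.le]; exact Real.pi_pos.ne), Complex.cpow_neg,
            Complex.cpow_neg, inv_inv, Complex.ofReal_natCast]
          ring
        rw [hF, h2]
        simp only [LSeries.term_of_ne_zero hn]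
        ring
      simp only [h1, integral_const_mul]
      rw [integral_rieszKernel hσ (by positivity)]
      by_cases hnx : (n : ℝ) ≤ x
      · rw [if_pos (Finset.mem_Icc.2 ⟨Nat.pos_of_ne_zero hn, Nat.le_floor hnx⟩),
          max_eq_right (by rw [sub_nonneg, div_le_one hx]; exact hnx)]
        push_cast
        ring
      · rw [if_neg (fun h => hnx ((Nat.le_floor_iff hx.le).1 (Finset.mem_Icc.1 h).2)),
          max_eq_left (by
            rw [sub_nonpos, le_div_iff₀ hx]; linarith)]
        simp
  simp only [hval] at hsum
  have hfin : HasSum (fun n => (2 * Real.pi : ℂ) *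
      (if n ∈ Finset.Icc 1 ⌊x⌋₊ then b n * (1 - n / x) else 0))
      (2 * Real.pi * ∑ n ∈ Finset.Icc 1 ⌊x⌋₊, b n * (1 - n / x)) := by
    apply HasSum.mul_left
    have := hasSum_sum_of_ne_finset_zero (L := .unconditional ℕ) (s := Finset.Icc 1 ⌊x⌋₊)
      (f := fun n : ℕ => (if n ∈ Finset.Icc 1 ⌊x⌋₊ then b n * (1 - n / x) else 0 : ℂ))
      (fun n hn => by rw [if_neg hn])
    rwa [Finset.sum_congr rfl fun n hn => if_pos hn] at this
  have heq := hfin.unique hsum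
  have hbound : ‖∫ y, ∑' n, F n y‖ ≤
      (∫ y : ℝ, (1 + y ^ 2) ^ (-(3 / 4) : ℝ)) * (M * x ^ σ) := by
    rw [← integral_mul_const]
    refine norm_integral_le_of_norm_le
      ((integrable_one_add_sq_rpow (a := 3 / 4) (by norm_num)).mul_const _) (ae_of_all _ fun y => ?_)
    have h1 : ∑' n, F n y =
        LSeries b (σ + y * I) * ((x : ℂ) ^ (σ + y * I : ℂ) * rieszKernel (σ + y * I)) := by
      rw [hF]; simp only [tsum_mul_right]; rfl
    rw [h1, norm_mul, norm_mul, hxn]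
    have h3 := hM y
    have h4 := norm_rieszKernel_le hσ y
    have h5 : 0 ≤ M * (1 + y ^ 2) ^ (1 / 4 : ℝ) := (norm_nonneg _).trans h3
    calc _ ≤ M * (1 + y ^ 2) ^ (1 / 4 : ℝ) * (x ^ σ * (1 + y ^ 2) ^ (-1 : ℝ)) := by gcongr
      _ = ((1 + y ^ 2) ^ (1 / 4 : ℝ) * (1 + y ^ 2) ^ (-1 : ℝ)) * (M * x ^ σ) := by ring
      _ = _ := by
        rw [← Real.rpow_add (by positivity)]; norm_num
  rw [← heq, norm_mul] at hbound
  have hpi : 1 ≤ ‖(2 * Real.pi : ℂ)‖ := by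
    rw [norm_mul, Complex.norm_real, Real.norm_of_nonneg Real.pi_pos.le]
    norm_num
    linarith [Real.pi_gt_three]
  rw [mul_assoc]
  exact (le_mul_of_one_le_left (norm_nonneg _) hpi).trans hbound

end VarianceBDH

namespace VarianceBDH

open Complex MeasureTheory Set Filter Topology
open scoped ArithmeticFunction.vonMangoldt

lemma norm_sum_mul_antitone_le {b : ℕ → ℂ} {g : ℕ → ℝ} {M N : ℕ} {K : ℝ}
    (hg : ∀ n, M < n → n < N → g (n + 1) ≤ g n) (hg0 : ∀ n, M < n → n ≤ N → 0 ≤ g n)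
    (hK : ∀ n, M < n → n ≤ N → ‖∑ i ∈ Finset.Ioc M n, b i‖ ≤ K) (hMN : M < N) :
    ‖∑ i ∈ Finset.Ioc M N, b i * g i‖ ≤ K * g (M + 1) := by
  have key : ∀ n, M < n → n ≤ N →
      ‖∑ i ∈ Finset.Ioc M n, b i * g i - (∑ i ∈ Finset.Ioc M n, b i) * g n‖ ≤
        K * (g (M + 1) - g n) := by
    intro n hn
    induction n, hn using Nat.le_induction with
    | base => intro _; simp [Nat.Ioc_succ_singleton]
    | succ n hn ih =>
      intro hnN
      have h1 := ih (by omega)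
      have h2 := hK n hn (by omega)
      have h3 := hg n hn (by omega)
      rw [← Finset.insert_Ioc_right_eq_Ioc_add_one (by omega : M ≤ n),
        Finset.sum_insert (by simp), Finset.sum_insert (by simp)]
      have e : b (n + 1) * g (n + 1) + ∑ i ∈ Finset.Ioc M n, b i * g i -
          (b (n + 1) + ∑ i ∈ Finset.Ioc M n, b i) * g (n + 1) =
          (∑ i ∈ Finset.Ioc M n, b i * g i - (∑ i ∈ Finset.Ioc M n, b i) * g n) +
          (∑ i ∈ Finset.Ioc M n, b i) * ((g n - g (n + 1) : ℝ) : ℂ) := by push_cast; ring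
      rw [e]
      refine (norm_add_le _ _).trans ?_
      rw [norm_mul, Complex.norm_real, Real.norm_of_nonneg (by linarith)]
      calc _ ≤ K * (g (M + 1) - g n) + K * (g n - g (n + 1)) := by
            gcongr
        _ = _ := by ring
  have h1 := key N hMN le_rfl
  have h2 := norm_le_insert' (∑ i ∈ Finset.Ioc M N, b i * g i) ((∑ i ∈ Finset.Ioc M N, b i) * g N)
  have h3 : ‖(∑ i ∈ Finset.Ioc M N, b i) * (g N : ℂ)‖ ≤ K * g N := by
    rw [norm_mul, Complex.norm_real, Real.norm_of_nonneg (hg0 N hMN le_rfl)]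
    exact mul_le_mul_of_nonneg_right (hK N hMN le_rfl) (hg0 N hMN le_rfl)
  linarith

lemma mul_norm_sum_le_of_riesz {b : ℕ → ℂ} {x h : ℝ} (hx : 0 < x) (hh : 0 < h) :
    h * ‖∑ n ∈ Finset.Icc 1 ⌊x⌋₊, b n‖ ≤
      (x + h) * ‖∑ n ∈ Finset.Icc 1 ⌊x + h⌋₊, b n * (1 - n / ((x + h : ℝ) : ℂ))‖ +
      x * ‖∑ n ∈ Finset.Icc 1 ⌊x⌋₊, b n * (1 - n / x)‖ +
      h * ∑ n ∈ Finset.Ioc ⌊x⌋₊ ⌊x + h⌋₊, ‖b n‖ := by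
  have hfl : ⌊x⌋₊ ≤ ⌊x + h⌋₊ := Nat.floor_mono (by linarith)
  have hdec : Finset.Icc 1 ⌊x + h⌋₊ = Finset.Icc 1 ⌊x⌋₊ ∪ Finset.Ioc ⌊x⌋₊ ⌊x + h⌋₊ := by
    ext n; simp only [Finset.mem_Icc, Finset.mem_union, Finset.mem_Ioc]; omega
  have hdisj : Disjoint (Finset.Icc 1 ⌊x⌋₊) (Finset.Ioc ⌊x⌋₊ ⌊x + h⌋₊) := by
    rw [Finset.disjoint_left]; intro n
    simp only [Finset.mem_Icc, Finset.mem_Ioc]; omega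
  have hxc : (x : ℂ) ≠ 0 := by exact_mod_cast hx.ne'
  have hxh : ((x + h : ℝ) : ℂ) ≠ 0 := by exact_mod_cast (by linarith : x + h ≠ 0)
  have e : (h : ℂ) * ∑ n ∈ Finset.Icc 1 ⌊x⌋₊, b n =
      ((x + h : ℝ) : ℂ) * (∑ n ∈ Finset.Icc 1 ⌊x + h⌋₊, b n * (1 - n / ((x + h : ℝ) : ℂ))) -
      (x : ℂ) * (∑ n ∈ Finset.Icc 1 ⌊x⌋₊, b n * (1 - n / x)) -
      ∑ n ∈ Finset.Ioc ⌊x⌋₊ ⌊x + h⌋₊, b n * ((x + h - n : ℝ) : ℂ) := by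
    rw [hdec, Finset.sum_union hdisj, mul_add, Finset.mul_sum, Finset.mul_sum, Finset.mul_sum,
      Finset.mul_sum]
    have h1 : ∀ n, ((x + h : ℝ) : ℂ) * (b n * (1 - n / ((x + h : ℝ) : ℂ))) =
        b n * ((x + h - n : ℝ) : ℂ) := by
      intro n; rw [one_sub_div hxh]; field_simp; push_cast; ring
    have h2 : ∀ n : ℕ, (x : ℂ) * (b n * (1 - n / x)) = b n * (x - n) := by
      intro n; field_simp
    simp only [h1, h2]
    rw [add_sub_right_comm, add_sub_assoc, sub_self, add_zero, ← Finset.sum_sub_distrib]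
    refine Finset.sum_congr rfl fun n _ => ?_
    push_cast; ring
  have e2 := congrArg norm e
  rw [norm_mul, Complex.norm_real, Real.norm_of_nonneg hh.le] at e2
  rw [e2]
  refine (norm_sub_le _ _).trans (add_le_add ((norm_sub_le _ _).trans (add_le_add ?_ ?_)) ?_)
  · rw [norm_mul, Complex.norm_real, Real.norm_of_nonneg (by linarith)]
  · rw [norm_mul, Complex.norm_real, Real.norm_of_nonneg hx.le]
  · rw [Finset.mul_sum]
    refine norm_sum_le_of_le _ fun n hn => ?_
    rw [norm_mul, Complex.norm_real, mul_comm]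
    rw [Finset.mem_Ioc, Nat.floor_lt hx.le, Nat.le_floor_iff (by linarith)] at hn
    gcongr
    rw [Real.norm_of_nonneg (by linarith)]
    linarith

lemma logMul_iterate_apply (a : ℕ → ℂ) (k n : ℕ) :
    LSeries.logMul^[k] a n = ((Real.log n ^ k : ℝ) : ℂ) * a n := by
  induction k with
  | zero => simp
  | succ k ih =>
    rw [Function.iterate_succ_apply', LSeries.logMul, ih, ← Complex.natCast_log]
    push_cast; ring

lemma norm_primeCoeff_le {q : ℕ} (χ : DirichletCharacter ℂ q) (n : ℕ) :
    ‖primeCoeff χ n‖ ≤ Real.log n + 1 := by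
  rw [primeCoeff, norm_mul]
  have h1 : ‖((Λ n : ℂ) - if χ = 1 then 1 else 0)‖ ≤ Real.log n + 1 := by
    refine (norm_sub_le _ _).trans (add_le_add ?_ ?_)
    · rw [Complex.norm_real, Real.norm_of_nonneg ArithmeticFunction.vonMangoldt_nonneg]
      exact ArithmeticFunction.vonMangoldt_le_log
    · split_ifs <;> simp
  have h2 : 0 ≤ Real.log n + 1 := (norm_nonneg _).trans h1
  calc _ ≤ 1 * (Real.log n + 1) := by
        gcongr
        exact DirichletCharacter.norm_le_one χ _
    _ = _ := one_mul _

lemma tau_rpow_half_le (q : ℕ) [NeZero q] (t : ℝ) :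
    tau q t ^ (1 / 2 : ℝ) ≤ 4 * q * (1 + t ^ 2) ^ (1 / 4 : ℝ) := by
  have hq : (1 : ℝ) ≤ q := by exact_mod_cast NeZero.one_le
  have h0 : 0 ≤ 4 * q * (1 + t ^ 2) ^ (1 / 4 : ℝ) := by positivity
  rw [← Real.sqrt_eq_rpow]
  refine Real.sqrt_le_iff.2 ⟨h0, ?_⟩
  have h1 : ((1 + t ^ 2) ^ (1 / 4 : ℝ)) ^ 2 = Real.sqrt (1 + t ^ 2) := by
    rw [← Real.rpow_natCast, ← Real.rpow_mul (by positivity), Real.sqrt_eq_rpow]; norm_num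
  rw [mul_pow, mul_pow, h1, tau]
  have h2 : |t| ≤ Real.sqrt (1 + t ^ 2) := Real.abs_le_sqrt (by linarith)
  have h3 : 1 ≤ Real.sqrt (1 + t ^ 2) := Real.one_le_sqrt.2 (by nlinarith)
  have h4 : (q : ℝ) ≤ q ^ 2 := by nlinarith
  calc (q : ℝ) * (|t| + 4) ≤ q ^ 2 * (16 * Real.sqrt (1 + t ^ 2)) := by
        gcongr
        linarith
    _ = _ := by ring

lemma one_le_log_of_three_le {x : ℝ} (hx : 3 ≤ x) : 1 ≤ Real.log x := by
  rw [Real.le_log_iff_exp_le (by linarith)]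
  linarith [Real.exp_one_lt_d9]

lemma norm_riesz_mean_primeCoeff_le (k : ℕ) : ∃ C : ℝ, 1 ≤ C ∧
    ∀ (q : ℕ) [NeZero q] (χ : DirichletCharacter ℂ q) (x : ℝ), χ.IsPrimitive → 3 ≤ x →
    ‖∑ n ∈ Finset.Icc 1 ⌊x⌋₊, LSeries.logMul^[k] (primeCoeff χ) n * (1 - n / x)‖ ≤ C * q * x := by
  obtain ⟨C, hC, h⟩ := norm_LSeries_logMul_primeCoeff_le (ε := 1 / 2) k (by norm_num)
  set J := ∫ y : ℝ, (1 + y ^ 2) ^ (-(3 / 4) : ℝ) with hJ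
  have hJ0 : 0 ≤ J := integral_nonneg fun y => by positivity
  refine ⟨1 + J * (C * 4) * Real.exp 1, by
    have : 0 ≤ J * (C * 4) * Real.exp 1 := by positivity
    linarith, ?_⟩
  intro q _ χ x hp hx
  have hlog := one_le_log_of_three_le hx
  have hx0 : 0 < x := by linarith
  obtain ⟨σ, hσ⟩ : ∃ σ, σ = 1 + 1 / Real.log x := ⟨_, rfl⟩
  have hinv : 0 < 1 / Real.log x := by positivity
  have hinv1 : 1 / Real.log x ≤ 1 := by rw [div_le_one (by linarith)]; exact hlog
  have hσ1 : 1 < σ := by linarith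
  have hs : LSeriesSummable (LSeries.logMul^[k] (primeCoeff χ)) σ := by
    apply LSeriesSummable_of_abscissaOfAbsConv_lt_re
    rw [LSeries.absicssaOfAbsConv_logPowMul]
    exact abscissa_primeCoeff_lt χ (by simpa using hσ1)
  have := norm_riesz_mean_le (M := C * 4 * q) hσ1.le hx0 hs ?_
  · refine this.trans ?_
    have hxs : x ^ σ = Real.exp 1 * x := by
      rw [hσ, Real.rpow_add hx0, Real.rpow_one, Real.rpow_def_of_pos hx0]
      rw [mul_one_div_cancel (by linarith)]; ring
    rw [hxs]
    have : 0 ≤ (q : ℝ) * x := by positivity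
    nlinarith
  · intro y
    have := h q χ (σ + y * I) hp (by simpa using hσ1) (by simp; linarith)
    refine this.trans ?_
    have e : (σ + y * I : ℂ).im = y := by simp
    rw [e]
    calc _ ≤ C * (4 * q * (1 + y ^ 2) ^ (1 / 4 : ℝ)) := by
          gcongr
          exact tau_rpow_half_le q y
      _ = _ := by ring

lemma pow_log_le (m : ℕ) {y : ℝ} (hy : 1 ≤ y) : Real.log y ^ m ≤ m.factorial * y := by
  have := Real.pow_div_factorial_le_exp (Real.log y) (Real.log_nonneg hy) m
  rw [Real.exp_log (by linarith), div_le_iff₀ (by positivity)] at this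
  linarith

lemma norm_sum_logMul_primeCoeff_le (j : ℕ) : ∃ C : ℝ, 1 ≤ C ∧
    ∀ (q : ℕ) [NeZero q] (χ : DirichletCharacter ℂ q) (x : ℝ), χ.IsPrimitive → 3 ≤ x →
    ‖∑ n ∈ Finset.Icc 1 ⌊x⌋₊, LSeries.logMul^[2 * j + 1] (primeCoeff χ) n‖ ≤
      C * q * x * Real.log x ^ (j + 1) := by
  obtain ⟨D, hD, h⟩ := norm_riesz_mean_primeCoeff_le (2 * j + 1)
  refine ⟨(5 * D + 1 + (j + 1).factorial * 6) * 3 ^ (j + 1), ?_, ?_⟩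
  · have h3 : (1 : ℝ) ≤ 3 ^ (j + 1) := one_le_pow₀ (by norm_num)
    have : (0 : ℝ) ≤ (j + 1).factorial * 6 := by positivity
    nlinarith
  intro q _ χ x hp hx
  have hlog := one_le_log_of_three_le hx
  have hx0 : 0 < x := by linarith
  have hq : (1 : ℝ) ≤ q := by exact_mod_cast NeZero.one_le
  set a := LSeries.logMul^[2 * j + 1] (primeCoeff χ) with ha
  obtain ⟨l, hl⟩ : ∃ l, l = Real.log (2 * x) + 1 := ⟨_, rfl⟩
  have hl1 : 1 ≤ l := by
    have := Real.log_nonneg (by linarith : 1 ≤ 2 * x)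
    linarith
  have hl3 : l ≤ 3 * Real.log x := by
    rw [hl, Real.log_mul (by norm_num) hx0.ne']
    linarith [Real.log_two_lt_d9]
  have hl0 : 0 < l := by linarith
  set m := j + 1 with hm
  have hlm : 1 ≤ l ^ m := one_le_pow₀ hl1
  have hlx : l ^ m ≤ m.factorial * (6 * x) := by
    have e : l = Real.log (Real.exp 1 * (2 * x)) := by
      rw [Real.log_mul (Real.exp_pos 1).ne' (by positivity), Real.log_exp, hl]; ring
    have he1 : 1 ≤ Real.exp 1 := Real.one_le_exp (by norm_num)
    have he2 : Real.exp 1 < 3 := by linarith [Real.exp_one_lt_d9]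
    rw [e]
    refine (pow_log_le m (by nlinarith)).trans ?_
    refine mul_le_mul_of_nonneg_left ?_ (by positivity)
    nlinarith
  set y := x / l ^ m with hy
  have hy0 : 0 < y := by positivity
  have hyx : y ≤ x := div_le_self hx0.le hlm
  have h1 := mul_norm_sum_le_of_riesz (b := a) hx0 hy0
  have h2 := h q χ x hp hx
  have h3 := h q χ (x + y) hp (by linarith)
  have h4 : ∑ n ∈ Finset.Ioc ⌊x⌋₊ ⌊x + y⌋₊, ‖a n‖ ≤ (y + 1) * l ^ (2 * m) := by
    have hb : ∀ n ∈ Finset.Ioc ⌊x⌋₊ ⌊x + y⌋₊, ‖a n‖ ≤ l ^ (2 * m) := by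
      intro n hn
      rw [Finset.mem_Ioc, Nat.floor_lt hx0.le, Nat.le_floor_iff (by linarith)] at hn
      rw [ha, logMul_iterate_apply, norm_mul, Complex.norm_real, norm_pow]
      have hn0 : 0 < Real.log n := Real.log_pos (by linarith)
      have hnl : Real.log n ≤ Real.log (2 * x) := Real.log_le_log (by linarith) (by linarith)
      have := norm_primeCoeff_le χ n
      rw [Real.norm_of_nonneg hn0.le]
      calc _ ≤ l ^ (2 * j + 1) * l := by
            gcongr <;> linarith
        _ = _ := by rw [hm]; ring
    refine (Finset.sum_le_card_nsmul _ _ _ hb).trans ?_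
    rw [nsmul_eq_mul, Nat.card_Ioc]
    gcongr
    have h5 := Nat.floor_le (by linarith : 0 ≤ x + y)
    have h6 := Nat.lt_floor_add_one x
    rw [Nat.cast_sub (Nat.floor_mono (by linarith))]
    linarith
  have h7 : y * ‖∑ n ∈ Finset.Icc 1 ⌊x⌋₊, a n‖ ≤
      y * (5 * D * q * (x * l ^ m) + (y + 1) * l ^ (2 * m)) := by
    refine h1.trans ?_
    have hyl : y * (x * l ^ m) = x * x := by rw [hy]; field_simp
    calc _ ≤ (x + x) * (D * q * (x + x)) + x * (D * q * x) + y * ((y + 1) * l ^ (2 * m)) := by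
          have : D * q * (x + y) ≤ D * q * (x + x) := by gcongr
          gcongr
          exact h3.trans this
      _ = 5 * D * q * (x * x) + y * ((y + 1) * l ^ (2 * m)) := by ring
      _ = _ := by rw [← hyl]; ring
  have h8 := le_of_mul_le_mul_left h7 hy0
  refine h8.trans ?_
  have h9 : (y + 1) * l ^ (2 * m) = x * l ^ m + l ^ m * l ^ m := by
    rw [hy]; field_simp; ring
  rw [h9]
  have hqx : x * l ^ m ≤ q * (x * l ^ m) := le_mul_of_one_le_left (by positivity) hq
  calc 5 * D * q * (x * l ^ m) + (x * l ^ m + l ^ m * l ^ m)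
      ≤ 5 * D * q * (x * l ^ m) + (q * (x * l ^ m) + (m.factorial * (6 * x)) * l ^ m) := by gcongr
    _ = 5 * D * q * (x * l ^ m) + (q * (x * l ^ m) + m.factorial * 6 * (x * l ^ m)) := by ring
    _ ≤ 5 * D * q * (x * l ^ m) + (q * (x * l ^ m) + m.factorial * 6 * (q * (x * l ^ m))) := by
        gcongr
    _ = (5 * D + 1 + m.factorial * 6) * (q * x * l ^ m) := by ring
    _ ≤ (5 * D + 1 + m.factorial * 6) * (q * x * (3 * Real.log x) ^ m) := by gcongr
    _ = _ := by rw [mul_pow]; ring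

/-- Prime number theorem for primitive characters, with a power of logarithm saving. -/
theorem norm_sum_primeCoeff_le (j : ℕ) : ∃ C : ℝ, 1 ≤ C ∧
    ∀ (q : ℕ) [NeZero q] (χ : DirichletCharacter ℂ q) (x : ℝ), χ.IsPrimitive → 9 ≤ x →
    ‖∑ n ∈ Finset.Icc 1 ⌊x⌋₊, primeCoeff χ n‖ ≤ C * q * x / Real.log x ^ j := by
  obtain ⟨D, hD, h⟩ := norm_sum_logMul_primeCoeff_le j
  refine ⟨2 * ((j + 1).factorial * 2 ^ (j + 1)) + 2 * D * 2 ^ (2 * j + 1), ?_, ?_⟩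
  · have h3 : (1 : ℝ) ≤ 2 ^ (2 * j + 1) := one_le_pow₀ (by norm_num)
    have : (0 : ℝ) ≤ 2 * ((j + 1).factorial * 2 ^ (j + 1)) := by positivity
    nlinarith
  intro q _ χ x hp hx
  have hlog := one_le_log_of_three_le (by linarith : 3 ≤ x)
  have hx0 : 0 < x := by linarith
  have hq : (1 : ℝ) ≤ q := by exact_mod_cast NeZero.one_le
  set L := Real.log x with hL
  have hL0 : 0 < L := by linarith
  have hs3 : 3 ≤ Real.sqrt x := Real.le_sqrt_of_sq_le (by linarith)
  have hsx : Real.sqrt x * Real.sqrt x = x := Real.mul_self_sqrt hx0.le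
  have hsltx : Real.sqrt x + 1 ≤ x := by nlinarith
  set M := ⌊Real.sqrt x⌋₊ with hM
  have hM3 : 3 ≤ M := Nat.le_floor (by exact_mod_cast hs3)
  have hMs : (M : ℝ) ≤ Real.sqrt x := Nat.floor_le (by positivity)
  have hMs' : Real.sqrt x < M + 1 := Nat.lt_floor_add_one _
  have hMN : M < ⌊x⌋₊ := by
    rw [Nat.lt_iff_add_one_le]
    apply Nat.le_floor
    push_cast; linarith
  have hdec : Finset.Icc 1 ⌊x⌋₊ = Finset.Icc 1 M ∪ Finset.Ioc M ⌊x⌋₊ := by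
    ext n; simp only [Finset.mem_Icc, Finset.mem_union, Finset.mem_Ioc]; omega
  have hdisj : Disjoint (Finset.Icc 1 M) (Finset.Ioc M ⌊x⌋₊) := by
    rw [Finset.disjoint_left]; intro n
    simp only [Finset.mem_Icc, Finset.mem_Ioc]; omega
  have hlogs : Real.log (Real.sqrt x) = L / 2 := Real.log_sqrt hx0.le
  rw [hdec, Finset.sum_union hdisj]
  have hfirst : ‖∑ n ∈ Finset.Icc 1 M, primeCoeff χ n‖ ≤
      2 * ((j + 1).factorial * 2 ^ (j + 1)) * (q * x / L ^ j) := by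
    have hb : ∀ n ∈ Finset.Icc 1 M, ‖primeCoeff χ n‖ ≤ 2 * L := by
      intro n hn
      rw [Finset.mem_Icc] at hn
      refine (norm_primeCoeff_le χ n).trans ?_
      have h1 : (n : ℝ) ≤ x := by
        have : (n : ℝ) ≤ M := by exact_mod_cast hn.2
        linarith
      have h2 : (0 : ℝ) < n := by exact_mod_cast hn.1
      have := Real.log_le_log h2 h1
      linarith
    refine (norm_sum_le_of_le _ hb).trans ?_
    rw [Finset.sum_const, Nat.card_Icc, nsmul_eq_mul, Nat.add_sub_cancel]
    have hp := pow_log_le (j + 1) (by linarith : 1 ≤ Real.sqrt x)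
    rw [hlogs, div_pow, div_le_iff₀ (by positivity)] at hp
    have h5 : Real.sqrt x * (2 * L) * L ^ j ≤ 2 * ((j + 1).factorial * 2 ^ (j + 1)) * (q * x) := by
      calc Real.sqrt x * (2 * L) * L ^ j = 2 * Real.sqrt x * L ^ (j + 1) := by ring
        _ ≤ 2 * Real.sqrt x * ((j + 1).factorial * Real.sqrt x * 2 ^ (j + 1)) := by gcongr
        _ = 2 * ((j + 1).factorial * 2 ^ (j + 1)) * (1 * (Real.sqrt x * Real.sqrt x)) := by ring
        _ ≤ _ := by rw [hsx]; gcongr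
    rw [mul_div_assoc', le_div_iff₀ (by positivity)]
    exact le_trans (by gcongr) h5
  have hsecond : ‖∑ n ∈ Finset.Ioc M ⌊x⌋₊, primeCoeff χ n‖ ≤
      2 * D * 2 ^ (2 * j + 1) * (q * x / L ^ j) := by
    set a := LSeries.logMul^[2 * j + 1] (primeCoeff χ) with ha
    have e : ∑ n ∈ Finset.Ioc M ⌊x⌋₊, primeCoeff χ n =
        ∑ n ∈ Finset.Ioc M ⌊x⌋₊, a n * ((1 / Real.log n ^ (2 * j + 1) : ℝ) : ℂ) := by
      refine Finset.sum_congr rfl fun n hn => ?_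
      rw [Finset.mem_Ioc] at hn
      have : Real.log n ≠ 0 := by
        have : (1 : ℝ) < n := by exact_mod_cast (by omega : 1 < n)
        exact (Real.log_pos this).ne'
      rw [ha, logMul_iterate_apply, mul_right_comm, ← Complex.ofReal_mul,
        mul_one_div_cancel (pow_ne_zero _ this), Complex.ofReal_one, one_mul]
    have hlogpos : ∀ n : ℕ, M < n → 0 < Real.log n := fun n hn =>
      Real.log_pos (by exact_mod_cast (by omega : 1 < n))
    have hB : ∀ n : ℕ, M ≤ n → n ≤ ⌊x⌋₊ →
        ‖∑ i ∈ Finset.Icc 1 n, a i‖ ≤ D * q * x * L ^ (j + 1) := by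
      intro n hn hnx
      have h3 : (3 : ℝ) ≤ n := by exact_mod_cast (by omega : 3 ≤ n)
      have h4 : (n : ℝ) ≤ x := (Nat.le_floor_iff hx0.le).1 hnx
      have h5 := h q χ n hp h3
      rw [Nat.floor_natCast] at h5
      refine h5.trans ?_
      have h6 : Real.log n ≤ L := Real.log_le_log (by linarith) h4
      have h7 := one_le_log_of_three_le h3
      gcongr
    rw [e]
    have := norm_sum_mul_antitone_le (b := a) (g := fun n : ℕ => 1 / Real.log n ^ (2 * j + 1))
      (K := 2 * (D * q * x * L ^ (j + 1))) ?_ ?_ ?_ hMN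
    · refine this.trans ?_
      have h5 : L / 2 ≤ Real.log ((M + 1 : ℕ) : ℝ) := by
        rw [← hlogs]
        apply Real.log_le_log (by linarith)
        push_cast; linarith
      calc _ ≤ 2 * (D * q * x * L ^ (j + 1)) * (1 / (L / 2) ^ (2 * j + 1)) := by
            gcongr
        _ = 2 * D * 2 ^ (2 * j + 1) * (q * x * (L ^ (j + 1) / L ^ (2 * j + 1))) := by
            rw [div_pow]; field_simp
        _ = _ := by
            congr 1
            have : L ^ (2 * j + 1) = L ^ (j + 1) * L ^ j := by ring
            rw [this]
            field_simp
    · intro n hn hnN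
      have h1 := hlogpos n hn
      have : Real.log n ≤ Real.log (n + 1 : ℕ) := by
        apply Real.log_le_log
        · exact_mod_cast (by omega : 0 < n)
        · push_cast; linarith
      gcongr
    · intro n hn _
      have := hlogpos n hn
      positivity
    · intro n hn hnN
      have e2 : Finset.Ioc M n = Finset.Icc 1 n \ Finset.Icc 1 M := by
        ext i; simp only [Finset.mem_Ioc, Finset.mem_sdiff, Finset.mem_Icc]; omega
      rw [e2, Finset.sum_sdiff_eq_sub (Finset.Icc_subset_Icc_right hn.le)]
      refine (norm_sub_le _ _).trans ?_
      have h1 := hB n hn.le hnN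
      have h2 := hB M le_rfl hMN.le
      linarith
  refine (norm_add_le _ _).trans ((add_le_add hfirst hsecond).trans (le_of_eq ?_))
  ring

/-- The weight of the prime powers up to `N` sharing a factor with `r` is negligible. -/
lemma sum_not_coprime_vonMangoldt_le (N : ℕ) {r : ℕ} (hr : r ≠ 0) :
    ∑ n ∈ (Finset.Icc 1 N).filter (fun n => ¬ n.Coprime r), Λ n ≤
      Nat.log 2 N * Real.log r := by
  have hsub : ∑ n ∈ (Finset.Icc 1 N).filter (fun n => ¬ n.Coprime r), Λ n ≤
      ∑ n ∈ (r.primeFactors ×ˢ Finset.Icc 1 (Nat.log 2 N)).image (fun y => y.1 ^ y.2), Λ n := by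
    rw [← Finset.sum_filter_ne_zero]
    refine Finset.sum_le_sum_of_subset_of_nonneg ?_
      fun _ _ _ => ArithmeticFunction.vonMangoldt_nonneg
    intro n hn
    simp only [Finset.mem_filter, Finset.mem_Icc] at hn
    obtain ⟨⟨⟨hn1, hnN⟩, hc⟩, hΛ⟩ := hn
    rw [ArithmeticFunction.vonMangoldt_ne_zero_iff, isPrimePow_nat_iff] at hΛ
    obtain ⟨p, k, hp, hk, rfl⟩ := hΛ
    simp only [Finset.mem_image, Finset.mem_product, Finset.mem_Icc, Nat.mem_primeFactors]
    refine ⟨(p, k), ⟨⟨hp, ?_, hr⟩, hk, ?_⟩, rfl⟩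
    · by_contra h
      exact hc (Nat.Coprime.pow_left k ((Nat.Prime.coprime_iff_not_dvd hp).2 h))
    · refine Nat.le_log_of_pow_le (by norm_num) ((Nat.pow_le_pow_left hp.two_le k).trans hnN)
  refine hsub.trans ((Finset.sum_image_le_of_nonneg
    fun _ _ => ArithmeticFunction.vonMangoldt_nonneg).trans ?_)
  rw [Finset.sum_product]
  have h1 : ∀ p ∈ r.primeFactors, ∑ k ∈ Finset.Icc 1 (Nat.log 2 N), Λ (p ^ k) =
      Nat.log 2 N * Real.log p := by
    intro p hp
    rw [Finset.sum_congr rfl (g := fun _ => Real.log p)]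
    · simp
    · intro k hk
      rw [ArithmeticFunction.vonMangoldt_apply_pow (by simp at hk; omega),
        ArithmeticFunction.vonMangoldt_apply_prime (Nat.prime_of_mem_primeFactors hp)]
  rw [Finset.sum_congr rfl h1, ← Finset.mul_sum]
  refine mul_le_mul_of_nonneg_left ?_ (by positivity)
  rw [← Real.log_prod fun p hp => by
    have := (Nat.prime_of_mem_primeFactors hp).pos; positivity]
  refine Real.log_le_log (Finset.prod_pos fun p hp => by
    have := (Nat.prime_of_mem_primeFactors hp).pos; positivity) ?_
  rw [← Nat.cast_prod]
  exact_mod_cast Nat.le_of_dvd (Nat.pos_of_ne_zero hr) (Nat.prod_primeFactors_dvd r)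

lemma natLog_le_two_mul_log (N : ℕ) : (Nat.log 2 N : ℝ) ≤ 2 * Real.log N := by
  rcases Nat.eq_zero_or_pos N with rfl | hN
  · simp
  have h := Nat.pow_log_le_self 2 hN.ne'
  have h1 : (2 : ℝ) ^ Nat.log 2 N ≤ N := by exact_mod_cast h
  have h2 := Real.log_le_log (by positivity) h1
  rw [Real.log_pow] at h2
  nlinarith [Real.log_two_gt_d9, (Nat.cast_nonneg (Nat.log 2 N) : (0 : ℝ) ≤ _)]

lemma natCast_eq_iff_mod {r : ℕ} (m n : ℕ) : ((m : ZMod r) = n) ↔ n % r = m % r := by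
  rw [ZMod.natCast_eq_natCast_iff]; exact eq_comm

/-- Prime sums twisted by an arbitrary character, by passage to the primitive character. -/
lemma norm_sum_char_mul_vonMangoldt_le (j : ℕ) : ∃ C : ℝ, 1 ≤ C ∧
    ∀ (r : ℕ) [NeZero r] (χ : DirichletCharacter ℂ r) (N : ℕ), 9 ≤ N →
      ‖∑ n ∈ Finset.Icc 1 N, χ n * (Λ n : ℂ) - if χ = 1 then (N : ℂ) else 0‖ ≤
        C * r * N / Real.log N ^ j + 2 * Real.log N * Real.log r := by
  obtain ⟨C, hC1, hC⟩ := norm_sum_primeCoeff_le j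
  refine ⟨C, hC1, fun r _ χ N hN => ?_⟩
  have hr : r ≠ 0 := NeZero.ne r
  have : NeZero χ.conductor := ⟨χ.conductor_ne_zero⟩
  have hχn : ∀ n : ℕ, χ n = if n.Coprime r then χ.primitiveCharacter n else 0 := by
    intro n
    conv_lhs => rw [← χ.changeLevel_primitiveCharacter]
    exact changeLevel_apply_natCast χ.conductor_dvd_level χ.primitiveCharacter n
  have hone : χ.primitiveCharacter = 1 ↔ χ = 1 := by
    constructor
    · intro h
      rw [← χ.changeLevel_primitiveCharacter, h, map_one]
    · rintro rfl
      exact DirichletCharacter.primitiveCharacter_one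
  have h1 := hC χ.conductor χ.primitiveCharacter N χ.primitiveCharacter_isPrimitive
    (by exact_mod_cast hN)
  rw [Nat.floor_natCast] at h1
  have e : ∑ n ∈ Finset.Icc 1 N, χ n * (Λ n : ℂ) - (if χ = 1 then (N : ℂ) else 0) =
      ∑ n ∈ Finset.Icc 1 N, primeCoeff χ.primitiveCharacter n -
        ∑ n ∈ (Finset.Icc 1 N).filter (fun n => ¬ n.Coprime r),
          χ.primitiveCharacter n * (Λ n : ℂ) := by
    have e1 : (if χ = 1 then (N : ℂ) else 0) =
        ∑ n ∈ Finset.Icc 1 N, χ.primitiveCharacter n * (if χ = 1 then 1 else 0) := by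
      split_ifs with h
      · have hc : χ.conductor = 1 := DirichletCharacter.eq_one_iff_conductor_eq_one.1 h
        have : ∀ n : ℕ, χ.primitiveCharacter n = 1 := by
          intro n
          rw [hone.2 h]
          apply MulChar.one_apply
          rw [ZMod.isUnit_iff_coprime, hc]
          exact Nat.coprime_one_right n
        simp [this]
      · simp
    rw [e1, Finset.sum_filter, ← Finset.sum_sub_distrib, ← Finset.sum_sub_distrib]
    refine Finset.sum_congr rfl fun n _ => ?_
    simp only [primeCoeff, hone, hχn n]
    split_ifs <;> simp_all <;> ring
  have h2 : ‖∑ n ∈ (Finset.Icc 1 N).filter (fun n => ¬ n.Coprime r),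
      χ.primitiveCharacter n * (Λ n : ℂ)‖ ≤ 2 * Real.log N * Real.log r := by
    refine (norm_sum_le _ _).trans (le_trans (Finset.sum_le_sum (g := fun n => Λ n) ?_) ?_)
    · intro n _
      rw [norm_mul, Complex.norm_real, Real.norm_of_nonneg ArithmeticFunction.vonMangoldt_nonneg]
      exact mul_le_of_le_one_left ArithmeticFunction.vonMangoldt_nonneg
        (DirichletCharacter.norm_le_one _ _)
    · refine (sum_not_coprime_vonMangoldt_le N hr).trans ?_
      exact mul_le_mul_of_nonneg_right (natLog_le_two_mul_log N) (Real.log_natCast_nonneg r)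
  rw [e]
  refine (norm_sub_le _ _).trans (add_le_add (h1.trans ?_) h2)
  have : (χ.conductor : ℝ) ≤ r := by
    exact_mod_cast Nat.le_of_dvd (Nat.pos_of_ne_zero hr) χ.conductor_dvd_level
  have hl : 0 ≤ Real.log N := Real.log_natCast_nonneg N
  gcongr

/-- The Chebyshev sum `ψ(N; r, a)`. -/
noncomputable def psiMod (N r a : ℕ) : ℝ :=
  ∑ n ∈ (Finset.Icc 1 N).filter (fun n => n % r = a % r), Λ n

lemma psiMod_nonneg (N r a : ℕ) : 0 ≤ psiMod N r a :=
  Finset.sum_nonneg fun _ _ => ArithmeticFunction.vonMangoldt_nonneg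

lemma totient_mul_psiMod {r a : ℕ} [NeZero r] (ha : a.Coprime r) (N : ℕ) :
    ((r.totient * psiMod N r a : ℝ) : ℂ) = ∑ χ : DirichletCharacter ℂ r,
      χ ((a : ZMod r)⁻¹) * ∑ n ∈ Finset.Icc 1 N, χ n * (Λ n : ℂ) := by
  have hu : IsUnit (a : ZMod r) := (ZMod.isUnit_iff_coprime _ _).2 ha
  simp_rw [Finset.mul_sum]
  rw [Finset.sum_comm]
  have h : ∀ n : ℕ, ∑ χ : DirichletCharacter ℂ r, χ ((a : ZMod r)⁻¹) * (χ n * (Λ n : ℂ)) =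
      if n % r = a % r then (r.totient : ℂ) * Λ n else 0 := by
    intro n
    simp_rw [← mul_assoc]
    rw [← Finset.sum_mul, DirichletCharacter.sum_char_inv_mul_char_eq ℂ hu]
    simp only [natCast_eq_iff_mod]
    split_ifs <;> simp
  simp_rw [h]
  rw [← Finset.sum_filter, ← Finset.mul_sum, psiMod]
  push_cast
  rfl

lemma abs_psiMod_sub_le_aux (j : ℕ) : ∃ C : ℝ, 1 ≤ C ∧
    ∀ (r a N : ℕ), r ≠ 0 → a.Coprime r → 9 ≤ N →
      |psiMod N r a - N / r.totient| ≤
        C * r * N / Real.log N ^ j + 2 * Real.log N * Real.log r := by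
  obtain ⟨C, hC1, hC⟩ := norm_sum_char_mul_vonMangoldt_le j
  refine ⟨C, hC1, fun r a N hr ha hN => ?_⟩
  have : NeZero r := ⟨hr⟩
  have hφ : (0 : ℝ) < r.totient := by exact_mod_cast Nat.totient_pos.2 (Nat.pos_of_ne_zero hr)
  set M := C * r * N / Real.log N ^ j + 2 * Real.log N * Real.log r with hM
  have hcard : Fintype.card (DirichletCharacter ℂ r) = r.totient := by
    rw [← Nat.card_eq_fintype_card]
    exact DirichletCharacter.card_eq_totient_of_hasEnoughRootsOfUnity ℂ r
  have hu : IsUnit ((a : ZMod r)⁻¹) := by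
    have hu : IsUnit (a : ZMod r) := (ZMod.isUnit_iff_coprime _ _).2 ha
    obtain ⟨u, hu⟩ := hu
    rw [← hu, ZMod.inv_coe_unit]
    exact Units.isUnit _
  have e : ((r.totient * psiMod N r a - N : ℝ) : ℂ) = ∑ χ : DirichletCharacter ℂ r,
      χ ((a : ZMod r)⁻¹) * (∑ n ∈ Finset.Icc 1 N, χ n * (Λ n : ℂ) -
        if χ = 1 then (N : ℂ) else 0) := by
    simp_rw [mul_sub]
    rw [Finset.sum_sub_distrib, ← totient_mul_psiMod ha]
    simp [MulChar.one_apply hu]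
  have h : ‖((r.totient * psiMod N r a - N : ℝ) : ℂ)‖ ≤ r.totient * M := by
    rw [e]
    refine (norm_sum_le _ _).trans ((Finset.sum_le_sum (g := fun _ => M) ?_).trans ?_)
    · intro χ _
      rw [norm_mul]
      exact (mul_le_of_le_one_left (norm_nonneg _) (DirichletCharacter.norm_le_one _ _)).trans
        (hC r χ N hN)
    · simp [hcard]
  rw [Complex.norm_real, Real.norm_eq_abs] at h
  have e2 : psiMod N r a - N / r.totient = (r.totient * psiMod N r a - N) / r.totient := by
    field_simp
  rw [e2, abs_div, abs_of_pos hφ, div_le_iff₀ hφ]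
  linarith

lemma sum_vonMangoldt_le_mul_log (N : ℕ) : ∑ n ∈ Finset.Icc 1 N, Λ n ≤ N * Real.log N := by
  refine (Finset.sum_le_sum (g := fun _ => Real.log N) fun n hn => ?_).trans (by simp)
  rw [Finset.mem_Icc] at hn
  exact ArithmeticFunction.vonMangoldt_le_log.trans
    (Real.log_le_log (by exact_mod_cast hn.1) (by exact_mod_cast hn.2))

lemma psiMod_le_sum (N r a : ℕ) : psiMod N r a ≤ ∑ n ∈ Finset.Icc 1 N, Λ n :=
  Finset.sum_le_sum_of_subset_of_nonneg (Finset.filter_subset _ _)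
    fun _ _ _ => ArithmeticFunction.vonMangoldt_nonneg

lemma log_pow_le_sqrt (m : ℕ) {x : ℝ} (hx : 1 ≤ x) :
    Real.log x ^ m ≤ 2 ^ m * m.factorial * √x := by
  have h := pow_log_le m (Real.one_le_sqrt.2 hx)
  rw [Real.log_sqrt (by linarith), div_pow, div_le_iff₀ (by positivity)] at h
  linarith

/-- The **Siegel–Walfisz theorem**. -/
theorem abs_psiMod_sub_le (j : ℕ) : ∃ C : ℝ, 1 ≤ C ∧
    ∀ (r a N : ℕ) (x : ℝ), r ≠ 0 → a.Coprime r → 81 ≤ x → N ≤ x →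
      |psiMod N r a - N / r.totient| ≤ C * r * x / Real.log x ^ j := by
  obtain ⟨C, hC1, hC⟩ := abs_psiMod_sub_le_aux j
  refine ⟨C * 2 ^ j + 2 * (2 ^ (j + 1) * (j + 1).factorial), ?_, fun r a N x hr ha hx hN => ?_⟩
  · have : (1 : ℝ) ≤ 2 ^ j := one_le_pow₀ (by norm_num)
    nlinarith [show (0 : ℝ) ≤ 2 * (2 ^ (j + 1) * (j + 1).factorial) by positivity]
  have hl : 1 ≤ Real.log x := one_le_log_of_three_le (by linarith)
  have hl0 : 0 < Real.log x := by linarith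
  have hr1 : (1 : ℝ) ≤ r := by exact_mod_cast Nat.one_le_iff_ne_zero.2 hr
  have hs := log_pow_le_sqrt (j + 1) (x := x) (by linarith)
  have hs0 : 9 ≤ √x := Real.le_sqrt_of_sq_le (by linarith)
  have hsx : √x * √x = x := Real.mul_self_sqrt (by linarith)
  have hlr : Real.log r ≤ r := (Real.log_le_sub_one_of_pos (by linarith)).trans (by linarith)
  rw [le_div_iff₀ (by positivity)]
  set F : ℝ := 2 ^ (j + 1) * (j + 1).factorial with hF
  have hF0 : 0 ≤ F := by positivity
  have hlogN : Real.log N ≤ Real.log x := by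
    rcases Nat.eq_zero_or_pos N with rfl | h
    · simpa using hl0.le
    · exact Real.log_le_log (by exact_mod_cast h) hN
  have hlogN0 : 0 ≤ Real.log N := Real.log_natCast_nonneg N
  have hkey : ∀ u : ℝ, 0 ≤ u → u ≤ √x * Real.log x → u * Real.log x ^ j ≤ F * x := by
    intro u hu0 hu
    calc u * Real.log x ^ j ≤ √x * Real.log x * Real.log x ^ j := by gcongr
      _ = √x * Real.log x ^ (j + 1) := by ring
      _ ≤ √x * (F * √x) := by gcongr
      _ = F * (√x * √x) := by ring
      _ = F * x := by rw [hsx]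
  rcases le_or_gt (√x) N with h | h
  · have h9 : 9 ≤ N := by exact_mod_cast hs0.trans h
    have hlN : Real.log x / 2 ≤ Real.log N := by
      rw [← Real.log_sqrt (by linarith)]
      exact Real.log_le_log (by linarith) h
    have h1 := hC r a N hr ha h9
    have h2 : C * r * N / Real.log N ^ j * Real.log x ^ j ≤ C * 2 ^ j * r * x := by
      rw [div_mul_eq_mul_div, div_le_iff₀ (by have : 0 < Real.log N := by linarith
                                              positivity)]
      calc C * r * N * Real.log x ^ j ≤ C * r * x * (2 * Real.log N) ^ j := by
            gcongr; linarith
        _ = _ := by ring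
    have h3 := hkey (Real.log N) hlogN0 (by nlinarith)
    calc |psiMod N r a - N / r.totient| * Real.log x ^ j
        ≤ (C * r * N / Real.log N ^ j + 2 * Real.log N * Real.log r) * Real.log x ^ j := by
          gcongr
      _ = C * r * N / Real.log N ^ j * Real.log x ^ j +
          2 * Real.log r * (Real.log N * Real.log x ^ j) := by ring
      _ ≤ C * 2 ^ j * r * x + 2 * r * (F * x) := by gcongr
      _ = _ := by ring
  · have h0 : |psiMod N r a - N / r.totient| ≤ √x * Real.log x := by
      have hφ : (1 : ℝ) ≤ r.totient := by
        exact_mod_cast Nat.totient_pos.2 (Nat.pos_of_ne_zero hr)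
      have h1 : psiMod N r a ≤ √x * Real.log x :=
        ((psiMod_le_sum N r a).trans (sum_vonMangoldt_le_mul_log N)).trans (by gcongr)
      have h2 : (N : ℝ) / r.totient ≤ N := div_le_self (by positivity) hφ
      have h3 : (0 : ℝ) ≤ N / r.totient := by positivity
      rw [abs_le]
      constructor <;> nlinarith [psiMod_nonneg N r a]
    have h1 := hkey _ (abs_nonneg _) h0
    have : (0:ℝ) < C * 2 ^ j := by positivity
    refine h1.trans ?_
    nlinarith [mul_nonneg (show 0 ≤ F * x by positivity) (show 0 ≤ (r : ℝ) - 1 by linarith), show 0 ≤ C * 2 ^ j * r * x by positivity, show 0 ≤ F * x by positivity]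

lemma sum_sub_mean_sq {ι : Type*} (s : Finset ι) (S : ι → ℝ) (c : ℝ) :
    ∑ b ∈ s, (S b - 1 / (s.card : ℝ) * ∑ b ∈ s, S b) ^ 2 =
      ∑ b ∈ s, (S b - c) ^ 2 - (∑ b ∈ s, S b - s.card * c) ^ 2 / s.card := by
  rcases s.eq_empty_or_nonempty with rfl | hs
  · simp
  have h : (s.card : ℝ) ≠ 0 := by exact_mod_cast hs.card_pos.ne'
  simp_rw [sub_sq, Finset.sum_add_distrib, Finset.sum_sub_distrib, ← Finset.sum_mul,
    ← Finset.mul_sum, Finset.sum_const, nsmul_eq_mul]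
  field_simp
  ring

lemma card_filter_gcd_eq {q h : ℕ} (hq : q ≠ 0) (hh : h ∣ q) :
    ((Finset.Icc 1 q).filter (fun b => Nat.gcd b q = h)).card = (q / h).totient := by
  rw [Nat.totient_div_of_dvd hh]
  refine Finset.card_nbij' (fun b => b % q) (fun b => if b = 0 then q else b) ?_ ?_ ?_ ?_
  · intro b hb
    simp only [Finset.coe_filter, Finset.mem_Icc, Finset.mem_range, mem_ofPred_eq] at hb ⊢
    refine ⟨Nat.mod_lt _ (Nat.pos_of_ne_zero hq), ?_⟩
    rw [← hb.2, Nat.gcd_comm b q, Nat.gcd_comm q, ← Nat.gcd_rec]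
  · intro b hb
    simp only [Finset.coe_filter, Finset.mem_Icc, Finset.mem_range, mem_ofPred_eq] at hb ⊢
    split_ifs with h0
    · subst h0
      simp at hb ⊢
      exact ⟨Nat.one_le_iff_ne_zero.2 hq, hb.2⟩
    · exact ⟨⟨Nat.one_le_iff_ne_zero.2 h0, hb.1.le⟩, by rw [Nat.gcd_comm]; exact hb.2⟩
  · intro b hb
    simp only [Finset.coe_filter, Finset.mem_Icc, mem_ofPred_eq] at hb ⊢
    rcases hb.1.2.lt_or_eq with h1 | h1
    · rw [Nat.mod_eq_of_lt h1, if_neg (by omega)]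
    · simp [h1]
  · intro b hb
    simp only [Finset.coe_filter, Finset.mem_range, mem_ofPred_eq] at hb ⊢
    split_ifs with h0
    · simp [h0]
    · exact Nat.mod_eq_of_lt hb.1

/-- The contribution of the modulus `q` to the variance. -/
noncomputable def varMod (N q : ℕ) : ℝ :=
  ∑ b ∈ Finset.Icc 1 q, (psiMod N q b - seqAver (fun n => Λ n) N q (Nat.gcd b q)) ^ 2

lemma seqSum_natCast (N q b : ℕ) : seqSum (fun n => Λ n) N q b = psiMod N q b := by
  simp [seqSum, psiMod]

lemma varV_eq_sum_varMod (x Q : ℝ) :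
    varV (fun n => Λ n) x Q = ∑ q ∈ Finset.Ioc ⌊Q / 2⌋₊ ⌊Q⌋₊, varMod ⌊x⌋₊ q := by
  simp [varV, varMod, psiMod, seqSum, seqAver]

lemma sum_sub_seqAver_sq {N q h : ℕ} (hq : q ≠ 0) (hh : h ∣ q) (c : ℝ) :
    ∑ b ∈ (Finset.Icc 1 q).filter (fun b => Nat.gcd b q = h),
        (psiMod N q b - seqAver (fun n => Λ n) N q h) ^ 2 =
      ∑ b ∈ (Finset.Icc 1 q).filter (fun b => Nat.gcd b q = h), (psiMod N q b - c) ^ 2 -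
        (∑ b ∈ (Finset.Icc 1 q).filter (fun b => Nat.gcd b q = h), psiMod N q b -
          (q / h).totient * c) ^ 2 / (q / h).totient := by
  rw [← card_filter_gcd_eq hq hh, ← sum_sub_mean_sq, seqAver, card_filter_gcd_eq hq hh]
  simp_rw [seqSum_natCast]

/-- Residue classes not coprime to `q` contribute at most the sum of the squares. -/
lemma sum_not_coprime_sub_seqAver_sq_le {N q : ℕ} (hq : q ≠ 0) :
    ∑ b ∈ (Finset.Icc 1 q).filter (fun b => ¬ b.Coprime q),
        (psiMod N q b - seqAver (fun n => Λ n) N q (Nat.gcd b q)) ^ 2 ≤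
      ∑ b ∈ (Finset.Icc 1 q).filter (fun b => ¬ b.Coprime q), psiMod N q b ^ 2 := by
  have hmap : ∀ b ∈ (Finset.Icc 1 q).filter (fun b => ¬ b.Coprime q),
      Nat.gcd b q ∈ q.divisors.erase 1 := by
    intro b hb
    rw [Finset.mem_filter] at hb
    rw [Finset.mem_erase, Nat.mem_divisors]
    exact ⟨hb.2, Nat.gcd_dvd_right b q, hq⟩
  rw [← Finset.sum_fiberwise_of_maps_to hmap, ← Finset.sum_fiberwise_of_maps_to hmap]
  refine Finset.sum_le_sum fun h hh => ?_
  rw [Finset.mem_erase, Nat.mem_divisors] at hh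
  have e : ((Finset.Icc 1 q).filter (fun b => ¬ b.Coprime q)).filter (fun b => Nat.gcd b q = h) =
      (Finset.Icc 1 q).filter (fun b => Nat.gcd b q = h) := by
    ext b
    simp only [Finset.mem_filter]
    constructor
    · exact fun hb => ⟨hb.1.1, hb.2⟩
    · exact fun hb => ⟨⟨hb.1, fun hc => hh.1 (hb.2.symm.trans hc)⟩, hb.2⟩
  rw [e]
  have h1 := sum_sub_seqAver_sq (N := N) hq hh.2.1 0
  rw [Finset.sum_congr rfl (g := fun b => (psiMod N q b - seqAver (fun n => Λ n) N q h) ^ 2)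
    fun b hb => by rw [(Finset.mem_filter.1 hb).2], h1]
  simp only [sub_zero, mul_zero]
  have : (0 : ℝ) ≤ (∑ b ∈ (Finset.Icc 1 q).filter (fun b => Nat.gcd b q = h), psiMod N q b) ^ 2 /
    (q / h).totient := by positivity
  linarith

/-- A sum over residue classes of sums over the classes is the full sum. -/
lemma sum_residue_classes {q : ℕ} (hq : q ≠ 0) (N : ℕ) (P : ℕ → Prop) [DecidablePred P]
    (hP : ∀ m n, n % q = m % q → (P n ↔ P m)) (f : ℕ → ℝ) :
    ∑ b ∈ (Finset.Icc 1 q).filter P,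
        ∑ n ∈ (Finset.Icc 1 N).filter (fun n => n % q = b % q), f n =
      ∑ n ∈ (Finset.Icc 1 N).filter P, f n := by
  set g : ℕ → ℕ := fun n => if n % q = 0 then q else n % q with hg
  have hgq : ∀ n, g n % q = n % q := by
    intro n
    simp only [hg]
    split_ifs with h
    · simp [h]
    · exact Nat.mod_mod _ _
  have hgI : ∀ n, g n ∈ Finset.Icc 1 q := by
    intro n
    have := Nat.mod_lt n (Nat.pos_of_ne_zero hq)
    simp only [hg, Finset.mem_Icc]
    split_ifs with h <;> omega
  have huniq : ∀ b ∈ Finset.Icc 1 q, ∀ n, n % q = b % q → g n = b := by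
    intro b hb n h
    rw [Finset.mem_Icc] at hb
    simp only [hg, h]
    rcases hb.2.lt_or_eq with h1 | h1
    · rw [Nat.mod_eq_of_lt h1, if_neg (by omega)]
    · simp [h1]
  rw [← Finset.sum_fiberwise_of_maps_to (t := (Finset.Icc 1 q).filter P) (g := g)
    (s := (Finset.Icc 1 N).filter P)]
  · refine Finset.sum_congr rfl fun b hb => Finset.sum_congr ?_ fun _ _ => rfl
    rw [Finset.mem_filter] at hb
    ext n
    simp only [Finset.mem_filter]
    constructor
    · exact fun h => ⟨⟨h.1, (hP _ _ h.2).2 hb.2⟩, huniq b hb.1 n h.2⟩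
    · rintro ⟨⟨h1, _⟩, h2⟩
      exact ⟨h1, by rw [← h2, hgq]⟩
  · intro n hn
    rw [Finset.mem_filter] at hn ⊢
    exact ⟨hgI n, (hP _ _ (hgq n)).2 hn.2⟩

lemma coprime_congr {q m n : ℕ} (h : n % q = m % q) : n.Coprime q ↔ m.Coprime q := by
  rw [Nat.Coprime, Nat.Coprime, Nat.gcd_comm n, Nat.gcd_comm m, Nat.gcd_rec q n, Nat.gcd_rec q m,
    h]

lemma sum_psiMod_coprime {q : ℕ} (hq : q ≠ 0) (N : ℕ) :
    ∑ b ∈ (Finset.Icc 1 q).filter (fun b => b.Coprime q), psiMod N q b =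
      ∑ n ∈ (Finset.Icc 1 N).filter (fun n => n.Coprime q), Λ n :=
  sum_residue_classes hq N _ (fun _ _ h => coprime_congr h) _

lemma sum_psiMod_not_coprime_sq_le {q : ℕ} (hq : q ≠ 0) (N : ℕ) :
    ∑ b ∈ (Finset.Icc 1 q).filter (fun b => ¬ b.Coprime q), psiMod N q b ^ 2 ≤
      (2 * Real.log N * Real.log q) ^ 2 := by
  refine (Finset.sum_sq_le_sq_sum_of_nonneg fun b _ => psiMod_nonneg N q b).trans ?_
  refine pow_le_pow_left₀ (Finset.sum_nonneg fun b _ => psiMod_nonneg N q b) ?_ 2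
  refine ((sum_residue_classes hq N (fun n => ¬ n.Coprime q)
    (fun _ _ h => not_congr (coprime_congr h)) _).trans_le
    (sum_not_coprime_vonMangoldt_le N hq)).trans ?_
  exact mul_le_mul_of_nonneg_right (natLog_le_two_mul_log N) (Real.log_natCast_nonneg q)

lemma varMod_split (N q : ℕ) (hq : q ≠ 0) (c : ℝ) :
    varMod N q = (∑ b ∈ (Finset.Icc 1 q).filter (fun b => b.Coprime q), (psiMod N q b - c) ^ 2 -
        (∑ n ∈ (Finset.Icc 1 N).filter (fun n => n.Coprime q), Λ n - q.totient * c) ^ 2 /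
          q.totient) +
      ∑ b ∈ (Finset.Icc 1 q).filter (fun b => ¬ b.Coprime q),
        (psiMod N q b - seqAver (fun n => Λ n) N q (Nat.gcd b q)) ^ 2 := by
  have h := sum_sub_seqAver_sq (N := N) hq (one_dvd q) c
  rw [Nat.div_one] at h
  rw [varMod, ← Finset.sum_filter_add_sum_filter_not _ (fun b => b.Coprime q)]
  congr 1
  rw [← sum_psiMod_coprime hq]
  refine Eq.trans ?_ h
  exact Finset.sum_congr rfl fun b hb => by rw [(Finset.mem_filter.1 hb).2]

/-- The average is the optimal approximation. -/
lemma varMod_le (N q : ℕ) (hq : q ≠ 0) (c : ℝ) :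
    varMod N q ≤ ∑ b ∈ (Finset.Icc 1 q).filter (fun b => b.Coprime q), (psiMod N q b - c) ^ 2 +
      (2 * Real.log N * Real.log q) ^ 2 := by
  rw [varMod_split N q hq c]
  have h1 := (sum_not_coprime_sub_seqAver_sq_le (N := N) hq).trans
    (sum_psiMod_not_coprime_sq_le hq N)
  have h2 : 0 ≤ (∑ n ∈ (Finset.Icc 1 N).filter (fun n => n.Coprime q), Λ n - q.totient * c) ^ 2 /
          q.totient := by positivity
  linarith

lemma abs_varMod_sub_le (N q : ℕ) (hq : q ≠ 0) :
    |varMod N q - (∑ b ∈ Finset.Icc 1 q, psiMod N q b ^ 2 -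
      (∑ n ∈ (Finset.Icc 1 N).filter (fun n => n.Coprime q), Λ n) ^ 2 / q.totient)| ≤
      (2 * Real.log N * Real.log q) ^ 2 := by
  rw [varMod_split N q hq 0,
    ← Finset.sum_filter_add_sum_filter_not (Finset.Icc 1 q) (fun b => b.Coprime q)]
  have h1 := (sum_not_coprime_sub_seqAver_sq_le (N := N) hq)
  have h2 := (sum_psiMod_not_coprime_sq_le hq N)
  have h3 : 0 ≤ ∑ b ∈ (Finset.Icc 1 q).filter (fun b => ¬ b.Coprime q),
    (psiMod N q b - seqAver (fun n => Λ n) N q (Nat.gcd b q)) ^ 2 :=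
    Finset.sum_nonneg fun _ _ => sq_nonneg _
  simp only [sub_zero, mul_zero]
  rw [abs_le]
  constructor <;> linarith

/-- Correlations `∑ Λ(m)Λ(n)` over `m + h < n ≤ N` with `n ≡ m (mod r)`. -/
noncomputable def pairSum (N r h : ℕ) : ℝ :=
  ∑ m ∈ Finset.Icc 1 N, ∑ n ∈ Finset.Icc 1 N,
    if m + h < n ∧ n % r = m % r then Λ m * Λ n else 0

lemma sum_psiMod_sq {q : ℕ} (hq : q ≠ 0) (N : ℕ) :
    ∑ b ∈ Finset.Icc 1 q, psiMod N q b ^ 2 =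
      ∑ n ∈ Finset.Icc 1 N, Λ n ^ 2 + 2 * pairSum N q 0 := by
  have h1 : ∑ b ∈ Finset.Icc 1 q, psiMod N q b ^ 2 =
      ∑ n ∈ Finset.Icc 1 N, Λ n * psiMod N q n := by
    have := sum_residue_classes hq N (fun _ => True) (fun _ _ _ => Iff.rfl)
      (fun n => Λ n * psiMod N q n)
    simp only [Finset.filter_true] at this
    rw [← this]
    refine Finset.sum_congr rfl fun b _ => ?_
    rw [sq]
    nth_rw 1 [psiMod]
    rw [Finset.sum_mul]
    refine Finset.sum_congr rfl fun n hn => ?_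
    rw [psiMod, psiMod, (Finset.mem_filter.1 hn).2]
  have h2 : ∀ m ∈ Finset.Icc 1 N, Λ m * psiMod N q m = Λ m ^ 2 +
      (∑ n ∈ Finset.Icc 1 N, (if m + 0 < n ∧ n % q = m % q then Λ m * Λ n else 0) +
        ∑ n ∈ Finset.Icc 1 N, (if n + 0 < m ∧ m % q = n % q then Λ n * Λ m else 0)) := by
    intro m hm
    have e : Λ m ^ 2 = ∑ n ∈ Finset.Icc 1 N, if n = m then Λ m * Λ n else 0 := by
      rw [Finset.sum_ite_eq' , if_pos hm, sq]
    rw [e, ← Finset.sum_add_distrib, ← Finset.sum_add_distrib, psiMod, Finset.sum_filter,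
      Finset.mul_sum]
    refine Finset.sum_congr rfl fun n _ => ?_
    rcases lt_trichotomy m n with h | h | h
    · simp only [add_zero, h, true_and, h.ne', if_false, h.not_gt, false_and]
      split_ifs <;> simp
    · simp [h]
    · simp only [add_zero, h, true_and, h.ne, if_false, h.not_gt, false_and]
      by_cases h' : n % q = m % q
      · simp [h', mul_comm]
      · simp [h', Ne.symm h']
  rw [h1, Finset.sum_congr rfl h2, Finset.sum_add_distrib, Finset.sum_add_distrib, pairSum,
    Finset.sum_comm (f := fun m n => if n + 0 < m ∧ m % q = n % q then Λ n * Λ m else 0)]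
  ring

lemma card_divisors_Ioc {k H₁ H₂ R : ℕ} (hk : 0 < k) (hkR : k ≤ (R + 1) * H₁) :
    ((Finset.Ioc H₁ H₂).filter (fun q => q ∣ k)).card =
      ((Finset.Icc 1 R).filter (fun r => r ∣ k ∧ r * H₁ < k ∧ k ≤ r * H₂)).card := by
  refine Finset.card_nbij' (fun q => k / q) (fun r => k / r) ?_ ?_ ?_ ?_
  · intro q hq
    simp only [Finset.coe_filter, Finset.mem_Ioc, Finset.mem_Icc, mem_ofPred_eq] at hq ⊢
    obtain ⟨⟨h1, h2⟩, r, rfl⟩ := hq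
    have hq0 : 0 < q := by omega
    have hr0 : 0 < r := Nat.pos_of_ne_zero (by rintro rfl; simp at hk)
    rw [Nat.mul_div_cancel_left _ hq0]
    refine ⟨⟨hr0, ?_⟩, Dvd.intro_left q rfl, ?_, ?_⟩
    · by_contra h
      have : (R + 1) * H₁ < r * q := by
        have h3 : R + 1 ≤ r := by omega
        calc (R + 1) * H₁ ≤ r * H₁ := Nat.mul_le_mul_right _ h3
          _ < r * q := Nat.mul_lt_mul_of_pos_left h1 hr0
      rw [mul_comm r q] at this; omega
    · rw [mul_comm q r]; exact Nat.mul_lt_mul_of_pos_left h1 hr0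
    · rw [mul_comm q r]; exact Nat.mul_le_mul_left _ h2
  · intro r hr
    simp only [Finset.coe_filter, Finset.mem_Ioc, Finset.mem_Icc, mem_ofPred_eq] at hr ⊢
    obtain ⟨⟨h1, h2⟩, ⟨q, rfl⟩, h3, h4⟩ := hr
    rw [Nat.mul_div_cancel_left _ h1]
    exact ⟨⟨Nat.lt_of_mul_lt_mul_left h3, Nat.le_of_mul_le_mul_left h4 h1⟩, Dvd.intro_left r rfl⟩
  · intro q hq
    simp only [Finset.coe_filter, Finset.mem_Ioc, mem_ofPred_eq] at hq
    exact Nat.div_div_self hq.2 hk.ne'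
  · intro r hr
    simp only [Finset.coe_filter, Finset.mem_Icc, mem_ofPred_eq] at hr
    exact Nat.div_div_self hr.2.1 hk.ne'

lemma mod_eq_iff_dvd_sub {m n q : ℕ} (h : m < n) : n % q = m % q ↔ q ∣ n - m :=
  ⟨fun h' => (Nat.modEq_iff_dvd' h.le).1 h'.symm, fun h' => ((Nat.modEq_iff_dvd' h.le).2 h').symm⟩

/-- Switching to the complementary divisor. -/
lemma sum_pairSum_eq {N H₁ H₂ R : ℕ} (hH : H₁ ≤ H₂) (hR : N ≤ (R + 1) * H₁) :
    ∑ q ∈ Finset.Ioc H₁ H₂, pairSum N q 0 =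
      ∑ r ∈ Finset.Icc 1 R, (pairSum N r (r * H₁) - pairSum N r (r * H₂)) := by
  simp only [pairSum]
  simp_rw [← Finset.sum_sub_distrib]
  rw [Finset.sum_comm, Finset.sum_comm (s := Finset.Icc 1 R)]
  refine Finset.sum_congr rfl fun m hm => ?_
  rw [Finset.sum_comm, Finset.sum_comm (s := Finset.Icc 1 R)]
  refine Finset.sum_congr rfl fun n hn => ?_
  rw [Finset.mem_Icc] at hm hn
  rcases le_or_gt n m with h | h
  · rw [Finset.sum_eq_zero, Finset.sum_eq_zero]
    · intro r _
      rw [if_neg (by omega), if_neg (by omega), sub_zero]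
    · intro q _
      rw [if_neg (by omega)]
  · have hk : 0 < n - m := by omega
    have h1 := card_divisors_Ioc (H₁ := H₁) (H₂ := H₂) (R := R) hk (by omega)
    have h2 : ∀ r, ((if m + r * H₁ < n ∧ n % r = m % r then Λ m * Λ n else 0) -
        if m + r * H₂ < n ∧ n % r = m % r then Λ m * Λ n else 0) =
        if r ∣ n - m ∧ r * H₁ < n - m ∧ n - m ≤ r * H₂ then Λ m * Λ n else 0 := by
      intro r
      simp only [mod_eq_iff_dvd_sub h]
      have h3 : r * H₁ ≤ r * H₂ := Nat.mul_le_mul_left _ hH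
      by_cases hd : r ∣ n - m
      · simp only [hd, and_true, true_and]
        by_cases ha : m + r * H₁ < n <;> by_cases hb : m + r * H₂ < n
        · rw [if_pos ha, if_pos hb, if_neg (by omega), sub_self]
        · rw [if_pos ha, if_neg hb, if_pos (by omega), sub_zero]
        · omega
        · rw [if_neg ha, if_neg hb, if_neg (by omega), sub_zero]
      · simp [hd]
    simp_rw [h2, mod_eq_iff_dvd_sub h]
    simp only [add_zero, h, true_and]
    rw [← Finset.sum_filter, ← Finset.sum_filter, Finset.sum_const, Finset.sum_const, h1]

lemma psiMod_mono {M N : ℕ} (h : M ≤ N) (r a : ℕ) : psiMod M r a ≤ psiMod N r a :=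
  Finset.sum_le_sum_of_subset_of_nonneg
    (Finset.filter_subset_filter _ (Finset.Icc_subset_Icc_right h))
    fun _ _ _ => ArithmeticFunction.vonMangoldt_nonneg

lemma pairSum_eq (N r h : ℕ) :
    pairSum N r h =
      ∑ m ∈ Finset.Icc 1 (N - h), Λ m * (psiMod N r m - psiMod (m + h) r m) := by
  have hsub : Finset.Icc 1 (N - h) ⊆ Finset.Icc 1 N :=
    Finset.Icc_subset_Icc_right (Nat.sub_le N h)
  rw [pairSum, ← Finset.sum_subset hsub]
  · refine Finset.sum_congr rfl fun m hm => ?_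
    rw [Finset.mem_Icc] at hm
    rw [psiMod, psiMod, ← Finset.sum_sdiff_eq_sub (Finset.filter_subset_filter _
      (Finset.Icc_subset_Icc_right (by omega))), Finset.mul_sum, ← Finset.sum_filter]
    refine Finset.sum_congr ?_ fun _ _ => rfl
    ext n
    simp only [Finset.mem_filter, Finset.mem_sdiff, Finset.mem_Icc]
    constructor
    · rintro ⟨h1, h2, h3⟩
      exact ⟨⟨h1, h3⟩, fun h4 => by omega⟩
    · rintro ⟨⟨h1, h3⟩, h4⟩
      refine ⟨h1, ?_, h3⟩
      by_contra h5
      exact h4 ⟨⟨h1.1, by omega⟩, h3⟩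
  · intro m hm hm'
    rw [Finset.mem_Icc] at hm hm'
    refine Finset.sum_eq_zero fun n hn => if_neg ?_
    rw [Finset.mem_Icc] at hn
    omega

lemma sum_vonMangoldt_mul_sub (M : ℕ) :
    ∑ m ∈ Finset.Icc 1 M, Λ m * ((M : ℝ) - m) = ∑ k ∈ Finset.range M, psiMod k 1 0 := by
  induction M with
  | zero => simp
  | succ M ih =>
    rw [Finset.sum_range_succ, ← ih, ← Finset.insert_Icc_right_eq_Icc_add_one (by omega),
      Finset.sum_insert (by simp)]
    have : psiMod M 1 0 = ∑ m ∈ Finset.Icc 1 M, Λ m := by simp [psiMod, Nat.mod_one]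
    rw [this, ← Finset.sum_add_distrib]
    push_cast
    rw [sub_self, mul_zero, zero_add]
    exact Finset.sum_congr rfl fun _ _ => by ring

lemma mul_log_pow_le {i j : ℕ} {x : ℝ} (hx : 3 ≤ x) :
    x * Real.log x ^ i ≤ (i + j).factorial * (x ^ 2 / Real.log x ^ j) := by
  have hl := one_le_log_of_three_le hx
  have h := pow_log_le (i + j) (y := x) (by linarith)
  rw [← mul_div_assoc, le_div_iff₀ (by positivity)]
  calc x * Real.log x ^ i * Real.log x ^ j = x * Real.log x ^ (i + j) := by ring
    _ ≤ x * ((i + j).factorial * x) := by gcongr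
    _ = _ := by ring

lemma log_natCast_le_log {N : ℕ} {x : ℝ} (hx : 1 ≤ x) (hN : N ≤ x) : Real.log N ≤ Real.log x := by
  rcases Nat.eq_zero_or_pos N with rfl | h
  · simpa using Real.log_nonneg hx
  · exact Real.log_le_log (by exact_mod_cast h) hN

lemma abs_pairSum_sub_le (j : ℕ) : ∃ C : ℝ, 1 ≤ C ∧
    ∀ (r N h : ℕ) (x : ℝ), r ≠ 0 → 81 ≤ x → N ≤ x →
      |pairSum N r h - ((N - h : ℕ) : ℝ) ^ 2 / (2 * r.totient)| ≤
        C * r * (x ^ 2 / Real.log x ^ j) := by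
  obtain ⟨C, hC1, hC⟩ := abs_psiMod_sub_le (j + 1)
  refine ⟨2 * C + 2 * (2 + j).factorial + C + j.factorial, ?_, fun r N h x hr hx hN => ?_⟩
  · have : (0 : ℝ) ≤ (2 + j).factorial := by positivity
    have : (0 : ℝ) ≤ j.factorial := by positivity
    linarith
  have hl : 1 ≤ Real.log x := one_le_log_of_three_le (by linarith)
  have hr1 : (1 : ℝ) ≤ r := by exact_mod_cast Nat.one_le_iff_ne_zero.2 hr
  have hφ : (1 : ℝ) ≤ r.totient := by
    exact_mod_cast Nat.totient_pos.2 (Nat.pos_of_ne_zero hr)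
  have hlr : Real.log r ≤ r := (Real.log_le_sub_one_of_pos (by linarith)).trans (by linarith)
  have hlN := log_natCast_le_log (by linarith) hN
  have hlN0 : 0 ≤ Real.log N := Real.log_natCast_nonneg N
  obtain ⟨M, hM⟩ : ∃ M, M = N - h := ⟨_, rfl⟩
  have hMN : M ≤ N := by omega
  have hMx : (M : ℝ) ≤ x := le_trans (by exact_mod_cast hMN) hN
  have hΛM : ∑ m ∈ Finset.Icc 1 M, Λ m ≤ x * Real.log x :=
    (sum_vonMangoldt_le_mul_log M).trans (by
      have := log_natCast_le_log (by linarith) hMx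
      have := Real.log_natCast_nonneg M
      gcongr)
  have hΛN : ∑ m ∈ Finset.Icc 1 N, Λ m ≤ x * Real.log x :=
    (sum_vonMangoldt_le_mul_log N).trans (by gcongr)
  set D : ℕ → ℝ := fun m => psiMod N r m - psiMod (m + h) r m - ((M : ℝ) - m) / r.totient with hD
  have hcop : ∀ m ∈ Finset.Icc 1 M, m.Coprime r →
      |D m| ≤ 2 * (C * r * x / Real.log x ^ (j + 1)) := by
    intro m hm hmr
    rw [Finset.mem_Icc] at hm
    have h1 := hC r m N x hr hmr hx hN
    have h2 := hC r m (m + h) x hr hmr hx (le_trans (by exact_mod_cast (by omega)) hN)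
    have e : D m = (psiMod N r m - N / r.totient) -
        (psiMod (m + h) r m - ((m + h : ℕ) : ℝ) / r.totient) := by
      have : N = M + h := by omega
      simp only [hD, this]; push_cast; ring
    rw [e]
    refine (abs_sub _ _).trans ?_
    linarith
  have htriv : ∀ m ∈ Finset.Icc 1 M, |D m| ≤ x * Real.log x := by
    intro m hm
    rw [Finset.mem_Icc] at hm
    have h1 : psiMod (m + h) r m ≤ psiMod N r m := psiMod_mono (by omega) r m
    have h2 := psiMod_nonneg (m + h) r m
    have h3 := psiMod_le_sum N r m
    have hmM : (m : ℝ) ≤ M := by exact_mod_cast hm.2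
    have h4 : 0 ≤ ((M : ℝ) - m) / r.totient := div_nonneg (by linarith) (by linarith)
    have h5 : ((M : ℝ) - m) / r.totient ≤ x :=
      (div_le_self (by linarith) hφ).trans (by linarith [(Nat.cast_nonneg m : (0 : ℝ) ≤ m)])
    simp only [hD]
    rw [abs_le]
    constructor <;> nlinarith
  have e : pairSum N r h - ((N - h : ℕ) : ℝ) ^ 2 / (2 * r.totient) =
      ∑ m ∈ (Finset.Icc 1 M).filter (fun m => m.Coprime r), Λ m * D m +
      ∑ m ∈ (Finset.Icc 1 M).filter (fun m => ¬ m.Coprime r), Λ m * D m +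
      (∑ m ∈ Finset.Icc 1 M, Λ m * ((M : ℝ) - m) - (M : ℝ) ^ 2 / 2) / r.totient := by
    rw [Finset.sum_filter_add_sum_filter_not, pairSum_eq, ← hM, sub_div, Finset.sum_div,
      add_sub, ← Finset.sum_add_distrib]
    congr 1
    · refine Finset.sum_congr rfl fun m _ => ?_
      simp only [hD]; ring
    · rw [div_div]
  have b1 : |∑ m ∈ (Finset.Icc 1 M).filter (fun m => m.Coprime r), Λ m * D m| ≤
      2 * C * r * (x ^ 2 / Real.log x ^ j) := by
    refine (Finset.abs_sum_le_sum_abs _ _).trans ?_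
    calc _ ≤ ∑ m ∈ (Finset.Icc 1 M).filter (fun m => m.Coprime r),
            Λ m * (2 * (C * r * x / Real.log x ^ (j + 1))) := by
          refine Finset.sum_le_sum fun m hm => ?_
          rw [Finset.mem_filter] at hm
          rw [abs_mul, abs_of_nonneg ArithmeticFunction.vonMangoldt_nonneg]
          exact mul_le_mul_of_nonneg_left (hcop m hm.1 hm.2)
            ArithmeticFunction.vonMangoldt_nonneg
      _ ≤ (x * Real.log x) * (2 * (C * r * x / Real.log x ^ (j + 1))) := by
          rw [← Finset.sum_mul]
          refine mul_le_mul_of_nonneg_right (le_trans ?_ hΛM) (by positivity)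
          exact Finset.sum_le_sum_of_subset_of_nonneg (Finset.filter_subset _ _)
            fun _ _ _ => ArithmeticFunction.vonMangoldt_nonneg
      _ = _ := by field_simp; ring
  have b2 : |∑ m ∈ (Finset.Icc 1 M).filter (fun m => ¬ m.Coprime r), Λ m * D m| ≤
      2 * (2 + j).factorial * r * (x ^ 2 / Real.log x ^ j) := by
    refine (Finset.abs_sum_le_sum_abs _ _).trans ?_
    calc _ ≤ ∑ m ∈ (Finset.Icc 1 M).filter (fun m => ¬ m.Coprime r),
            Λ m * (x * Real.log x) := by
          refine Finset.sum_le_sum fun m hm => ?_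
          rw [Finset.mem_filter] at hm
          rw [abs_mul, abs_of_nonneg ArithmeticFunction.vonMangoldt_nonneg]
          exact mul_le_mul_of_nonneg_left (htriv m hm.1)
            ArithmeticFunction.vonMangoldt_nonneg
      _ ≤ (2 * Real.log x * r) * (x * Real.log x) := by
          rw [← Finset.sum_mul]
          refine mul_le_mul_of_nonneg_right ?_ (by positivity)
          refine (sum_not_coprime_vonMangoldt_le M hr).trans ?_
          have h1 := natLog_le_two_mul_log M
          have h2 := log_natCast_le_log (by linarith) hMx
          have h3 := Real.log_natCast_nonneg r
          have h4 := Real.log_natCast_nonneg M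
          gcongr
          linarith
      _ = 2 * r * (x * Real.log x ^ 2) := by ring
      _ ≤ 2 * r * ((2 + j).factorial * (x ^ 2 / Real.log x ^ j)) :=
          mul_le_mul_of_nonneg_left (mul_log_pow_le (by linarith)) (by positivity)
      _ = _ := by ring
  have b3 : |(∑ m ∈ Finset.Icc 1 M, Λ m * ((M : ℝ) - m) - (M : ℝ) ^ 2 / 2) / r.totient| ≤
      (C + j.factorial) * (x ^ 2 / Real.log x ^ j) := by
    rw [abs_div, abs_of_pos (by linarith : (0 : ℝ) < r.totient)]
    refine (div_le_self (abs_nonneg _) hφ).trans ?_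
    have e1 : ∑ m ∈ Finset.Icc 1 M, Λ m * ((M : ℝ) - m) - (M : ℝ) ^ 2 / 2 =
        ∑ k ∈ Finset.range M, (psiMod k 1 0 - k) - M / 2 := by
      rw [sum_vonMangoldt_mul_sub, Finset.sum_sub_distrib]
      have := Finset.sum_range_id_mul_two M
      have h2 : (∑ k ∈ Finset.range M, (k : ℝ)) * 2 = M * (M - 1) := by
        rcases Nat.eq_zero_or_pos M with h0 | h0
        · simp [h0]
        · have h3 : ((∑ k ∈ Finset.range M, k : ℕ) : ℝ) * 2 = M * ((M - 1 : ℕ) : ℝ) := by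
            exact_mod_cast this
          rw [Nat.cast_sub h0] at h3
          push_cast at h3; exact h3
      linarith
    have h1 : |∑ k ∈ Finset.range M, (psiMod k 1 0 - k)| ≤
        x * (C * x / Real.log x ^ (j + 1)) := by
      refine (Finset.abs_sum_le_sum_abs _ _).trans ?_
      refine (Finset.sum_le_sum (g := fun _ => C * x / Real.log x ^ (j + 1)) ?_).trans ?_
      · intro k hk
        rw [Finset.mem_range] at hk
        have h3 := hC 1 0 k x one_ne_zero (Nat.coprime_one_right 0) hx
          (le_trans (by exact_mod_cast hk.le) hMx)
        simpa using h3
      · rw [Finset.sum_const, Finset.card_range, nsmul_eq_mul]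
        gcongr
    have h2 : x * (C * x / Real.log x ^ (j + 1)) ≤ C * (x ^ 2 / Real.log x ^ j) := by
      have : Real.log x ^ j ≤ Real.log x ^ (j + 1) := pow_le_pow_right₀ hl (Nat.le_succ j)
      calc x * (C * x / Real.log x ^ (j + 1)) = C * (x ^ 2 / Real.log x ^ (j + 1)) := by ring
        _ ≤ _ := by gcongr
    have h3 := mul_log_pow_le (i := 0) (j := j) (x := x) (by linarith)
    rw [pow_zero, mul_one, zero_add] at h3
    rw [e1]
    refine (abs_sub _ _).trans ?_
    rw [abs_of_nonneg (by positivity : (0 : ℝ) ≤ M / 2)]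
    linarith
  rw [e]
  refine (abs_add_three _ _ _).trans ?_
  have hpos : 0 ≤ (C + j.factorial) * (x ^ 2 / Real.log x ^ j) := by positivity
  nlinarith [mul_le_mul_of_nonneg_left hr1 hpos]

end VarianceBDH

namespace VarianceBDH

open Complex MeasureTheory Set Filter Topology

/-- `μ²(d)/φ(d)`. -/
noncomputable def sqfreeInvTotient (d : ℕ) : ℝ := if Squarefree d then 1 / d.totient else 0

lemma sqfreeInvTotient_nonneg (d : ℕ) : 0 ≤ sqfreeInvTotient d := by
  unfold sqfreeInvTotient; split_ifs <;> positivity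

lemma totient_of_squarefree {d : ℕ} (hd : Squarefree d) :
    d.totient = ∏ p ∈ d.primeFactors, (p - 1) := by
  have h := Nat.totient_mul_prod_primeFactors d
  rw [Nat.prod_primeFactors_of_squarefree hd, mul_comm] at h
  exact Nat.eq_of_mul_eq_mul_left (Nat.pos_of_ne_zero hd.ne_zero) h

lemma cast_div_totient {r : ℕ} (hr : r ≠ 0) :
    (r : ℝ) / r.totient = ∏ p ∈ r.primeFactors, (1 + 1 / ((p : ℝ) - 1)) := by
  have h := Nat.totient_mul_prod_primeFactors r
  have hφ : (r.totient : ℝ) ≠ 0 := by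
    exact_mod_cast (Nat.totient_pos.2 (Nat.pos_of_ne_zero hr)).ne'
  have hpos : ∀ p ∈ r.primeFactors, (0 : ℝ) < (p : ℝ) - 1 := by
    intro p hp
    have : (1 : ℝ) < p := by exact_mod_cast (Nat.prime_of_mem_primeFactors hp).one_lt
    linarith
  have hcast : ((∏ p ∈ r.primeFactors, (p - 1) : ℕ) : ℝ) =
      ∏ p ∈ r.primeFactors, ((p : ℝ) - 1) := by
    rw [Nat.cast_prod]
    refine Finset.prod_congr rfl fun p hp => ?_
    rw [Nat.cast_sub (Nat.prime_of_mem_primeFactors hp).one_le, Nat.cast_one]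
  have h' : (r.totient : ℝ) * ∏ p ∈ r.primeFactors, (p : ℝ) =
      r * ∏ p ∈ r.primeFactors, ((p : ℝ) - 1) := by
    rw [← hcast, ← Nat.cast_prod, ← Nat.cast_mul, h, Nat.cast_mul]
  have e : ∏ p ∈ r.primeFactors, (1 + 1 / ((p : ℝ) - 1)) =
      (∏ p ∈ r.primeFactors, (p : ℝ)) / ∏ p ∈ r.primeFactors, ((p : ℝ) - 1) := by
    rw [← Finset.prod_div_distrib]
    refine Finset.prod_congr rfl fun p hp => ?_
    have := (hpos p hp).ne'
    field_simp
    ring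
  rw [e, div_eq_div_iff hφ (Finset.prod_pos hpos).ne', ← h']
  ring

lemma cast_div_totient_eq_sum {r : ℕ} (hr : r ≠ 0) :
    (r : ℝ) / r.totient = ∑ d ∈ r.divisors, sqfreeInvTotient d := by
  rw [cast_div_totient hr, Finset.prod_one_add]
  simp only [sqfreeInvTotient]
  rw [← Finset.sum_filter, Nat.sum_divisors_filter_squarefree hr]
  have e : (UniqueFactorizationMonoid.normalizedFactors r).toFinset = r.primeFactors := by
    rw [Nat.factors_eq]; rfl
  rw [e]
  refine Finset.sum_congr rfl fun S hS => ?_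
  rw [Finset.mem_powerset] at hS
  have hp : ∀ p ∈ S, p.Prime := fun p hp => Nat.prime_of_mem_primeFactors (hS hp)
  have hval : S.val.prod = ∏ p ∈ S, p := by
    rw [Finset.prod_val]
    rfl
  have hsq : Squarefree (∏ p ∈ S, p) := by
    refine Finset.squarefree_prod_of_pairwise_isCoprime (fun p hpS q hqS hpq => ?_)
      fun p hpS => (hp p hpS).squarefree
    exact Nat.coprime_iff_isRelPrime.1 ((Nat.coprime_primes (hp p hpS) (hp q hqS)).2 hpq)
  rw [hval, totient_of_squarefree hsq, Nat.primeFactors_prod hp, Nat.cast_prod,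
    Finset.prod_div_distrib, Finset.prod_const_one]
  congr 1
  refine Finset.prod_congr rfl fun p hp' => ?_
  rw [Nat.cast_sub (hp p hp').one_le, Nat.cast_one]

lemma prod_one_add_inv_le (S : Finset ℕ) (hS : ∀ p ∈ S, 2 ≤ p) :
    ∏ p ∈ S, (1 + 1 / ((p : ℝ) - 1)) ≤ S.card + 1 := by
  induction S using Finset.induction_on_max with
  | empty => simp
  | insert a s ha ih =>
    have hns : a ∉ s := fun h => lt_irrefl _ (ha a h)
    rw [Finset.prod_insert hns, Finset.card_insert_of_notMem hns]
    have hsub : s ⊆ Finset.Ico 2 a := fun p hp =>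
      Finset.mem_Ico.2 ⟨hS p (Finset.mem_insert_of_mem hp), ha p hp⟩
    have hc := Finset.card_le_card hsub
    rw [Nat.card_Ico] at hc
    have ha2 := hS a (Finset.mem_insert_self a s)
    have h1 : (s.card : ℝ) + 1 ≤ (a : ℝ) - 1 := by
      have : s.card + 2 ≤ a := by omega
      have : (s.card : ℝ) + 2 ≤ a := by exact_mod_cast this
      linarith
    have h2 : (0 : ℝ) ≤ s.card := by positivity
    have ih' := ih fun p hp => hS p (Finset.mem_insert_of_mem hp)
    push_cast
    calc _ ≤ (1 + 1 / ((a : ℝ) - 1)) * (s.card + 1) :=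
          mul_le_mul_of_nonneg_left ih' (by
            have : (0 : ℝ) ≤ 1 / ((a : ℝ) - 1) := div_nonneg zero_le_one (by linarith)
            linarith)
      _ = s.card + 1 + (s.card + 1) / ((a : ℝ) - 1) := by ring
      _ ≤ _ := by
        have : ((s.card : ℝ) + 1) / ((a : ℝ) - 1) ≤ 1 := (div_le_one (by linarith)).2 h1
        linarith

lemma inv_totient_le {d : ℕ} (hd : d ≠ 0) : 1 / (d.totient : ℝ) ≤ (1 + 2 * Real.log d) / d := by
  have hd0 : (0 : ℝ) < d := by exact_mod_cast Nat.pos_of_ne_zero hd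
  have h1 := prod_one_add_inv_le d.primeFactors
    fun p hp => (Nat.prime_of_mem_primeFactors hp).two_le
  rw [← cast_div_totient hd] at h1
  have h2 : 2 ^ d.primeFactors.card ≤ d :=
    (Finset.pow_card_le_prod _ _ _ fun p hp => (Nat.prime_of_mem_primeFactors hp).two_le).trans
      (Nat.le_of_dvd (Nat.pos_of_ne_zero hd) (Nat.prod_primeFactors_dvd d))
  have h3 : (d.primeFactors.card : ℝ) ≤ 2 * Real.log d :=
    le_trans (by exact_mod_cast Nat.le_log_of_pow_le (by norm_num) h2) (natLog_le_two_mul_log d)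
  rw [le_div_iff₀ hd0]
  calc 1 / (d.totient : ℝ) * d = d / d.totient := by ring
    _ ≤ _ := by linarith

lemma sqfreeInvTotient_le {d : ℕ} (hd : d ≠ 0) :
    sqfreeInvTotient d ≤ (1 + 2 * Real.log d) / d := by
  unfold sqfreeInvTotient
  split_ifs
  · exact inv_totient_le hd
  · have := Real.log_natCast_nonneg d
    positivity

lemma sum_one_div_le (Y : ℕ) : ∑ d ∈ Finset.Icc 1 Y, 1 / (d : ℝ) ≤ 1 + Real.log Y := by
  have h := harmonic_le_one_add_log Y
  rw [harmonic_eq_sum_Icc] at h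
  push_cast at h
  simpa [one_div] using h

lemma sum_log_div_le (Y : ℕ) :
    ∑ d ∈ Finset.Icc 1 Y, (1 + 2 * Real.log d) / d ≤ (1 + 2 * Real.log Y) * (1 + Real.log Y) := by
  have hY := Real.log_natCast_nonneg Y
  calc _ ≤ ∑ d ∈ Finset.Icc 1 Y, (1 + 2 * Real.log Y) * (1 / (d : ℝ)) := by
        refine Finset.sum_le_sum fun d hd => ?_
        rw [Finset.mem_Icc] at hd
        have h1 : Real.log d ≤ Real.log Y :=
          Real.log_le_log (by exact_mod_cast hd.1) (by exact_mod_cast hd.2)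
        rw [mul_one_div]
        gcongr
    _ ≤ _ := by
        rw [← Finset.mul_sum]
        exact mul_le_mul_of_nonneg_left (sum_one_div_le Y) (by linarith)

lemma sum_log_div_sq_le {Y : ℕ} (hY : 1 ≤ Y) (P : ℕ) :
    ∑ d ∈ Finset.Ioc Y P, (1 + 2 * Real.log d) / (d : ℝ) ^ 2 ≤ (5 + 2 * Real.log Y) / Y := by
  have hY0 : 0 ≤ (5 + 2 * Real.log Y) / Y := by
    have := Real.log_natCast_nonneg Y
    positivity
  rcases le_or_gt P Y with hPY | hPY
  · rw [Finset.Ioc_eq_empty (by omega)]; simpa using hY0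
  suffices h : ∑ d ∈ Finset.Ioc Y P, (1 + 2 * Real.log d) / (d : ℝ) ^ 2 ≤
      (5 + 2 * Real.log Y) / Y - (5 + 2 * Real.log P) / P by
    have : 0 ≤ (5 + 2 * Real.log P) / P := by
      have := Real.log_natCast_nonneg P
      positivity
    linarith
  induction P, hPY.le using Nat.le_induction with
  | base => simp
  | succ P hP ih =>
    rw [← Finset.insert_Ioc_right_eq_Ioc_add_one hP, Finset.sum_insert (by simp)]
    have ih' : ∑ d ∈ Finset.Ioc Y P, (1 + 2 * Real.log d) / (d : ℝ) ^ 2 ≤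
      (5 + 2 * Real.log Y) / Y - (5 + 2 * Real.log P) / P := by
      rcases hP.lt_or_eq with h | h
      · exact ih h
      · simp [h]
    have hP1 : (1 : ℝ) ≤ P := by exact_mod_cast hY.trans hP
    have hlog : Real.log ((P + 1 : ℕ) : ℝ) ≤ Real.log P + 1 / P := by
      have h1 : ((P + 1 : ℕ) : ℝ) = P * (1 + 1 / P) := by push_cast; field_simp
      rw [h1, Real.log_mul (by positivity) (by positivity)]
      have := Real.log_le_sub_one_of_pos (show (0 : ℝ) < 1 + 1 / P by positivity)
      linarith
    have hl0 := Real.log_natCast_nonneg (P + 1)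
    obtain ⟨l, hl⟩ : ∃ l, l = Real.log ((P + 1 : ℕ) : ℝ) := ⟨_, rfl⟩
    rw [← hl] at hlog hl0 ⊢
    have h2 : (1 + 2 * l) / ((P + 1 : ℕ) : ℝ) ^ 2 ≤
        (5 + 2 * (l - 1 / P)) / P - (5 + 2 * l) / ((P + 1 : ℕ) : ℝ) := by
      push_cast
      have e : (5 + 2 * (l - 1 / (P : ℝ))) / P - (5 + 2 * l) / ((P : ℝ) + 1) -
          (1 + 2 * l) / ((P : ℝ) + 1) ^ 2 =
          (2 * P ^ 2 + (2 * l) * P + (P - 2)) / (P ^ 2 * (P + 1) ^ 2) := by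
        field_simp
        ring
      have : 0 ≤ (2 * (P : ℝ) ^ 2 + (2 * l) * P + (P - 2)) / (P ^ 2 * (P + 1) ^ 2) := by
        apply div_nonneg _ (by positivity)
        nlinarith [mul_nonneg hl0 (by linarith : (0 : ℝ) ≤ P)]
      linarith
    have h3 : (5 + 2 * (l - 1 / P)) / P ≤ (5 + 2 * Real.log P) / P := by
      gcongr; linarith
    linarith

lemma sq_sub_sq_truncated (N a r : ℕ) :
    2 * (r : ℝ) * ((N - (a + r) : ℕ) : ℝ) ≤
        ((N - a : ℕ) : ℝ) ^ 2 - ((N - (a + r) : ℕ) : ℝ) ^ 2 ∧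
      ((N - a : ℕ) : ℝ) ^ 2 - ((N - (a + r) : ℕ) : ℝ) ^ 2 ≤
        2 * (r : ℝ) * ((N - a : ℕ) : ℝ) ∧
      ((N - a : ℕ) : ℝ) ^ 2 - ((N - (a + r) : ℕ) : ℝ) ^ 2 ≤
        2 * (r : ℝ) * ((N - (a + r) : ℕ) : ℝ) + (r : ℝ) ^ 2 := by
  obtain ⟨u, hu⟩ : ∃ u, u = N - a := ⟨_, rfl⟩
  obtain ⟨v, hv⟩ : ∃ v, v = N - (a + r) := ⟨_, rfl⟩
  rw [← hu, ← hv]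
  have hv0 : (0 : ℝ) ≤ v := by positivity
  have hu0 : (0 : ℝ) ≤ u := by positivity
  have hr0 : (0 : ℝ) ≤ r := by positivity
  have huv : (u : ℝ) ≤ v + r := by exact_mod_cast (by omega : u ≤ v + r)
  have hvu : (v : ℝ) ≤ u := by exact_mod_cast (by omega : v ≤ u)
  rcases Nat.eq_zero_or_pos v with h | h
  · have : (v : ℝ) = 0 := by exact_mod_cast h
    rw [this] at huv hvu ⊢
    refine ⟨by nlinarith, by nlinarith, by nlinarith⟩
  · have : (u : ℝ) = v + r := by exact_mod_cast (by omega : u = v + r)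
    rw [this]
    refine ⟨by nlinarith, by nlinarith, by nlinarith⟩

lemma sum_truncated_le (N e K : ℕ) :
    2 * (e : ℝ) * ∑ m ∈ Finset.Icc 1 K, ((N - m * e : ℕ) : ℝ) ≤ (N : ℝ) ^ 2 := by
  suffices h : 2 * (e : ℝ) * ∑ m ∈ Finset.Icc 1 K, ((N - m * e : ℕ) : ℝ) ≤
      (N : ℝ) ^ 2 - ((N - K * e : ℕ) : ℝ) ^ 2 by
    nlinarith [sq_nonneg ((N - K * e : ℕ) : ℝ)]
  induction K with
  | zero => simp
  | succ K ih =>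
    rw [← Finset.insert_Icc_right_eq_Icc_add_one (by omega), Finset.sum_insert (by simp)]
    have h := (sq_sub_sq_truncated N (K * e) e).1
    rw [show K * e + e = (K + 1) * e by ring] at h
    nlinarith

lemma le_sum_truncated {N e K : ℕ} (h : N ≤ (K + 1) * e) :
    (N : ℝ) ^ 2 ≤ 2 * e * N + 2 * (e : ℝ) * ∑ m ∈ Finset.Icc 1 K, ((N - m * e : ℕ) : ℝ) := by
  have key : ∀ K : ℕ, (N : ℝ) ^ 2 - ((N - (K + 1) * e : ℕ) : ℝ) ^ 2 ≤
      2 * e * N + 2 * (e : ℝ) * ∑ m ∈ Finset.Icc 1 K, ((N - m * e : ℕ) : ℝ) := by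
    intro K
    induction K with
    | zero =>
      have h := (sq_sub_sq_truncated N 0 e).2.1
      simpa using h
    | succ K ih =>
      rw [← Finset.insert_Icc_right_eq_Icc_add_one (by omega), Finset.sum_insert (by simp)]
      have h := (sq_sub_sq_truncated N ((K + 1) * e) e).2.1
      rw [show (K + 1) * e + e = (K + 1 + 1) * e by ring] at h
      nlinarith
  have h1 := key K
  rw [Nat.sub_eq_zero_of_le h] at h1
  simpa using h1

lemma abs_sq_diff_sub_le (N r : ℕ) {H₁ H₂ : ℕ} (hH : H₁ ≤ H₂) :
    |(((N - r * H₁ : ℕ) : ℝ) ^ 2 - ((N - r * H₂ : ℕ) : ℝ) ^ 2) -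
      2 * (r : ℝ) * ∑ q ∈ Finset.Ioc H₁ H₂, ((N - r * q : ℕ) : ℝ)| ≤
      (r : ℝ) ^ 2 * ((H₂ : ℝ) - H₁) := by
  suffices h : 0 ≤ (((N - r * H₁ : ℕ) : ℝ) ^ 2 - ((N - r * H₂ : ℕ) : ℝ) ^ 2) -
      2 * (r : ℝ) * ∑ q ∈ Finset.Ioc H₁ H₂, ((N - r * q : ℕ) : ℝ) ∧
      (((N - r * H₁ : ℕ) : ℝ) ^ 2 - ((N - r * H₂ : ℕ) : ℝ) ^ 2) -
      2 * (r : ℝ) * ∑ q ∈ Finset.Ioc H₁ H₂, ((N - r * q : ℕ) : ℝ) ≤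
      (r : ℝ) ^ 2 * ((H₂ : ℝ) - H₁) by
    rw [abs_of_nonneg h.1]; exact h.2
  induction H₂, hH using Nat.le_induction with
  | base => simp
  | succ H hH ih =>
    rw [← Finset.insert_Ioc_right_eq_Ioc_add_one hH, Finset.sum_insert (by simp)]
    have h := sq_sub_sq_truncated N (r * H) r
    rw [show r * H + r = r * (H + 1) by ring] at h
    push_cast
    constructor <;> nlinarith

lemma sum_multiples {d : ℕ} (hd : d ≠ 0) (P : ℕ) (f : ℕ → ℝ) :
    ∑ r ∈ (Finset.Icc 1 P).filter (fun r => d ∣ r), f r =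
      ∑ m ∈ Finset.Icc 1 (P / d), f (d * m) := by
  have hd0 := Nat.pos_of_ne_zero hd
  symm
  refine Finset.sum_nbij (fun m => d * m) ?_ ?_ ?_ fun _ _ => rfl
  · intro m hm
    rw [Finset.mem_Icc] at hm
    rw [Finset.mem_filter, Finset.mem_Icc]
    refine ⟨⟨Nat.mul_pos hd0 hm.1, ?_⟩, dvd_mul_right d m⟩
    exact (Nat.mul_le_mul_left d hm.2).trans (Nat.mul_div_le P d)
  · intro a _ b _ h
    exact Nat.eq_of_mul_eq_mul_left hd0 h
  · intro r hr
    simp only [Finset.coe_filter, Finset.mem_Icc, mem_ofPred_eq] at hr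
    obtain ⟨⟨h1, h2⟩, m, rfl⟩ := hr
    refine ⟨m, ?_, rfl⟩
    simp only [Finset.coe_Icc, Set.mem_Icc]
    refine ⟨Nat.pos_of_ne_zero (by rintro rfl; simp at h1), ?_⟩
    rw [Nat.le_div_iff_mul_le hd0, mul_comm]; exact h2

lemma sum_mul_sum_divisors {S : Finset ℕ} {P : ℕ} (hS : S ⊆ Finset.Icc 1 P) (f g : ℕ → ℝ) :
    ∑ r ∈ S, f r * ∑ d ∈ r.divisors, g d =
      ∑ d ∈ Finset.Icc 1 P, g d * ∑ r ∈ S.filter (fun r => d ∣ r), f r := by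
  have h : ∀ r ∈ S, f r * ∑ d ∈ r.divisors, g d =
      ∑ d ∈ Finset.Icc 1 P, if d ∣ r then g d * f r else 0 := by
    intro r hr
    have hr' := Finset.mem_Icc.1 (hS hr)
    rw [← Finset.sum_filter, Finset.mul_sum]
    refine Finset.sum_congr ?_ fun _ _ => mul_comm _ _
    ext d
    simp only [Nat.mem_divisors, Finset.mem_filter, Finset.mem_Icc]
    constructor
    · rintro ⟨h1, h2⟩
      exact ⟨⟨Nat.pos_of_dvd_of_pos h1 hr'.1, (Nat.le_of_dvd hr'.1 h1).trans hr'.2⟩, h1⟩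
    · exact fun h1 => ⟨h1.2, by omega⟩
  rw [Finset.sum_congr rfl h, Finset.sum_comm]
  refine Finset.sum_congr rfl fun d _ => ?_
  rw [Finset.mul_sum, Finset.sum_filter]

lemma card_multiples_Ioc (d a b : ℕ) (hd : d ≠ 0) (hab : a ≤ b) :
    |(d : ℝ) * ((Finset.Ioc a b).filter (fun q => d ∣ q)).card - ((b : ℝ) - a)| ≤ d := by
  have hd0 := Nat.pos_of_ne_zero hd
  have h : ((Finset.Ioc a b).filter (fun q => d ∣ q)).card + a / d = b / d := by
    rw [← Nat.Ioc_filter_dvd_card_eq_div a d, ← Nat.Ioc_filter_dvd_card_eq_div b d,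
      ← Finset.card_union_of_disjoint]
    · congr 1
      rw [← Finset.filter_union, Finset.union_comm, Finset.Ioc_union_Ioc_eq_Ioc (by omega) hab]
    · exact Finset.disjoint_filter_filter (Finset.disjoint_left.2 fun q h1 h2 => by
        rw [Finset.mem_Ioc] at h1 h2; omega)
  have h1 : (d : ℝ) * ((Finset.Ioc a b).filter (fun q => d ∣ q)).card +
      d * ((a / d : ℕ) : ℝ) = d * ((b / d : ℕ) : ℝ) := by
    rw [← mul_add]; congr 1; exact_mod_cast h
  have ha1 : (d : ℝ) * ((a / d : ℕ) : ℝ) ≤ a := by exact_mod_cast Nat.mul_div_le a d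
  have hb1 : (d : ℝ) * ((b / d : ℕ) : ℝ) ≤ b := by exact_mod_cast Nat.mul_div_le b d
  have ha2 : (a : ℝ) ≤ d * ((a / d : ℕ) : ℝ) + d := by
    have := Nat.lt_mul_div_succ a hd0
    exact_mod_cast (by rw [mul_add, mul_one] at this; omega : a ≤ d * (a / d) + d)
  have hb2 : (b : ℝ) ≤ d * ((b / d : ℕ) : ℝ) + d := by
    have := Nat.lt_mul_div_succ b hd0
    exact_mod_cast (by rw [mul_add, mul_one] at this; omega : b ≤ d * (b / d) + d)
  rw [abs_le]
  constructor <;> linarith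

lemma abs_sum_multiples_inv_sub_le {d H₁ H₂ : ℕ} (hd : d ≠ 0) (hH : H₁ ≤ H₂) :
    |∑ q ∈ (Finset.Ioc H₁ H₂).filter (fun q => d ∣ q), 1 / (q : ℝ) -
      (∑ q ∈ Finset.Ioc H₁ H₂, 1 / (q : ℝ)) / d| ≤ 1 / ((H₁ : ℝ) + 1) := by
  rcases hH.eq_or_lt with rfl | hH
  · simp; positivity
  have hd0 : (0 : ℝ) < d := by exact_mod_cast Nat.pos_of_ne_zero hd
  have h := norm_sum_mul_antitone_le (M := H₁) (N := H₂) (K := d)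
    (b := fun q => (((if d ∣ q then (d : ℝ) else 0) - 1 : ℝ) : ℂ)) (g := fun q => 1 / (q : ℝ))
    (fun n hn _ => by
      have : (0 : ℝ) < n := by exact_mod_cast (by omega : 0 < n)
      push_cast
      gcongr
      linarith) (fun n _ _ => by positivity) (fun n hn _ => by
      rw [← Complex.ofReal_sum, Complex.norm_real, Real.norm_eq_abs, Finset.sum_sub_distrib,
        ← Finset.sum_filter, Finset.sum_const, Finset.sum_const, Nat.card_Ioc]
      have := card_multiples_Ioc d H₁ n hd hn.le
      rw [nsmul_eq_mul, nsmul_eq_mul, Nat.cast_sub hn.le]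
      convert this using 2
      ring) hH
  have e : ∑ q ∈ Finset.Ioc H₁ H₂, (((if d ∣ q then (d : ℝ) else 0) - 1 : ℝ) : ℂ) *
      ((1 / (q : ℝ) : ℝ) : ℂ) =
      ((d * (∑ q ∈ (Finset.Ioc H₁ H₂).filter (fun q => d ∣ q), 1 / (q : ℝ) -
        (∑ q ∈ Finset.Ioc H₁ H₂, 1 / (q : ℝ)) / d) : ℝ) : ℂ) := by
    rw [mul_sub, mul_div_cancel₀ _ hd0.ne', Finset.sum_filter, Finset.mul_sum,
      ← Finset.sum_sub_distrib, Complex.ofReal_sum]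
    refine Finset.sum_congr rfl fun q _ => ?_
    rw [← Complex.ofReal_mul]
    congr 1
    split_ifs <;> ring
  rw [e, Complex.norm_real, Real.norm_eq_abs, abs_mul, abs_of_pos hd0] at h
  push_cast at h
  exact le_of_mul_le_mul_left h hd0

lemma one_div_totient_eq {r : ℕ} (hr : r ≠ 0) :
    1 / (r.totient : ℝ) = 1 / (r : ℝ) * ∑ d ∈ r.divisors, sqfreeInvTotient d := by
  rw [← cast_div_totient_eq_sum hr]
  have : (r : ℝ) ≠ 0 := by exact_mod_cast hr
  field_simp

/-- Comparison of the two main terms. -/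
lemma abs_main_term_sub_le {N H₁ H₂ R P Y : ℕ} (hH : H₁ ≤ H₂) (hH2 : H₂ ≤ 2 * H₁ + 1)
    (hR : N ≤ (R + 1) * H₁) (hRP : R ≤ P) (hHP : H₂ ≤ P) (hY : 1 ≤ Y) :
    |∑ r ∈ Finset.Icc 1 R, (((N - r * H₁ : ℕ) : ℝ) ^ 2 - ((N - r * H₂ : ℕ) : ℝ) ^ 2) / r.totient -
      (N : ℝ) ^ 2 * ∑ q ∈ Finset.Ioc H₁ H₂, 1 / (q.totient : ℝ)| ≤
      (R : ℝ) ^ 3 * ((H₂ : ℝ) - H₁) +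
      2 * N * ((H₂ : ℝ) - H₁) * ((1 + 2 * Real.log Y) * (1 + Real.log Y)) +
      (N : ℝ) ^ 2 * ((5 + 2 * Real.log Y) / Y) +
      (N : ℝ) ^ 2 / ((H₁ : ℝ) + 1) * ((1 + 2 * Real.log P) * (1 + Real.log P)) := by
  have hHr : (0 : ℝ) ≤ (H₂ : ℝ) - H₁ := by
    have : (H₁ : ℝ) ≤ H₂ := by exact_mod_cast hH
    linarith
  set w : ℕ → ℝ := fun r => ((N - r * H₁ : ℕ) : ℝ) ^ 2 - ((N - r * H₂ : ℕ) : ℝ) ^ 2 with hw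
  set v : ℕ → ℝ := fun r => 2 * ∑ q ∈ Finset.Ioc H₁ H₂, ((N - r * q : ℕ) : ℝ) with hv
  set T : ℕ → ℝ := fun d => ∑ r ∈ (Finset.Icc 1 P).filter (fun r => d ∣ r), v r with hT
  set ℓ : ℕ → ℝ := fun d => ∑ q ∈ (Finset.Ioc H₁ H₂).filter (fun q => d ∣ q), 1 / (q : ℝ) with hℓ
  set L : ℝ := ∑ q ∈ Finset.Ioc H₁ H₂, 1 / (q : ℝ) with hL
  have hL0 : 0 ≤ L := Finset.sum_nonneg fun _ _ => by positivity
  have hL1 : L ≤ 1 := by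
    have h1 : L ≤ ∑ q ∈ Finset.Ioc H₁ H₂, 1 / ((H₁ : ℝ) + 1) := by
      refine Finset.sum_le_sum fun q hq => ?_
      rw [Finset.mem_Ioc] at hq
      have : (H₁ : ℝ) + 1 ≤ q := by exact_mod_cast hq.1
      gcongr
    refine h1.trans ?_
    rw [Finset.sum_const, Nat.card_Ioc, nsmul_eq_mul, mul_one_div, div_le_one (by positivity)]
    exact_mod_cast (by omega : H₂ - H₁ ≤ H₁ + 1)
  -- replace the difference of squares by its linear approximation
  have s1 : |∑ r ∈ Finset.Icc 1 R, w r / r.totient -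
      ∑ r ∈ Finset.Icc 1 R, r * v r / r.totient| ≤ (R : ℝ) ^ 3 * ((H₂ : ℝ) - H₁) := by
    rw [← Finset.sum_sub_distrib]
    refine (Finset.abs_sum_le_sum_abs _ _).trans ?_
    refine (Finset.sum_le_sum (g := fun _ => (R : ℝ) ^ 2 * ((H₂ : ℝ) - H₁)) ?_).trans ?_
    · intro r hr
      rw [Finset.mem_Icc] at hr
      have hφ : (1 : ℝ) ≤ r.totient := by exact_mod_cast Nat.totient_pos.2 hr.1
      have h1 := abs_sq_diff_sub_le N r hH
      rw [← sub_div, abs_div, abs_of_pos (by linarith : (0 : ℝ) < r.totient)]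
      refine (div_le_self (abs_nonneg _) hφ).trans ?_
      have e : (r : ℝ) * v r = 2 * (r : ℝ) * ∑ q ∈ Finset.Ioc H₁ H₂, ((N - r * q : ℕ) : ℝ) := by
        simp only [hv]; ring
      rw [e]
      refine h1.trans ?_
      have : (r : ℝ) ≤ R := by exact_mod_cast hr.2
      gcongr
    · rw [Finset.sum_const, Nat.card_Icc, nsmul_eq_mul]
      simp only [Nat.add_sub_cancel]
      exact le_of_eq (by ring)
  have s2 : ∑ r ∈ Finset.Icc 1 R, r * v r / r.totient =
      ∑ d ∈ Finset.Icc 1 P, sqfreeInvTotient d * T d := by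
    rw [hT, ← sum_mul_sum_divisors (Finset.Subset.refl _),
      ← Finset.sum_subset (Finset.Icc_subset_Icc_right hRP)]
    · refine Finset.sum_congr rfl fun r hr => ?_
      rw [Finset.mem_Icc] at hr
      rw [← cast_div_totient_eq_sum (by omega)]
      ring
    · intro r hr hr'
      rw [Finset.mem_Icc] at hr hr'
      have : v r = 0 := by
        simp only [hv]
        rw [Finset.sum_eq_zero, mul_zero]
        intro q hq
        rw [Finset.mem_Ioc] at hq
        have h1 : (R + 1) * H₁ ≤ r * q := Nat.mul_le_mul (by omega) hq.1.le
        rw [Nat.sub_eq_zero_of_le (hR.trans h1), Nat.cast_zero]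
      rw [this, zero_mul]
  have s3 : ∑ q ∈ Finset.Ioc H₁ H₂, 1 / (q.totient : ℝ) =
      ∑ d ∈ Finset.Icc 1 P, sqfreeInvTotient d * ℓ d := by
    rw [hℓ, ← sum_mul_sum_divisors (P := P)]
    · refine Finset.sum_congr rfl fun q hq => ?_
      rw [Finset.mem_Ioc] at hq
      exact one_div_totient_eq (by omega)
    · intro q hq
      rw [Finset.mem_Ioc] at hq
      rw [Finset.mem_Icc]; omega
  have hTd : ∀ d ∈ Finset.Icc 1 P, T d ≤ (N : ℝ) ^ 2 * (L / d) ∧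
      (N : ℝ) ^ 2 * (L / d) ≤ T d + 2 * N * ((H₂ : ℝ) - H₁) ∧ 0 ≤ T d := by
    intro d hd
    rw [Finset.mem_Icc] at hd
    have hd0 : (0 : ℝ) < d := by exact_mod_cast hd.1
    have e1 : T d = ∑ q ∈ Finset.Ioc H₁ H₂,
        2 * ∑ m ∈ Finset.Icc 1 (P / d), ((N - m * (d * q) : ℕ) : ℝ) := by
      simp only [hT, hv]
      rw [← Finset.mul_sum, ← Finset.mul_sum, Finset.sum_comm]
      congr 1
      refine Finset.sum_congr rfl fun q _ => ?_
      rw [sum_multiples (by omega)]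
      refine Finset.sum_congr rfl fun m _ => ?_
      rw [show d * m * q = m * (d * q) by ring]
    have e2 : (N : ℝ) ^ 2 * (L / d) = ∑ q ∈ Finset.Ioc H₁ H₂, (N : ℝ) ^ 2 / (d * q : ℕ) := by
      rw [hL, Finset.sum_div, Finset.mul_sum]
      refine Finset.sum_congr rfl fun q _ => ?_
      push_cast
      rw [div_div, mul_one_div, mul_comm (q : ℝ)]
    have hq0 : ∀ q ∈ Finset.Ioc H₁ H₂, (0 : ℝ) < (d * q : ℕ) := by
      intro q hq
      rw [Finset.mem_Ioc] at hq
      exact_mod_cast Nat.mul_pos hd.1 (by omega)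
    refine ⟨?_, ?_, ?_⟩
    · rw [e1, e2]
      refine Finset.sum_le_sum fun q hq => ?_
      rw [le_div_iff₀ (hq0 q hq)]
      have := sum_truncated_le N (d * q) (P / d)
      linarith
    · have e3 : 2 * (N : ℝ) * ((H₂ : ℝ) - H₁) = ∑ q ∈ Finset.Ioc H₁ H₂, 2 * (N : ℝ) := by
        rw [Finset.sum_const, Nat.card_Ioc, nsmul_eq_mul, Nat.cast_sub hH]; ring
      rw [e1, e2, e3, ← Finset.sum_add_distrib]
      refine Finset.sum_le_sum fun q hq => ?_
      rw [div_le_iff₀ (hq0 q hq)]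
      have h1 : N ≤ (P / d + 1) * (d * q) := by
        rw [Finset.mem_Ioc] at hq
        have h2 := Nat.lt_mul_div_succ P hd.1
        calc N ≤ (R + 1) * H₁ := hR
          _ ≤ (d * (P / d + 1)) * q := Nat.mul_le_mul (by omega) hq.1.le
          _ = _ := by ring
      have := le_sum_truncated h1
      linarith
    · rw [e1]
      exact Finset.sum_nonneg fun q _ => by positivity
  have hdiff : ∀ d ∈ Finset.Icc 1 P, |sqfreeInvTotient d * (T d - (N : ℝ) ^ 2 * ℓ d)| ≤
      (if d ≤ Y then 2 * N * ((H₂ : ℝ) - H₁) * ((1 + 2 * Real.log d) / d) else 0) +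
      (if Y < d then (N : ℝ) ^ 2 * ((1 + 2 * Real.log d) / (d : ℝ) ^ 2) else 0) +
      (N : ℝ) ^ 2 / ((H₁ : ℝ) + 1) * ((1 + 2 * Real.log d) / d) := by
    intro d hd
    obtain ⟨h1, h2, h3⟩ := hTd d hd
    rw [Finset.mem_Icc] at hd
    have hd0 : (0 : ℝ) < d := by exact_mod_cast hd.1
    have hg := sqfreeInvTotient_le (d := d) (by omega)
    have hg0 := sqfreeInvTotient_nonneg d
    have h4 := abs_sum_multiples_inv_sub_le (d := d) (by omega) hH
    rw [abs_mul, abs_of_nonneg hg0]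
    have h5 : |(N : ℝ) ^ 2 * (L / d - ℓ d)| ≤ (N : ℝ) ^ 2 / ((H₁ : ℝ) + 1) := by
      rw [abs_mul, abs_of_nonneg (by positivity), abs_sub_comm,
        div_eq_mul_one_div ((N : ℝ) ^ 2)]
      exact mul_le_mul_of_nonneg_left h4 (by positivity)
    have h6 : |T d - (N : ℝ) ^ 2 * ℓ d| ≤ |T d - (N : ℝ) ^ 2 * (L / d)| +
        (N : ℝ) ^ 2 / ((H₁ : ℝ) + 1) := by
      have : T d - (N : ℝ) ^ 2 * ℓ d =
        (T d - (N : ℝ) ^ 2 * (L / d)) + (N : ℝ) ^ 2 * (L / d - ℓ d) := by ring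
      rw [this]
      exact (abs_add_le _ _).trans (by linarith)
    have hlog := Real.log_natCast_nonneg d
    have h7 : sqfreeInvTotient d * |T d - (N : ℝ) ^ 2 * (L / d)| ≤
        (if d ≤ Y then 2 * N * ((H₂ : ℝ) - H₁) * ((1 + 2 * Real.log d) / d) else 0) +
        (if Y < d then (N : ℝ) ^ 2 * ((1 + 2 * Real.log d) / (d : ℝ) ^ 2) else 0) := by
      rcases le_or_gt d Y with h | h
      · rw [if_pos h, if_neg (by omega), add_zero, mul_comm]
        refine mul_le_mul ?_ hg hg0 (by positivity)
        rw [abs_le]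
        constructor <;> linarith [show 0 ≤ 2 * (N : ℝ) * ((H₂ : ℝ) - H₁) by positivity]
      · rw [if_neg (by omega), if_pos h, zero_add]
        have h8 : |T d - (N : ℝ) ^ 2 * (L / d)| ≤ (N : ℝ) ^ 2 / d := by
          have h9 : (N : ℝ) ^ 2 * (L / d) ≤ (N : ℝ) ^ 2 / d := by
            rw [div_eq_mul_one_div ((N : ℝ) ^ 2)]
            gcongr
          rw [abs_le]
          constructor <;> linarith [show 0 ≤ (N : ℝ) ^ 2 / d by positivity]
        calc _ ≤ (1 + 2 * Real.log d) / d * ((N : ℝ) ^ 2 / d) := by gcongr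
          _ = _ := by ring
    calc _ ≤ sqfreeInvTotient d * (|T d - (N : ℝ) ^ 2 * (L / d)| +
          (N : ℝ) ^ 2 / ((H₁ : ℝ) + 1)) := mul_le_mul_of_nonneg_left h6 hg0
      _ = sqfreeInvTotient d * |T d - (N : ℝ) ^ 2 * (L / d)| +
          (N : ℝ) ^ 2 / ((H₁ : ℝ) + 1) * sqfreeInvTotient d := by ring
      _ ≤ _ := add_le_add h7 (mul_le_mul_of_nonneg_left hg (by positivity))
  have s4 : |∑ d ∈ Finset.Icc 1 P, sqfreeInvTotient d * (T d - (N : ℝ) ^ 2 * ℓ d)| ≤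
      2 * N * ((H₂ : ℝ) - H₁) * ((1 + 2 * Real.log Y) * (1 + Real.log Y)) +
      (N : ℝ) ^ 2 * ((5 + 2 * Real.log Y) / Y) +
      (N : ℝ) ^ 2 / ((H₁ : ℝ) + 1) * ((1 + 2 * Real.log P) * (1 + Real.log P)) := by
    refine (Finset.abs_sum_le_sum_abs _ _).trans ((Finset.sum_le_sum hdiff).trans ?_)
    rw [Finset.sum_add_distrib, Finset.sum_add_distrib, ← Finset.sum_filter, ← Finset.sum_filter,
      ← Finset.mul_sum, ← Finset.mul_sum, ← Finset.mul_sum]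
    have hnn : ∀ d : ℕ, 0 ≤ (1 + 2 * Real.log d) / d := fun d => by
      have := Real.log_natCast_nonneg d
      positivity
    refine add_le_add (add_le_add ?_ ?_) ?_
    · refine mul_le_mul_of_nonneg_left (le_trans ?_ (sum_log_div_le Y)) (by positivity)
      refine Finset.sum_le_sum_of_subset_of_nonneg ?_ fun d _ _ => hnn d
      intro d hd
      simp only [Finset.mem_filter, Finset.mem_Icc] at hd ⊢
      omega
    · refine mul_le_mul_of_nonneg_left (le_trans ?_ (sum_log_div_sq_le hY P)) (by positivity)
      refine Finset.sum_le_sum_of_subset_of_nonneg ?_ fun d _ _ => ?_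
      · intro d hd
        simp only [Finset.mem_filter, Finset.mem_Icc, Finset.mem_Ioc] at hd ⊢
        omega
      · have := Real.log_natCast_nonneg d
        positivity
    · exact mul_le_mul_of_nonneg_left (sum_log_div_le P) (by positivity)
  have e : ∑ r ∈ Finset.Icc 1 R, w r / r.totient -
      (N : ℝ) ^ 2 * ∑ q ∈ Finset.Ioc H₁ H₂, 1 / (q.totient : ℝ) =
      (∑ r ∈ Finset.Icc 1 R, w r / r.totient - ∑ r ∈ Finset.Icc 1 R, r * v r / r.totient) +
      ∑ d ∈ Finset.Icc 1 P, sqfreeInvTotient d * (T d - (N : ℝ) ^ 2 * ℓ d) := by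
    simp_rw [mul_sub]
    rw [s2, s3, Finset.sum_sub_distrib, Finset.mul_sum]
    have : ∑ d ∈ Finset.Icc 1 P, (N : ℝ) ^ 2 * (sqfreeInvTotient d * ℓ d) =
        ∑ d ∈ Finset.Icc 1 P, sqfreeInvTotient d * ((N : ℝ) ^ 2 * ℓ d) :=
      Finset.sum_congr rfl fun _ _ => by ring
    rw [this]; ring
  rw [e]
  refine (abs_add_le _ _).trans ?_
  linarith

end VarianceBDH

namespace VarianceBDH

open Complex MeasureTheory Set Filter Topology
open scoped ArithmeticFunction.vonMangoldt

lemma psiMod_one (N a : ℕ) : psiMod N 1 a = ∑ n ∈ Finset.Icc 1 N, Λ n := by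
  simp [psiMod, Nat.mod_one]

/-- The prime number theorem with coprimality condition. -/
lemma abs_sum_coprime_vonMangoldt_sub_le (j : ℕ) : ∃ C : ℝ, 1 ≤ C ∧
    ∀ (q N : ℕ) (x : ℝ), q ≠ 0 → 81 ≤ x → N ≤ x → q ≤ x →
      |∑ n ∈ (Finset.Icc 1 N).filter (fun n => n.Coprime q), Λ n - N| ≤
        C * (x / Real.log x ^ j) := by
  obtain ⟨C, hC, h⟩ := abs_psiMod_sub_le j
  refine ⟨C + 2 * (2 + j).factorial,
    by linarith [show (0 : ℝ) ≤ 2 * (2 + j).factorial by positivity],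
    fun q N x hq hx hN hqx => ?_⟩
  have hL := one_le_log_of_three_le (show 3 ≤ x by linarith)
  have h1 := h 1 0 N x one_ne_zero (Nat.coprime_one_right 0) hx hN
  rw [psiMod_one, Nat.totient_one, Nat.cast_one, div_one, mul_one] at h1
  have h2 := Finset.sum_filter_add_sum_filter_not (Finset.Icc 1 N) (fun n => n.Coprime q)
    (fun n => Λ n)
  have h3 := sum_not_coprime_vonMangoldt_le N hq
  have h4 : (Nat.log 2 N : ℝ) * Real.log q ≤ 2 * Real.log x ^ 2 := by
    have e1 := natLog_le_two_mul_log N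
    have e2 := log_natCast_le_log (by linarith) hN
    have e3 := log_natCast_le_log (by linarith) hqx
    have e4 := Real.log_natCast_nonneg q
    calc (Nat.log 2 N : ℝ) * Real.log q ≤ (2 * Real.log x) * Real.log x := by
          gcongr
          linarith
      _ = _ := by ring
  have h5 : Real.log x ^ 2 ≤ (2 + j).factorial * (x / Real.log x ^ j) := by
    rw [← mul_div_assoc, le_div_iff₀ (by positivity), ← pow_add]
    exact pow_log_le (2 + j) (by linarith)
  have h6 : 0 ≤ ∑ n ∈ (Finset.Icc 1 N).filter (fun n => ¬ n.Coprime q), Λ n :=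
    Finset.sum_nonneg fun _ _ => ArithmeticFunction.vonMangoldt_nonneg
  rw [mul_div_assoc, abs_le] at h1
  rw [abs_le, add_mul]
  constructor <;> linarith [h1.1, h1.2,
    show (0 : ℝ) ≤ (2 + j).factorial * (x / Real.log x ^ j) by positivity]

lemma sum_inv_totient_le {S : Finset ℕ} {P : ℕ} {x : ℝ} (hx : 3 ≤ x) (hP : P ≤ x)
    (hS : S ⊆ Finset.Icc 1 P) : ∑ q ∈ S, 1 / (q.totient : ℝ) ≤ 6 * Real.log x ^ 2 := by
  have hL := one_le_log_of_three_le hx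
  have hlog := log_natCast_le_log (by linarith) hP
  have h0 := Real.log_natCast_nonneg P
  calc ∑ q ∈ S, 1 / (q.totient : ℝ) ≤ ∑ q ∈ Finset.Icc 1 P, 1 / (q.totient : ℝ) :=
        Finset.sum_le_sum_of_subset_of_nonneg hS fun _ _ _ => by positivity
    _ ≤ ∑ q ∈ Finset.Icc 1 P, (1 + 2 * Real.log q) / q :=
        Finset.sum_le_sum fun q hq => inv_totient_le (by rw [Finset.mem_Icc] at hq; omega)
    _ ≤ (1 + 2 * Real.log P) * (1 + Real.log P) := sum_log_div_le P
    _ ≤ (3 * Real.log x) * (2 * Real.log x) := by gcongr <;> linarith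
    _ = _ := by ring

lemma abs_sum_sq_div_totient_sub_le (j : ℕ) : ∃ C : ℝ, 1 ≤ C ∧
    ∀ (S : Finset ℕ) (N P : ℕ) (x : ℝ), 81 ≤ x → N ≤ x → P ≤ x → S ⊆ Finset.Icc 1 P →
      |∑ q ∈ S, (∑ n ∈ (Finset.Icc 1 N).filter (fun n => n.Coprime q), Λ n) ^ 2 / q.totient -
        (N : ℝ) ^ 2 * ∑ q ∈ S, 1 / (q.totient : ℝ)| ≤ C * (x ^ 2 / Real.log x ^ j) := by
  obtain ⟨E, hE, h⟩ := abs_sum_coprime_vonMangoldt_sub_le (j + 2)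
  refine ⟨6 * (E * (2 + E)), by nlinarith, fun S N P x hx hN hP hS => ?_⟩
  have hL := one_le_log_of_three_le (show 3 ≤ x by linarith)
  have hsum := sum_inv_totient_le (by linarith) hP hS
  obtain ⟨L, hLdef⟩ : ∃ L, L = Real.log x := ⟨_, rfl⟩
  rw [← hLdef] at hL hsum ⊢
  have hterm : ∀ q ∈ S, |(∑ n ∈ (Finset.Icc 1 N).filter (fun n => n.Coprime q), Λ n) ^ 2 -
      (N : ℝ) ^ 2| ≤ E * (2 + E) * (x ^ 2 / L ^ (j + 2)) := by
    intro q hq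
    have hq' := Finset.mem_Icc.1 (hS hq)
    have hqP : (q : ℝ) ≤ P := by exact_mod_cast hq'.2
    have h1 := h q N x (by omega) hx hN (hqP.trans hP)
    rw [← hLdef] at h1
    obtain ⟨s, hs⟩ : ∃ s, s = ∑ n ∈ (Finset.Icc 1 N).filter (fun n => n.Coprime q), Λ n := ⟨_, rfl⟩
    rw [← hs] at h1 ⊢
    have hs0 : 0 ≤ s := by
      rw [hs]; exact Finset.sum_nonneg fun _ _ => ArithmeticFunction.vonMangoldt_nonneg
    have h2 : x / L ^ (j + 2) ≤ x := div_le_self (by linarith) (one_le_pow₀ hL)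
    have h3 : s + N ≤ (2 + E) * x := by
      have := (abs_le.1 h1).2
      nlinarith
    have : s ^ 2 - (N : ℝ) ^ 2 = (s - N) * (s + N) := by ring
    rw [this, abs_mul, abs_of_nonneg (show 0 ≤ s + N by positivity)]
    calc _ ≤ E * (x / L ^ (j + 2)) * ((2 + E) * x) := by gcongr
      _ = _ := by ring
  have hsplit : ∑ q ∈ S, (∑ n ∈ (Finset.Icc 1 N).filter (fun n => n.Coprime q), Λ n) ^ 2 / q.totient -
        (N : ℝ) ^ 2 * ∑ q ∈ S, 1 / (q.totient : ℝ) =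
      ∑ q ∈ S, ((∑ n ∈ (Finset.Icc 1 N).filter (fun n => n.Coprime q), Λ n) ^ 2 - (N : ℝ) ^ 2) *
        (1 / (q.totient : ℝ)) := by
    rw [Finset.mul_sum, ← Finset.sum_sub_distrib]
    exact Finset.sum_congr rfl fun q _ => by ring
  rw [hsplit]
  calc _ ≤ ∑ q ∈ S, E * (2 + E) * (x ^ 2 / L ^ (j + 2)) * (1 / (q.totient : ℝ)) := by
        refine (Finset.abs_sum_le_sum_abs _ _).trans (Finset.sum_le_sum fun q hq => ?_)
        rw [abs_mul, abs_of_nonneg (show 0 ≤ 1 / (q.totient : ℝ) by positivity)]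
        exact mul_le_mul_of_nonneg_right (hterm q hq) (by positivity)
    _ = E * (2 + E) * (x ^ 2 / L ^ (j + 2)) * ∑ q ∈ S, 1 / (q.totient : ℝ) := by
        rw [Finset.mul_sum]
    _ ≤ E * (2 + E) * (x ^ 2 / L ^ (j + 2)) * (6 * L ^ 2) := by gcongr
    _ = _ := by
        field_simp
        ring

lemma abs_sum_pairSum_sub_le (j : ℕ) : ∃ C : ℝ, 1 ≤ C ∧
    ∀ (N H₁ H₂ R : ℕ) (x : ℝ), 81 ≤ x → N ≤ x → H₁ ≤ H₂ → N ≤ (R + 1) * H₁ →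
      |2 * ∑ q ∈ Finset.Ioc H₁ H₂, pairSum N q 0 -
        ∑ r ∈ Finset.Icc 1 R, (((N - r * H₁ : ℕ) : ℝ) ^ 2 - ((N - r * H₂ : ℕ) : ℝ) ^ 2) / r.totient|
        ≤ C * (R : ℝ) ^ 2 * (x ^ 2 / Real.log x ^ j) := by
  obtain ⟨C, hC, h⟩ := abs_pairSum_sub_le j
  refine ⟨4 * C, by linarith, fun N H₁ H₂ R x hx hN hH hR => ?_⟩
  have hL := one_le_log_of_three_le (show 3 ≤ x by linarith)
  rw [sum_pairSum_eq hH hR, Finset.mul_sum, ← Finset.sum_sub_distrib]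
  calc _ ≤ ∑ r ∈ Finset.Icc 1 R, 4 * C * R * (x ^ 2 / Real.log x ^ j) := by
        refine (Finset.abs_sum_le_sum_abs _ _).trans (Finset.sum_le_sum fun r hr => ?_)
        rw [Finset.mem_Icc] at hr
        have hrR : (r : ℝ) ≤ R := by exact_mod_cast hr.2
        have h1 := h r N (r * H₁) x (by omega) hx hN
        have h2 := h r N (r * H₂) x (by omega) hx hN
        have h3 : C * r * (x ^ 2 / Real.log x ^ j) ≤ C * R * (x ^ 2 / Real.log x ^ j) := by gcongr
        have hφ : (0 : ℝ) < r.totient := by exact_mod_cast Nat.totient_pos.2 (by omega)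
        have : 2 * (pairSum N r (r * H₁) - pairSum N r (r * H₂)) -
            (((N - r * H₁ : ℕ) : ℝ) ^ 2 - ((N - r * H₂ : ℕ) : ℝ) ^ 2) / r.totient =
            2 * (pairSum N r (r * H₁) - ((N - r * H₁ : ℕ) : ℝ) ^ 2 / (2 * r.totient)) -
            2 * (pairSum N r (r * H₂) - ((N - r * H₂ : ℕ) : ℝ) ^ 2 / (2 * r.totient)) := by
          field_simp
          ring
        rw [this]
        refine (abs_sub _ _).trans ?_
        rw [abs_mul, abs_mul, abs_two]
        linarith
    _ = _ := by
        rw [Finset.sum_const, Nat.card_Icc, nsmul_eq_mul, Nat.add_sub_cancel]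
        ring

lemma sum_vonMangoldt_sq_nonneg (N : ℕ) : 0 ≤ ∑ n ∈ Finset.Icc 1 N, Λ n ^ 2 :=
  Finset.sum_nonneg fun _ _ => sq_nonneg _

lemma sum_vonMangoldt_sq_le {N : ℕ} {x : ℝ} (hx : 1 ≤ x) (hN : N ≤ x) :
    ∑ n ∈ Finset.Icc 1 N, Λ n ^ 2 ≤ x * Real.log x ^ 2 := by
  calc _ ≤ ∑ n ∈ Finset.Icc 1 N, Real.log x ^ 2 := by
        refine Finset.sum_le_sum fun n hn => ?_
        rw [Finset.mem_Icc] at hn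
        have : (n : ℝ) ≤ N := by exact_mod_cast hn.2
        exact pow_le_pow_left₀ ArithmeticFunction.vonMangoldt_nonneg
          (ArithmeticFunction.vonMangoldt_le_log.trans
            (log_natCast_le_log hx (this.trans hN))) 2
    _ = N * Real.log x ^ 2 := by
        rw [Finset.sum_const, Nat.card_Icc, nsmul_eq_mul, Nat.add_sub_cancel]
    _ ≤ _ := by gcongr

lemma abs_sum_varMod_sub_le {N H₁ H₂ : ℕ} {x : ℝ} (hx : 1 ≤ x) (hN : N ≤ x) (hH : H₁ ≤ H₂)
    (hH₂ : H₂ ≤ x) :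
    |∑ q ∈ Finset.Ioc H₁ H₂, varMod N q - (((H₂ : ℝ) - H₁) * ∑ n ∈ Finset.Icc 1 N, Λ n ^ 2 +
      (2 * ∑ q ∈ Finset.Ioc H₁ H₂, pairSum N q 0 - ∑ q ∈ Finset.Ioc H₁ H₂,
        (∑ n ∈ (Finset.Icc 1 N).filter (fun n => n.Coprime q), Λ n) ^ 2 / q.totient))| ≤
      4 * (x * Real.log x ^ 4) := by
  have hL := Real.log_nonneg hx
  have e : (((H₂ : ℝ) - H₁) * ∑ n ∈ Finset.Icc 1 N, Λ n ^ 2 +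
      (2 * ∑ q ∈ Finset.Ioc H₁ H₂, pairSum N q 0 - ∑ q ∈ Finset.Ioc H₁ H₂,
        (∑ n ∈ (Finset.Icc 1 N).filter (fun n => n.Coprime q), Λ n) ^ 2 / q.totient)) =
      ∑ q ∈ Finset.Ioc H₁ H₂, (∑ b ∈ Finset.Icc 1 q, psiMod N q b ^ 2 -
      (∑ n ∈ (Finset.Icc 1 N).filter (fun n => n.Coprime q), Λ n) ^ 2 / q.totient) := by
    rw [Finset.sum_sub_distrib, Finset.sum_congr rfl fun q hq =>
      sum_psiMod_sq (q := q) (by rw [Finset.mem_Ioc] at hq; omega) N,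
      Finset.sum_add_distrib, Finset.sum_const, Nat.card_Ioc, nsmul_eq_mul, Nat.cast_sub hH,
      ← Finset.mul_sum]
    ring
  rw [e, ← Finset.sum_sub_distrib]
  calc _ ≤ ∑ q ∈ Finset.Ioc H₁ H₂, 4 * Real.log x ^ 4 := by
        refine (Finset.abs_sum_le_sum_abs _ _).trans (Finset.sum_le_sum fun q hq => ?_)
        rw [Finset.mem_Ioc] at hq
        have hqx : (q : ℝ) ≤ x := le_trans (by exact_mod_cast hq.2) hH₂
        calc _ ≤ (2 * Real.log N * Real.log q) ^ 2 := abs_varMod_sub_le N q (by omega)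
          _ ≤ (2 * Real.log x * Real.log x) ^ 2 := by
            have h1 := log_natCast_le_log hx hN
            have h2 := log_natCast_le_log hx hqx
            have h3 := Real.log_natCast_nonneg N
            have h4 := Real.log_natCast_nonneg q
            gcongr
          _ = _ := by ring
    _ = ((H₂ - H₁ : ℕ) : ℝ) * (4 * Real.log x ^ 4) := by
        rw [Finset.sum_const, Nat.card_Ioc, nsmul_eq_mul]
    _ ≤ x * (4 * Real.log x ^ 4) := by
        have : ((H₂ - H₁ : ℕ) : ℝ) ≤ H₂ := by exact_mod_cast Nat.sub_le _ _
        exact mul_le_mul_of_nonneg_right (this.trans hH₂) (by positivity)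
    _ = _ := by ring

lemma half_le_log_two_mul_div {x Q : ℝ} (hQ : 0 < Q) (hQx : Q ≤ x) :
    1 / 2 ≤ Real.log (2 * x / Q) := by
  have h1 : Real.log 2 ≤ Real.log (2 * x / Q) := by
    apply Real.log_le_log (by norm_num)
    rw [le_div_iff₀ hQ]
    linarith
  linarith [Real.log_two_gt_d9]

set_option maxHeartbeats 1000000 in
/-- The asymptotic formula for the variance when `Q` is within a power of `log x` of `x`. -/
theorem abs_varV_sub_le_of_log_pow (a B : ℕ) : ∃ C : ℝ, 1 ≤ C ∧
    ∀ x Q : ℝ, 81 ≤ x → 4 ≤ Q → x / Real.log x ^ B ≤ Q → Q ≤ x →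
      |varV (fun n => Λ n) x Q - Q / 2 * ∑ n ∈ Finset.Icc 1 ⌊x⌋₊, Λ n ^ 2| ≤
        C * (x ^ 2 / Real.log x ^ a + Q * x * Real.log (2 * x / Q) ^ 2) := by
  obtain ⟨C₁, hC₁, hpair⟩ := abs_sum_pairSum_sub_le (a + 2 * B)
  obtain ⟨C₂, hC₂, hcop⟩ := abs_sum_sq_div_totient_sub_le a
  obtain ⟨K, hK⟩ : ∃ K : ℝ, K = 16 * C₁ + C₂ + 4 * (4 + a).factorial + (2 + a).factorial +
    64 * (3 * B + a).factorial + 12 * (B + 2 + a).factorial := ⟨_, rfl⟩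
  have hK1 : 17 ≤ K := by
    have : (0 : ℝ) ≤ 4 * (4 + a).factorial + (2 + a).factorial +
      64 * (3 * B + a).factorial + 12 * (B + 2 + a).factorial := by positivity
    linarith
  refine ⟨K + 48, by linarith, fun x Q hx hQ4 hQB hQx => ?_⟩
  have hL := one_le_log_of_three_le (show 3 ≤ x by linarith)
  have hℓ := half_le_log_two_mul_div (by linarith) hQx
  obtain ⟨N, hNdef⟩ : ∃ N, N = ⌊x⌋₊ := ⟨_, rfl⟩
  obtain ⟨H₁, hH₁def⟩ : ∃ H, H = ⌊Q / 2⌋₊ := ⟨_, rfl⟩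
  obtain ⟨H₂, hH₂def⟩ : ∃ H, H = ⌊Q⌋₊ := ⟨_, rfl⟩
  obtain ⟨Y, hYdef⟩ : ∃ Y, Y = ⌊2 * x / Q⌋₊ := ⟨_, rfl⟩
  rw [varV_eq_sum_varMod, ← hNdef, ← hH₁def, ← hH₂def]
  have hNx : (N : ℝ) ≤ x := by rw [hNdef]; exact Nat.floor_le (by linarith)
  have hH₁le : (H₁ : ℝ) ≤ Q / 2 := by rw [hH₁def]; exact Nat.floor_le (by linarith)
  have hH₁lt : Q / 2 < H₁ + 1 := by rw [hH₁def]; exact Nat.lt_floor_add_one _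
  have hH₂le : (H₂ : ℝ) ≤ Q := by rw [hH₂def]; exact Nat.floor_le (by linarith)
  have hH₂lt : Q < H₂ + 1 := by rw [hH₂def]; exact Nat.lt_floor_add_one _
  have hxQ : 1 ≤ x / Q := by rw [le_div_iff₀ (by linarith)]; linarith
  have hYle : (Y : ℝ) ≤ 2 * x / Q := by rw [hYdef]; exact Nat.floor_le (by positivity)
  have hYge : x / Q ≤ Y := by
    have : 2 * x / Q < Y + 1 := by rw [hYdef]; exact Nat.lt_floor_add_one _
    have e : 2 * x / Q = 2 * (x / Q) := by ring
    linarith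
  have hY1 : 1 ≤ Y := by exact_mod_cast hxQ.trans hYge
  have hH : H₁ ≤ H₂ := by rw [hH₁def, hH₂def]; exact Nat.floor_le_floor (by linarith)
  have hHN : H₂ ≤ N := by rw [hNdef, hH₂def]; exact Nat.floor_le_floor hQx
  have hH2 : H₂ ≤ 2 * H₁ + 1 := by
    have : (H₂ : ℝ) < 2 * H₁ + 2 := by linarith
    have : H₂ < 2 * H₁ + 2 := by exact_mod_cast this
    omega
  have hH₁pos : 0 < H₁ := by
    have : (1 : ℝ) < H₁ + 1 := by linarith
    have : 1 < H₁ + 1 := by exact_mod_cast this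
    omega
  have hH₁pos' : (0 : ℝ) < H₁ := by exact_mod_cast hH₁pos
  obtain ⟨R, hRdef⟩ : ∃ R, R = N / H₁ := ⟨_, rfl⟩
  have hRN : R ≤ N := by rw [hRdef]; exact Nat.div_le_self _ _
  have hR : N ≤ (R + 1) * H₁ := by
    rw [hRdef, mul_comm]; exact (Nat.lt_mul_div_succ N hH₁pos).le
  have h1 := abs_sum_varMod_sub_le (by linarith) hNx hH (hH₂le.trans hQx)
  have h2 := hpair N H₁ H₂ R x hx hNx hH hR
  have h3 := hcop (Finset.Ioc H₁ H₂) N N x hx hNx hNx fun q hq => by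
    rw [Finset.mem_Ioc] at hq
    rw [Finset.mem_Icc]
    omega
  have h4 := abs_main_term_sub_le hH hH2 hR hRN hHN hY1
  have hS0 := sum_vonMangoldt_sq_nonneg N
  have hS := sum_vonMangoldt_sq_le (by linarith) hNx
  have hlogY : Real.log Y ≤ Real.log (2 * x / Q) :=
    Real.log_le_log (by exact_mod_cast hY1) hYle
  have hlogY0 := Real.log_natCast_nonneg Y
  have hlogN := log_natCast_le_log (by linarith) hNx
  have hlogN0 := Real.log_natCast_nonneg N
  have s1 := mul_log_pow_le (i := 4) (j := a) (show 3 ≤ x by linarith)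
  have s2 := mul_log_pow_le (i := 2) (j := a) (show 3 ≤ x by linarith)
  have s3 := mul_log_pow_le (i := 3 * B) (j := a) (show 3 ≤ x by linarith)
  have s4 := mul_log_pow_le (i := B + 2) (j := a) (show 3 ≤ x by linarith)
  obtain ⟨ℓ, hℓdef⟩ : ∃ ℓ, ℓ = Real.log (2 * x / Q) := ⟨_, rfl⟩
  obtain ⟨L, hLdef⟩ : ∃ L, L = Real.log x := ⟨_, rfl⟩
  rw [← hℓdef] at hℓ hlogY ⊢
  rw [← hLdef] at hL hQB h1 h2 h3 hS hlogN s1 s2 s3 s4 ⊢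
  have hLB : x / Q ≤ L ^ B := by
    rw [div_le_iff₀ (by positivity)] at hQB
    rw [div_le_iff₀ (by linarith)]
    linarith
  have hRL : (R : ℝ) ≤ 4 * L ^ B := by
    have e1 : (R : ℝ) ≤ N / H₁ := by rw [hRdef]; exact Nat.cast_div_le
    have e2 : (N : ℝ) / H₁ ≤ x / (Q / 4) := by gcongr; linarith
    have e3 : x / (Q / 4) = 4 * (x / Q) := by field_simp
    linarith
  obtain ⟨M, hM⟩ : ∃ M, M = x ^ 2 / L ^ a := ⟨_, rfl⟩
  have hM0 : 0 ≤ M := by rw [hM]; positivity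
  rw [← hM] at h3 s1 s2 s3 s4 ⊢
  have h2' : C₁ * (R : ℝ) ^ 2 * (x ^ 2 / L ^ (a + 2 * B)) ≤ 16 * C₁ * M := by
    calc _ ≤ C₁ * (4 * L ^ B) ^ 2 * (x ^ 2 / L ^ (a + 2 * B)) := by gcongr
      _ = _ := by
        rw [hM, pow_add, pow_mul', mul_pow]
        field_simp
        ring
  have hHH : (0 : ℝ) ≤ (H₂ : ℝ) - H₁ := by
    rw [sub_nonneg]; exact_mod_cast hH
  have m1 : (R : ℝ) ^ 3 * ((H₂ : ℝ) - H₁) ≤ 64 * (3 * B + a).factorial * M := by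
    calc _ ≤ (4 * L ^ B) ^ 3 * x := by
          gcongr <;> linarith
      _ = 64 * (x * L ^ (3 * B)) := by rw [mul_pow, ← pow_mul, mul_comm B 3]; ring
      _ ≤ _ := by linarith
  have m2 : 2 * N * ((H₂ : ℝ) - H₁) * ((1 + 2 * Real.log Y) * (1 + Real.log Y)) ≤
      24 * (Q * x * ℓ ^ 2) := by
    calc _ ≤ 2 * x * Q * ((4 * ℓ) * (3 * ℓ)) := by
          gcongr <;> linarith
      _ = _ := by ring
  have m3 : (N : ℝ) ^ 2 * ((5 + 2 * Real.log Y) / Y) ≤ 24 * (Q * x * ℓ ^ 2) := by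
    have : ℓ ≤ 2 * ℓ ^ 2 := by nlinarith only [hℓ]
    have : 5 + 2 * Real.log Y ≤ 24 * ℓ ^ 2 := by linarith
    calc _ ≤ x ^ 2 * ((24 * ℓ ^ 2) / (x / Q)) := by gcongr
      _ = _ := by field_simp
  have m4 : (N : ℝ) ^ 2 / ((H₁ : ℝ) + 1) * ((1 + 2 * Real.log N) * (1 + Real.log N)) ≤
      12 * (B + 2 + a).factorial * M := by
    calc _ ≤ x ^ 2 / (Q / 2) * ((3 * L) * (2 * L)) := by
          gcongr <;> linarith
      _ = 12 * (x * (x / Q) * L ^ 2) := by field_simp; ring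
      _ ≤ 12 * (x * L ^ B * L ^ 2) := by gcongr
      _ = 12 * (x * L ^ (B + 2)) := by rw [pow_add]; ring
      _ ≤ _ := by linarith
  have m5 : |((H₂ : ℝ) - H₁ - Q / 2) * ∑ n ∈ Finset.Icc 1 N, Λ n ^ 2| ≤
      (2 + a).factorial * M := by
    rw [abs_mul, abs_of_nonneg hS0]
    have : |(H₂ : ℝ) - H₁ - Q / 2| ≤ 1 := by
      rw [abs_le]
      constructor <;> linarith
    calc _ ≤ 1 * ∑ n ∈ Finset.Icc 1 N, Λ n ^ 2 := mul_le_mul_of_nonneg_right this hS0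
      _ ≤ _ := by linarith
  have hKM : K * M = 16 * C₁ * M + C₂ * M + 4 * (4 + a).factorial * M + (2 + a).factorial * M +
    64 * (3 * B + a).factorial * M + 12 * (B + 2 + a).factorial * M := by rw [hK]; ring
  have hT : 0 ≤ K * (Q * x * ℓ ^ 2) := by
    have : 0 ≤ K := by linarith
    positivity
  rw [abs_le] at h1 h2 h3 h4 m5 ⊢
  constructor <;> linarith [h1.1, h1.2, h2.1, h2.2, h3.1, h3.2, h4.1, h4.2, m5.1, m5.2]

/-- The residues modulo `q * k` lying above `b` modulo `q` and coprime to `q * k`. -/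
noncomputable def coprimeLifts (q k b : ℕ) : Finset ℕ :=
  ((Finset.Icc 1 (q * k)).filter (fun n => n % q = b % q)).filter (fun n => n.Coprime (q * k))

lemma exists_mem_Icc_natCast_eq {n : ℕ} (hn : n ≠ 0) (v : ZMod n) :
    ∃ c ∈ Finset.Icc 1 n, (c : ZMod n) = v := by
  have : NeZero n := ⟨hn⟩
  rcases Nat.eq_zero_or_pos v.val with h | h
  · refine ⟨n, Finset.mem_Icc.2 ⟨by omega, le_rfl⟩, ?_⟩
    rw [ZMod.val_eq_zero] at h
    simp [h]
  · exact ⟨v.val, Finset.mem_Icc.2 ⟨h, (ZMod.val_lt v).le⟩, ZMod.natCast_zmod_val v⟩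

lemma card_coprimeLifts_eq_card_units {q k b : ℕ} (hq : q ≠ 0) (hk : k ≠ 0) [NeZero (q * k)]
    (hb : b.Coprime q) :
    (coprimeLifts q k b).card =
      (Finset.univ.filter fun u : (ZMod (q * k))ˣ =>
        ZMod.unitsMap (Dvd.intro k rfl) u = ZMod.unitOfCoprime b hb).card := by
  have key : ∀ (c : ℕ) (hc : c.Coprime (q * k)),
      ZMod.unitsMap (Dvd.intro k rfl) (ZMod.unitOfCoprime c hc) = ZMod.unitOfCoprime b hb ↔
        c % q = b % q := by
    intro c hc
    rw [Units.ext_iff, ZMod.unitsMap_val, ZMod.coe_unitOfCoprime, ZMod.coe_unitOfCoprime,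
      ZMod.cast_natCast (Dvd.intro k rfl), natCast_eq_iff_mod, eq_comm]
  refine Finset.card_bij (fun c hc => ZMod.unitOfCoprime c (Finset.mem_filter.1 hc).2) ?_ ?_ ?_
  · intro c hc
    rw [Finset.mem_filter]
    exact ⟨Finset.mem_univ _, (key c _).2 (Finset.mem_filter.1 (Finset.mem_filter.1 hc).1).2⟩
  · intro c hc c' hc' h
    rw [Units.ext_iff, ZMod.coe_unitOfCoprime, ZMod.coe_unitOfCoprime,
      ZMod.natCast_eq_natCast_iff] at h
    have h1 := Finset.mem_Icc.1 (Finset.mem_filter.1 (Finset.mem_filter.1 hc).1).1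
    have h2 := Finset.mem_Icc.1 (Finset.mem_filter.1 (Finset.mem_filter.1 hc').1).1
    rcases le_total c c' with h3 | h3
    · have := Nat.eq_zero_of_dvd_of_lt ((Nat.modEq_iff_dvd' h3).1 h) (by omega)
      omega
    · have := Nat.eq_zero_of_dvd_of_lt ((Nat.modEq_iff_dvd' h3).1 h.symm) (by omega)
      omega
  · intro u hu
    obtain ⟨c, hc, hcu⟩ := exists_mem_Icc_natCast_eq (mul_ne_zero hq hk) (u : ZMod (q * k))
    have hcop : c.Coprime (q * k) := (ZMod.isUnit_iff_coprime c (q * k)).1 (hcu ▸ u.isUnit)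
    have hu' : ZMod.unitOfCoprime c hcop = u := by
      rw [Units.ext_iff, ZMod.coe_unitOfCoprime, hcu]
    refine ⟨c, ?_, hu'⟩
    rw [coprimeLifts, Finset.mem_filter, Finset.mem_filter]
    refine ⟨⟨hc, (key c hcop).1 ?_⟩, hcop⟩
    rw [hu']
    exact (Finset.mem_filter.1 hu).2

lemma card_filter_coprime_Icc (n : ℕ) :
    ((Finset.Icc 1 n).filter (fun b => b.Coprime n)).card = n.totient := by
  rw [← Nat.filter_coprime_Ico_eq_totient n 1]
  congr 1
  ext b
  simp only [Finset.mem_filter, Finset.mem_Icc, Finset.mem_Ico, Nat.coprime_comm]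
  exact and_congr_left fun _ => by omega

lemma sum_sum_coprimeLifts {q k : ℕ} (hq : q ≠ 0) (f : ℕ → ℝ) :
    ∑ b ∈ (Finset.Icc 1 q).filter (fun b => b.Coprime q), ∑ c ∈ coprimeLifts q k b, f c =
      ∑ c ∈ (Finset.Icc 1 (q * k)).filter (fun c => c.Coprime (q * k)), f c := by
  have h := sum_residue_classes hq (q * k) (fun n => n.Coprime q)
    (fun _ _ h => coprime_congr h) (fun c => if c.Coprime (q * k) then f c else 0)
  simp only [coprimeLifts, Finset.sum_filter _ f]
  rw [h, ← Finset.sum_filter, Finset.filter_filter]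
  rw [← Finset.sum_filter]
  refine Finset.sum_congr (Finset.filter_congr fun c _ => ?_) fun _ _ => rfl
  exact ⟨fun h => h.2, fun h => ⟨Nat.Coprime.coprime_mul_right_right h, h⟩⟩

lemma card_coprimeLifts {q k b : ℕ} (hq : q ≠ 0) (hk : k ≠ 0) (hb : b.Coprime q) :
    ((coprimeLifts q k b).card : ℝ) * q.totient = (q * k).totient := by
  have : NeZero (q * k) := ⟨mul_ne_zero hq hk⟩
  have h := sum_sum_coprimeLifts (k := k) hq (fun _ => 1)
  simp only [Finset.sum_const, nsmul_eq_mul, mul_one] at h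
  rw [card_filter_coprime_Icc] at h
  rw [← h, ← card_filter_coprime_Icc, mul_comm, ← nsmul_eq_mul, ← Finset.sum_const]
  refine Finset.sum_congr rfl fun c hc => ?_
  have hc' := (Finset.mem_filter.1 hc).2
  rw [card_coprimeLifts_eq_card_units hq hk hb, card_coprimeLifts_eq_card_units hq hk hc']
  have hs := ZMod.unitsMap_surjective (Dvd.intro k rfl : q ∣ q * k)
  exact congrArg _ (MonoidHom.card_fiber_eq_of_mem_range _ (hs _) (hs _))

lemma card_coprimeLifts_le {q : ℕ} (hq : q ≠ 0) (k b : ℕ) :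
    ((coprimeLifts q k b).card : ℝ) ≤ k := by
  have h1 : (coprimeLifts q k b).card ≤
      ((Finset.Icc 1 (q * k)).filter (fun n => n % q = b % q)).card := Finset.card_filter_le _ _
  have h2 := Nat.Ioc_filter_modEq_card 0 (q * k) (Nat.pos_of_ne_zero hq) b
  have e : (((q * k : ℕ) : ℚ) - b) / q = (k : ℚ) + ((0 : ℕ) - b) / q := by
    have : (q : ℚ) ≠ 0 := by exact_mod_cast hq
    push_cast
    field_simp
    ring
  rw [e, Int.floor_natCast_add] at h2
  have h3 : ((Finset.Icc 1 (q * k)).filter (fun n => n % q = b % q)).card = k := by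
    have : (((Finset.Ioc 0 (q * k)).filter (fun x => x ≡ b [MOD q])).card : ℤ) = k := by
      rw [h2]; simp
    exact_mod_cast this
  exact_mod_cast h1.trans h3.le

/-- The variance of primes over reduced residue classes modulo `q`, around the expected value. -/
noncomputable def coprimeVar (N q : ℕ) : ℝ :=
  ∑ b ∈ (Finset.Icc 1 q).filter (fun b => b.Coprime q), (psiMod N q b - N / q.totient) ^ 2

lemma psiMod_eq_sum_lifts {q k : ℕ} (hq : q ≠ 0) (hk : k ≠ 0) (N b : ℕ) :
    psiMod N q b =
      ∑ c ∈ (Finset.Icc 1 (q * k)).filter (fun n => n % q = b % q), psiMod N (q * k) c := by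
  refine (sum_residue_classes (mul_ne_zero hq hk) N (fun n => n % q = b % q) ?_ _).symm
  intro m n h
  have : n % q = m % q := Nat.ModEq.of_mul_right k h
  rw [this]

lemma coprimeVar_le_mul {q k : ℕ} (hq : q ≠ 0) (hk : k ≠ 0) (N : ℕ) :
    coprimeVar N q ≤ 2 * k * coprimeVar N (q * k) +
      2 * (2 * Real.log N * Real.log ((q * k : ℕ) : ℝ)) ^ 2 := by
  obtain ⟨E, hE⟩ : ∃ E : ℕ → ℝ, E = fun b => ∑ c ∈ ((Finset.Icc 1 (q * k)).filter
    (fun n => n % q = b % q)).filter (fun n => ¬ n.Coprime (q * k)), psiMod N (q * k) c := ⟨_, rfl⟩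
  have hE0 : ∀ b, 0 ≤ E b := fun b => by
    rw [hE]; exact Finset.sum_nonneg fun c _ => psiMod_nonneg _ _ _
  have hEsum : ∑ b ∈ (Finset.Icc 1 q).filter (fun b => b.Coprime q), E b ≤
      2 * Real.log N * Real.log ((q * k : ℕ) : ℝ) := by
    have h := sum_residue_classes hq (q * k) (fun n => n.Coprime q)
      (fun _ _ h => coprime_congr h)
      (fun c => if ¬ c.Coprime (q * k) then psiMod N (q * k) c else 0)
    simp only [← Finset.sum_filter] at h
    rw [hE, h]
    calc _ ≤ ∑ c ∈ (Finset.Icc 1 (q * k)).filter (fun c => ¬ c.Coprime (q * k)),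
          psiMod N (q * k) c := by
          refine Finset.sum_le_sum_of_subset_of_nonneg ?_ fun c _ _ => psiMod_nonneg _ _ _
          exact Finset.filter_subset_filter _ (Finset.filter_subset _ _)
      _ ≤ Nat.log 2 N * Real.log ((q * k : ℕ) : ℝ) :=
          (sum_residue_classes (mul_ne_zero hq hk) N (fun n => ¬ n.Coprime (q * k))
            (fun _ _ h => not_congr (coprime_congr h)) _).trans_le
            (sum_not_coprime_vonMangoldt_le N (mul_ne_zero hq hk))
      _ ≤ _ := mul_le_mul_of_nonneg_right (natLog_le_two_mul_log N) (Real.log_natCast_nonneg _)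
  have hterm : ∀ b ∈ (Finset.Icc 1 q).filter (fun b => b.Coprime q),
      (psiMod N q b - N / q.totient) ^ 2 ≤ 2 * k * ∑ c ∈ coprimeLifts q k b,
        (psiMod N (q * k) c - N / (q * k).totient) ^ 2 + 2 * E b ^ 2 := by
    intro b hb
    have hb' := (Finset.mem_filter.1 hb).2
    have hcard := card_coprimeLifts hq hk hb'
    have hφ : (0 : ℝ) < q.totient := by exact_mod_cast Nat.totient_pos.2 (Nat.pos_of_ne_zero hq)
    have hφ' : (0 : ℝ) < (q * k).totient := by
      exact_mod_cast Nat.totient_pos.2 (Nat.pos_of_ne_zero (mul_ne_zero hq hk))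
    have e : psiMod N q b - N / q.totient =
        ∑ c ∈ coprimeLifts q k b, (psiMod N (q * k) c - N / (q * k).totient) + E b := by
      rw [psiMod_eq_sum_lifts hq hk, ← Finset.sum_filter_add_sum_filter_not _
        (fun n => n.Coprime (q * k)), Finset.sum_sub_distrib, Finset.sum_const, nsmul_eq_mul, hE]
      have : ((coprimeLifts q k b).card : ℝ) * (N / (q * k).totient) = N / q.totient := by
        rw [← hcard]
        have : ((coprimeLifts q k b).card : ℝ) ≠ 0 := by
          intro h0; rw [h0, zero_mul] at hcard; exact hφ'.ne hcard
        field_simp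
      rw [this, coprimeLifts]
      ring
    rw [e]
    have h1 := sq_sum_le_card_mul_sum_sq (s := coprimeLifts q k b)
      (f := fun c => psiMod N (q * k) c - N / (q * k).totient)
    have h2 : ((coprimeLifts q k b).card : ℝ) * ∑ c ∈ coprimeLifts q k b,
        (psiMod N (q * k) c - N / (q * k).totient) ^ 2 ≤ k * ∑ c ∈ coprimeLifts q k b,
        (psiMod N (q * k) c - N / (q * k).totient) ^ 2 :=
      mul_le_mul_of_nonneg_right (card_coprimeLifts_le hq k b)
        (Finset.sum_nonneg fun _ _ => sq_nonneg _)
    refine add_sq_le.trans ?_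
    linarith
  calc coprimeVar N q ≤ ∑ b ∈ (Finset.Icc 1 q).filter (fun b => b.Coprime q),
        (2 * k * ∑ c ∈ coprimeLifts q k b,
        (psiMod N (q * k) c - N / (q * k).totient) ^ 2 + 2 * E b ^ 2) := Finset.sum_le_sum hterm
    _ = 2 * k * coprimeVar N (q * k) +
        2 * ∑ b ∈ (Finset.Icc 1 q).filter (fun b => b.Coprime q), E b ^ 2 := by
        rw [Finset.sum_add_distrib, ← Finset.mul_sum, ← Finset.mul_sum, sum_sum_coprimeLifts hq,
          coprimeVar]
    _ ≤ _ := by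
        have h1 := Finset.sum_sq_le_sq_sum_of_nonneg (s := (Finset.Icc 1 q).filter
          (fun b => b.Coprime q)) (f := E) fun b _ => hE0 b
        have h2 := pow_le_pow_left₀ (Finset.sum_nonneg fun b _ => hE0 b) hEsum 2
        linarith

lemma coprimeVar_nonneg (N q : ℕ) : 0 ≤ coprimeVar N q :=
  Finset.sum_nonneg fun _ _ => sq_nonneg _

lemma coprimeVar_le_varMod_add {q : ℕ} (hq : q ≠ 0) (N : ℕ) :
    coprimeVar N q ≤ varMod N q +
      (∑ n ∈ (Finset.Icc 1 N).filter (fun n => n.Coprime q), Λ n - N) ^ 2 * (1 / q.totient) := by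
  have hφ : (0 : ℝ) < q.totient := by exact_mod_cast Nat.totient_pos.2 (Nat.pos_of_ne_zero hq)
  have h := varMod_split N q hq (N / q.totient)
  rw [mul_div_cancel₀ _ hφ.ne'] at h
  have h0 : 0 ≤ ∑ b ∈ (Finset.Icc 1 q).filter (fun b => ¬ b.Coprime q),
        (psiMod N q b - seqAver (fun n => Λ n) N q (Nat.gcd b q)) ^ 2 :=
    Finset.sum_nonneg fun _ _ => sq_nonneg _
  rw [coprimeVar, mul_one_div]
  linarith

lemma sum_mul_sum_multiples_le {S T U : Finset ℕ} {f g F : ℕ → ℝ} (hf : ∀ k, 0 ≤ f k)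
    (hg : ∀ m, 0 ≤ g m) (hU : ∀ k ∈ U, k ≠ 0) (hT0 : ∀ m ∈ T, m ≠ 0)
    (hT : ∀ q ∈ S, ∀ k ∈ U, q * k ∈ T) (hF : ∀ m ∈ T, ∑ k ∈ m.divisors, f k ≤ F m) :
    ∑ k ∈ U, f k * ∑ q ∈ S, g (q * k) ≤ ∑ m ∈ T, F m * g m := by
  calc _ ≤ ∑ k ∈ U, f k * ∑ m ∈ T.filter (fun m => k ∣ m), g m := by
        refine Finset.sum_le_sum fun k hk => mul_le_mul_of_nonneg_left ?_ (hf k)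
        have hinj : Set.InjOn (fun q => q * k) (S : Set ℕ) := fun a _ b _ h =>
          Nat.eq_of_mul_eq_mul_right (Nat.pos_of_ne_zero (hU k hk)) h
        rw [← Finset.sum_image (f := g) hinj]
        refine Finset.sum_le_sum_of_subset_of_nonneg ?_ fun _ _ _ => hg _
        intro m hm
        obtain ⟨q, hq, rfl⟩ := Finset.mem_image.1 hm
        exact Finset.mem_filter.2 ⟨hT q hq k hk, Dvd.intro_left q rfl⟩
    _ = ∑ m ∈ T, (∑ k ∈ U.filter (fun k => k ∣ m), f k) * g m := by
        simp only [Finset.mul_sum, Finset.sum_mul, Finset.sum_filter]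
        rw [Finset.sum_comm]
        refine Finset.sum_congr rfl fun m _ => Finset.sum_congr rfl fun k _ => ?_
        split_ifs <;> simp
    _ ≤ _ := by
        refine Finset.sum_le_sum fun m hm => mul_le_mul_of_nonneg_right ?_ (hg m)
        refine le_trans ?_ (hF m hm)
        refine Finset.sum_le_sum_of_subset_of_nonneg ?_ fun _ _ _ => hf _
        intro k hk
        exact Nat.mem_divisors.2 ⟨(Finset.mem_filter.1 hk).2, hT0 m hm⟩

lemma sum_coprimeVar_le {S T : Finset ℕ} {N K : ℕ} {x : ℝ} (hx : 1 ≤ x) (hN : N ≤ x)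
    (hS : ∀ q ∈ S, q ≠ 0) (hT0 : ∀ m ∈ T, m ≠ 0 ∧ (m : ℝ) ≤ x)
    (hT : ∀ q ∈ S, ∀ k ∈ Finset.Ioc K (2 * K), q * k ∈ T) :
    (∑ k ∈ Finset.Ioc K (2 * K), Λ k) * ∑ q ∈ S, coprimeVar N q ≤
      4 * K * (Real.log x * ∑ m ∈ T, coprimeVar N m) +
        (∑ k ∈ Finset.Ioc K (2 * K), Λ k) * (S.card * (8 * Real.log x ^ 4)) := by
  have hL := Real.log_nonneg hx
  have h1 := sum_mul_sum_multiples_le (S := S) (T := T) (U := Finset.Ioc K (2 * K))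
    (f := fun k => Λ k) (g := coprimeVar N) (F := fun _ => Real.log x)
    (fun _ => ArithmeticFunction.vonMangoldt_nonneg) (coprimeVar_nonneg N)
    (fun k hk => by rw [Finset.mem_Ioc] at hk; omega) (fun m hm => (hT0 m hm).1) hT
    (fun m hm => by
      rw [ArithmeticFunction.vonMangoldt_sum]
      exact log_natCast_le_log hx (hT0 m hm).2)
  rw [← Finset.mul_sum] at h1
  calc _ = ∑ k ∈ Finset.Ioc K (2 * K), Λ k * ∑ q ∈ S, coprimeVar N q := by rw [Finset.sum_mul]
    _ ≤ ∑ k ∈ Finset.Ioc K (2 * K), Λ k * ∑ q ∈ S,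
          (4 * K * coprimeVar N (q * k) + 8 * Real.log x ^ 4) := by
        refine Finset.sum_le_sum fun k hk => mul_le_mul_of_nonneg_left
          (Finset.sum_le_sum fun q hq => ?_) ArithmeticFunction.vonMangoldt_nonneg
        have hm := hT0 _ (hT q hq k hk)
        rw [Finset.mem_Ioc] at hk
        have hk2 : (k : ℝ) ≤ 2 * K := by exact_mod_cast hk.2
        refine (coprimeVar_le_mul (hS q hq) (by omega : k ≠ 0) N).trans ?_
        have e1 : 2 * (k : ℝ) * coprimeVar N (q * k) ≤ 4 * K * coprimeVar N (q * k) :=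
          mul_le_mul_of_nonneg_right (by linarith) (coprimeVar_nonneg _ _)
        have e2 : (2 * Real.log N * Real.log ((q * k : ℕ) : ℝ)) ^ 2 ≤
            (2 * Real.log x * Real.log x) ^ 2 := by
          have h1 := log_natCast_le_log hx hN
          have h2 := log_natCast_le_log hx hm.2
          have h3 := Real.log_natCast_nonneg N
          have h4 := Real.log_natCast_nonneg (q * k)
          gcongr
        have e3 : (2 * Real.log x * Real.log x) ^ 2 = 4 * Real.log x ^ 4 := by ring
        linarith
    _ = 4 * K * ∑ k ∈ Finset.Ioc K (2 * K), Λ k * ∑ q ∈ S, coprimeVar N (q * k) +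
        (∑ k ∈ Finset.Ioc K (2 * K), Λ k) * (S.card * (8 * Real.log x ^ 4)) := by
        rw [Finset.mul_sum, Finset.sum_mul, ← Finset.sum_add_distrib]
        refine Finset.sum_congr rfl fun k _ => ?_
        rw [Finset.sum_add_distrib, ← Finset.mul_sum, Finset.sum_const, nsmul_eq_mul]
        ring
    _ ≤ _ := by
        have := mul_le_mul_of_nonneg_left h1 (show (0 : ℝ) ≤ 4 * K by positivity)
        linarith

lemma exists_half_le_sum_vonMangoldt :
    ∃ K₀ : ℕ, 1 ≤ K₀ ∧ ∀ K, K₀ ≤ K → (K : ℝ) / 2 ≤ ∑ k ∈ Finset.Ioc K (2 * K), Λ k := by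
  obtain ⟨C, hC, h⟩ := abs_psiMod_sub_le 1
  obtain ⟨K₀, hK₀⟩ := exists_nat_ge (Real.exp (8 * C) + 81)
  have hexp := Real.exp_pos (8 * C)
  have hK1 : (1 : ℝ) ≤ K₀ := by linarith
  refine ⟨K₀, by exact_mod_cast hK1, fun K hK => ?_⟩
  have hK' : (K₀ : ℝ) ≤ K := by exact_mod_cast hK
  have hlog : 8 * C ≤ Real.log (2 * K) := by
    rw [Real.le_log_iff_exp_le (by linarith)]
    linarith
  have h1 := h 1 0 K (2 * K) one_ne_zero (Nat.coprime_one_right 0) (by linarith) (by linarith)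
  have h2 := h 1 0 (2 * K) (2 * K) one_ne_zero (Nat.coprime_one_right 0) (by linarith)
    (by push_cast; linarith)
  rw [psiMod_one, Nat.totient_one, Nat.cast_one, div_one, mul_one, pow_one] at h1 h2
  have h3 : C * (2 * K) / Real.log (2 * K) ≤ K / 4 := by
    rw [div_le_iff₀ (by linarith)]
    nlinarith
  have h4 : ∑ k ∈ Finset.Ioc K (2 * K), Λ k =
      ∑ n ∈ Finset.Icc 1 (2 * K), Λ n - ∑ n ∈ Finset.Icc 1 K, Λ n := by
    have := Finset.sum_Ioc_consecutive (fun n : ℕ => Λ n) (Nat.zero_le K) (by omega : K ≤ 2 * K)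
    rw [eq_sub_iff_add_eq']
    exact this
  rw [h4]
  rw [abs_le] at h1 h2
  push_cast at h2
  linarith [h1.2, h2.1]

lemma varV_nonneg (a : ℕ → ℝ) (x Q : ℝ) : 0 ≤ varV a x Q :=
  Finset.sum_nonneg fun _ _ => Finset.sum_nonneg fun _ _ => sq_nonneg _

lemma varV_le_of_log_pow (t : ℕ) : ∃ C : ℝ, 1 ≤ C ∧
    ∀ x Q : ℝ, 81 ≤ x → 4 ≤ Q → x / Real.log x ^ (t + 4) ≤ Q → Q ≤ 2 * (x / Real.log x ^ (t + 3)) →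
      Q ≤ x → varV (fun n => Λ n) x Q ≤ C * (x ^ 2 / Real.log x ^ t) := by
  obtain ⟨C, hC, h⟩ := abs_varV_sub_le_of_log_pow t (t + 4)
  refine ⟨1 + 3 * C, by linarith, fun x Q hx hQ4 hQB hQt hQx => ?_⟩
  have hL := one_le_log_of_three_le (show 3 ≤ x by linarith)
  have h1 := (abs_le.1 (h x Q hx hQ4 hQB hQx)).2
  have hS := sum_vonMangoldt_sq_le (by linarith) (Nat.floor_le (show 0 ≤ x by linarith))
  have hℓ := half_le_log_two_mul_div (by linarith) hQx
  have hℓL : Real.log (2 * x / Q) ≤ Real.log x := by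
    apply Real.log_le_log (by positivity)
    rw [div_le_iff₀ (by linarith)]
    nlinarith
  obtain ⟨L, hLdef⟩ : ∃ L, L = Real.log x := ⟨_, rfl⟩
  rw [← hLdef] at hL h1 hS hℓL hQt ⊢
  have hQL : Q * x * L ^ 2 ≤ 2 * (x ^ 2 / L ^ t) := by
    calc _ ≤ 2 * (x / L ^ (t + 3)) * x * L ^ 2 := by gcongr
      _ = 2 * (x ^ 2 / L ^ t) / L := by rw [pow_add]; field_simp
      _ ≤ _ := div_le_self (by positivity) hL
  have h2 : Q / 2 * ∑ n ∈ Finset.Icc 1 ⌊x⌋₊, Λ n ^ 2 ≤ x ^ 2 / L ^ t := by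
    calc _ ≤ Q / 2 * (x * L ^ 2) := by gcongr
      _ = Q * x * L ^ 2 / 2 := by ring
      _ ≤ _ := by linarith
  have h3 : Q * x * Real.log (2 * x / Q) ^ 2 ≤ Q * x * L ^ 2 := by gcongr
  nlinarith

set_option maxHeartbeats 1000000 in
/-- The variance is negligible when `Q` is smaller than `x` by a large power of `log x`. -/
theorem varV_le_of_lt_log_pow (t : ℕ) : ∃ C : ℝ, 1 ≤ C ∧
    ∀ x Q : ℝ, C ≤ x → 4 ≤ Q → Q ≤ x / Real.log x ^ (t + 5) →
      varV (fun n => Λ n) x Q ≤ C * (x ^ 2 / Real.log x ^ t) := by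
  obtain ⟨C₁, hC₁, hblock⟩ := varV_le_of_log_pow (t + 1)
  obtain ⟨C₂, hC₂, hcop⟩ := abs_sum_coprime_vonMangoldt_sub_le (t + 3)
  obtain ⟨K₀, hK₀, hΛ⟩ := exists_half_le_sum_vonMangoldt
  obtain ⟨D, hD⟩ : ∃ D : ℝ, D = 8 * (2 * C₁ + 6 * C₂ ^ 2) + 12 * (4 + t).factorial := ⟨_, rfl⟩
  have hD1 : 1 ≤ D := by
    have : (0 : ℝ) ≤ 12 * (4 + t).factorial := by positivity
    nlinarith
  refine ⟨D + 81 + Real.exp (K₀ + 2), by linarith [Real.exp_pos ((K₀ : ℝ) + 2)],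
    fun x Q hx hQ4 hQ => ?_⟩
  have hexp := Real.exp_pos ((K₀ : ℝ) + 2)
  have hx81 : 81 ≤ x := by linarith
  have hLK : (K₀ : ℝ) + 2 ≤ Real.log x := by
    rw [Real.le_log_iff_exp_le (by linarith)]
    linarith
  have hK₀0 : (1 : ℝ) ≤ K₀ := by exact_mod_cast hK₀
  have s1 := mul_log_pow_le (i := 4) (j := t) (show 3 ≤ x by linarith)
  have hblock₁ := hblock x
  have hcop₁ := fun m hm hm' => hcop m ⌊x⌋₊ x hm hx81 (Nat.floor_le (by linarith)) hm'
  have hinv := fun S P => sum_inv_totient_le (S := S) (P := P) (show 3 ≤ x by linarith)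
  have hNx : ((⌊x⌋₊ : ℕ) : ℝ) ≤ x := Nat.floor_le (by linarith)
  have hcv := fun S T K => sum_coprimeVar_le (S := S) (T := T) (K := K)
    (show 1 ≤ x by linarith) hNx
  have hlogle := fun (n : ℕ) (hn : (n : ℝ) ≤ x) => log_natCast_le_log (by linarith) hn
  obtain ⟨N, hNdef⟩ : ∃ N, N = ⌊x⌋₊ := ⟨_, rfl⟩
  obtain ⟨L, hLdef⟩ : ∃ L, L = Real.log x := ⟨_, rfl⟩
  simp only [← hLdef, ← hNdef] at hQ hLK s1 hblock₁ hcop₁ hinv hNx hcv hlogle ⊢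
  have hL2 : 2 ≤ L := by linarith
  obtain ⟨y, hy⟩ : ∃ y, y = x / L ^ (t + 4) := ⟨_, rfl⟩
  have hyQ : L * Q ≤ y := by
    rw [le_div_iff₀ (by positivity), pow_succ] at hQ
    rw [hy, le_div_iff₀ (by positivity)]
    linarith
  have hQ0 : 0 < Q := by linarith
  have hyx : 2 * y ≤ x := by
    rw [hy, ← mul_div_assoc, div_le_iff₀ (by positivity)]
    have : L ≤ L ^ (t + 4) := le_self_pow₀ (by linarith) (by omega)
    nlinarith
  obtain ⟨K, hKdef⟩ : ∃ K, K = ⌊y / Q⌋₊ := ⟨_, rfl⟩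
  have hLy : L ≤ y / Q := by rwa [le_div_iff₀ hQ0]
  have hKle : (K : ℝ) * Q ≤ y := by
    rw [← le_div_iff₀ hQ0, hKdef]; exact Nat.floor_le (by linarith)
  have hKge : y / Q < K + 1 := by rw [hKdef]; exact Nat.lt_floor_add_one _
  have hKK₀ : K₀ ≤ K := by rw [hKdef]; exact Nat.le_floor (by linarith)
  have hK1 : (1 : ℝ) ≤ K := by exact_mod_cast hK₀.trans hKK₀
  have hKQ : y / 2 ≤ K * Q := by
    have : y / Q / 2 ≤ K := by linarith
    calc y / 2 = y / Q / 2 * Q := by field_simp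
      _ ≤ _ := by gcongr
  have hy2 : x / L ^ (t + 1 + 4) ≤ y / 2 := by
    rw [hy, div_div]
    refine div_le_div_of_nonneg_left (by linarith) (by positivity) ?_
    calc L ^ (t + 4) * 2 ≤ L ^ (t + 4) * L := by gcongr
      _ = L ^ (t + 1 + 4) := by ring
  have hy3 : x / L ^ (t + 1 + 3) = y := by rw [hy, show t + 1 + 3 = t + 4 by ring]
  have hKQ4 : 4 ≤ K * Q := by nlinarith
  obtain ⟨M, hM⟩ : ∃ M, M = x ^ 2 / L ^ (t + 1) := ⟨_, rfl⟩
  have hM0 : 0 ≤ M := by rw [hM]; positivity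
  have hb1 := hblock₁ (K * Q) hx81 hKQ4 (by linarith) (by linarith) (by linarith)
  have hb2 := hblock₁ (2 * (K * Q)) hx81 (by linarith) (by linarith) (by linarith) (by linarith)
  rw [varV_eq_sum_varMod, ← hM, ← hNdef] at hb1 hb2
  rw [mul_div_cancel_left₀ _ (two_ne_zero)] at hb2
  have hf1 : ⌊K * Q / 2⌋₊ ≤ ⌊K * Q⌋₊ := Nat.floor_le_floor (by linarith)
  have hf2 : ⌊K * Q⌋₊ ≤ ⌊2 * (K * Q)⌋₊ := Nat.floor_le_floor (by linarith)
  have hcons := Finset.sum_Ioc_consecutive (fun m => varMod N m) hf1 hf2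
  obtain ⟨T, hTdef⟩ : ∃ T, T = Finset.Ioc ⌊K * Q / 2⌋₊ ⌊2 * (K * Q)⌋₊ := ⟨_, rfl⟩
  rw [← hTdef] at hcons
  have hTm : ∀ m ∈ T, m ≠ 0 ∧ (m : ℝ) ≤ x := by
    intro m hm
    rw [hTdef, Finset.mem_Ioc] at hm
    refine ⟨by omega, ?_⟩
    have := (Nat.le_floor_iff (by linarith)).1 hm.2
    linarith
  have hTN : T ⊆ Finset.Icc 1 N := by
    intro m hm
    have := hTm m hm
    rw [Finset.mem_Icc, hNdef]
    exact ⟨Nat.pos_of_ne_zero this.1, Nat.le_floor this.2⟩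
  have hW : ∑ m ∈ T, coprimeVar N m ≤ (2 * C₁ + 6 * C₂ ^ 2) * M := by
    calc _ ≤ ∑ m ∈ T, (varMod N m + (C₂ * (x / L ^ (t + 3))) ^ 2 * (1 / (m.totient : ℝ))) := by
          refine Finset.sum_le_sum fun m hm => ?_
          have hm' := hTm m hm
          refine (coprimeVar_le_varMod_add hm'.1 N).trans ?_
          have h1 := hcop₁ m hm'.1 hm'.2
          have h2 := sq_le_sq' (abs_le.1 h1).1 (abs_le.1 h1).2
          have := mul_le_mul_of_nonneg_right h2 (show 0 ≤ 1 / (m.totient : ℝ) by positivity)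
          linarith
      _ = ∑ m ∈ T, varMod N m + (C₂ * (x / L ^ (t + 3))) ^ 2 * ∑ m ∈ T, 1 / (m.totient : ℝ) := by
          rw [Finset.sum_add_distrib, Finset.mul_sum]
      _ ≤ 2 * C₁ * M + (C₂ * (x / L ^ (t + 3))) ^ 2 * (6 * L ^ 2) := by
          have := hinv T N hNx hTN
          gcongr
          linarith
      _ ≤ 2 * C₁ * M + 6 * C₂ ^ 2 * M := by
          have : (x / L ^ (t + 3)) ^ 2 * L ^ 2 ≤ M := by
            calc (x / L ^ (t + 3)) ^ 2 * L ^ 2 = x ^ 2 / L ^ (t + 1) / L ^ (t + 3) := by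
                  field_simp
                  ring
              _ ≤ M := by
                  rw [hM]
                  exact div_le_self (by positivity) (one_le_pow₀ (by linarith))
          have := mul_le_mul_of_nonneg_left this (show 0 ≤ 6 * C₂ ^ 2 by positivity)
          linarith
      _ = _ := by ring
  obtain ⟨S, hSdef⟩ : ∃ S, S = Finset.Ioc ⌊Q / 2⌋₊ ⌊Q⌋₊ := ⟨_, rfl⟩
  have hSx : ∀ q ∈ S, q ≠ 0 ∧ (q : ℝ) ≤ x := by
    intro q hq
    rw [hSdef, Finset.mem_Ioc] at hq
    have := (Nat.le_floor_iff (by linarith)).1 hq.2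
    exact ⟨by omega, by nlinarith⟩
  have hScard : (S.card : ℝ) ≤ x := by
    have h1 : S.card ≤ ⌊Q⌋₊ := by rw [hSdef, Nat.card_Ioc]; omega
    have h2 : ((⌊Q⌋₊ : ℕ) : ℝ) ≤ Q := Nat.floor_le hQ0.le
    have h3 : (S.card : ℝ) ≤ (⌊Q⌋₊ : ℕ) := by exact_mod_cast h1
    nlinarith
  have hmain := hcv S T K (fun q hq => (hSx q hq).1) hTm (by
    intro q hq k hk
    rw [hSdef, Finset.mem_Ioc] at hq
    rw [Finset.mem_Ioc] at hk
    have hq1 : Q / 2 < q := (Nat.floor_lt (by linarith)).1 hq.1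
    have hq2 : (q : ℝ) ≤ Q := (Nat.le_floor_iff (by linarith)).1 hq.2
    have hk1 : (K : ℝ) < k := by exact_mod_cast hk.1
    have hk2 : (k : ℝ) ≤ 2 * K := by exact_mod_cast hk.2
    rw [hTdef, Finset.mem_Ioc]
    constructor
    · rw [Nat.floor_lt (by positivity)]
      push_cast
      linarith [mul_lt_mul'' hq1 hk1 (by linarith) (by linarith)]
    · apply Nat.le_floor
      push_cast
      linarith [mul_le_mul hq2 hk2 (by positivity) hQ0.le])
  have hΛK := hΛ K hKK₀
  obtain ⟨Θ, hΘ⟩ : ∃ Θ, Θ = ∑ k ∈ Finset.Ioc K (2 * K), Λ k := ⟨_, rfl⟩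
  rw [← hΘ] at hmain hΛK
  have hW0 : 0 ≤ ∑ m ∈ T, coprimeVar N m := Finset.sum_nonneg fun _ _ => coprimeVar_nonneg _ _
  have hV : ∑ q ∈ S, coprimeVar N q ≤ 8 * (L * ∑ m ∈ T, coprimeVar N m) + x * (8 * L ^ 4) := by
    refine le_of_mul_le_mul_left (hmain.trans ?_) (show 0 < Θ by linarith)
    rw [mul_add]
    have e1 : 4 * K * (L * ∑ m ∈ T, coprimeVar N m) ≤
        8 * Θ * (L * ∑ m ∈ T, coprimeVar N m) :=
      mul_le_mul_of_nonneg_right (by linarith) (by positivity)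
    have e2 : Θ * (S.card * (8 * L ^ 4)) ≤ Θ * (x * (8 * L ^ 4)) :=
      mul_le_mul_of_nonneg_left (mul_le_mul_of_nonneg_right hScard (by positivity)) (by linarith)
    linarith
  have hML : L * M = x ^ 2 / L ^ t := by
    have hL : L ≠ 0 := by linarith
    rw [hM, pow_succ, mul_div_assoc', div_eq_div_iff (by positivity) (by positivity)]
    ring
  rw [varV_eq_sum_varMod, ← hSdef, ← hNdef]
  calc _ ≤ ∑ q ∈ S, (coprimeVar N q + 4 * L ^ 4) := by
        refine Finset.sum_le_sum fun q hq => ?_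
        have hq' := hSx q hq
        refine (varMod_le N q hq'.1 (N / q.totient)).trans ?_
        rw [← coprimeVar]
        have h1 := hlogle N hNx
        have h2 := hlogle q hq'.2
        have h3 := Real.log_natCast_nonneg N
        have h4 := Real.log_natCast_nonneg q
        have : (2 * Real.log N * Real.log q) ^ 2 ≤ (2 * L * L) ^ 2 := by gcongr
        nlinarith
    _ = ∑ q ∈ S, coprimeVar N q + S.card * (4 * L ^ 4) := by
        rw [Finset.sum_add_distrib, Finset.sum_const, nsmul_eq_mul]
    _ ≤ 8 * (L * ∑ m ∈ T, coprimeVar N m) + x * (8 * L ^ 4) + x * (4 * L ^ 4) := by gcongr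
    _ ≤ 8 * (L * ((2 * C₁ + 6 * C₂ ^ 2) * M)) + 12 * (x * L ^ 4) := by
        have : L * ∑ m ∈ T, coprimeVar N m ≤ L * ((2 * C₁ + 6 * C₂ ^ 2) * M) := by gcongr
        linarith
    _ = 8 * (2 * C₁ + 6 * C₂ ^ 2) * (L * M) + 12 * (x * L ^ 4) := by ring
    _ ≤ D * (x ^ 2 / L ^ t) := by
        rw [hML, hD, add_mul]
        linarith
    _ ≤ _ := by
        gcongr
        linarith

lemma psi_natCast_eq_sum_Icc (N : ℕ) : Chebyshev.psi N = ∑ n ∈ Finset.Icc 1 N, Λ n := by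
  rw [Chebyshev.psi, Nat.floor_natCast]
  rfl

lemma sum_vonMangoldt_mul_log_sub_le (N : ℕ) :
    ∑ n ∈ Finset.Icc 1 N, Λ n * (Real.log N - Real.log n) ≤ (Real.log 4 + 4) * N := by
  induction N with
  | zero => simp
  | succ N ih =>
    rcases Nat.eq_zero_or_pos N with rfl | hN
    · simp
      positivity
    have hN' : (0 : ℝ) < N := by exact_mod_cast hN
    rw [Finset.sum_Icc_succ_top (by omega), sub_self, mul_zero, add_zero]
    have hstep : Real.log ((N + 1 : ℕ) : ℝ) - Real.log N ≤ 1 / N := by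
      rw [← Real.log_div (by positivity) hN'.ne']
      refine (Real.log_le_sub_one_of_pos (by positivity)).trans (le_of_eq ?_)
      push_cast
      field_simp
      ring
    have hpsi : ∑ n ∈ Finset.Icc 1 N, Λ n ≤ (Real.log 4 + 4) * N := by
      rw [← psi_natCast_eq_sum_Icc]
      exact Chebyshev.psi_le_const_mul_self hN'.le
    calc ∑ n ∈ Finset.Icc 1 N, Λ n * (Real.log ((N + 1 : ℕ) : ℝ) - Real.log n)
        = ∑ n ∈ Finset.Icc 1 N, Λ n * (Real.log N - Real.log n) +
          (∑ n ∈ Finset.Icc 1 N, Λ n) * (Real.log ((N + 1 : ℕ) : ℝ) - Real.log N) := by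
          rw [Finset.sum_mul, ← Finset.sum_add_distrib]
          exact Finset.sum_congr rfl fun n _ => by ring
      _ ≤ (Real.log 4 + 4) * N + (Real.log 4 + 4) * N * (1 / N) := by
          refine add_le_add ih ((mul_le_mul_of_nonneg_left hstep ?_).trans
            (mul_le_mul_of_nonneg_right hpsi (by positivity)))
          exact Finset.sum_nonneg fun _ _ => ArithmeticFunction.vonMangoldt_nonneg
      _ = (Real.log 4 + 4) * ((N + 1 : ℕ) : ℝ) := by
          push_cast
          field_simp

lemma sum_vonMangoldt_mul_log_sub_self_le {N : ℕ} (hN : 1 ≤ N) :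
    ∑ n ∈ Finset.Icc 1 N, Λ n * (Real.log n - Λ n) ≤ 2 * √N * Real.log N ^ 2 := by
  have hN1 : (1 : ℝ) ≤ N := by exact_mod_cast hN
  have hle := Chebyshev.psi_sub_theta_le hN1
  rw [Chebyshev.psi_sub_theta_eq_sum_not_prime, Nat.floor_natCast] at hle
  calc ∑ n ∈ Finset.Icc 1 N, Λ n * (Real.log n - Λ n)
      ≤ ∑ n ∈ Finset.Icc 1 N, if ¬ n.Prime then Λ n * Real.log N else 0 := by
        refine Finset.sum_le_sum fun n hn => ?_
        have hn' := Finset.mem_Icc.1 hn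
        have h0 : 0 ≤ Λ n := ArithmeticFunction.vonMangoldt_nonneg
        split_ifs with hp
        · rw [ArithmeticFunction.vonMangoldt_apply_prime hp, sub_self, mul_zero]
        · refine mul_le_mul_of_nonneg_left ?_ h0
          have : Real.log n ≤ Real.log N :=
            Real.log_le_log (by exact_mod_cast hn'.1) (by exact_mod_cast hn'.2)
          linarith
    _ = (∑ n ∈ Finset.Ioc 0 N with ¬ n.Prime, Λ n) * Real.log N := by
        rw [← Finset.sum_filter, Finset.sum_mul]
        rfl
    _ ≤ 2 * √N * Real.log N * Real.log N :=
        mul_le_mul_of_nonneg_right hle (Real.log_natCast_nonneg N)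
    _ = _ := by ring

lemma abs_sum_vonMangoldt_sq_sub_natCast_le :
    ∃ C : ℝ, 1 ≤ C ∧ ∀ N : ℕ, 81 ≤ N →
      |∑ n ∈ Finset.Icc 1 N, Λ n ^ 2 - N * Real.log N| ≤ C * N := by
  obtain ⟨C, hC, hψ⟩ := abs_psiMod_sub_le 1
  refine ⟨C + (Real.log 4 + 4) + 16 , ?_, fun N hN => ?_⟩
  · have : 0 ≤ Real.log 4 := Real.log_nonneg (by norm_num)
    linarith
  have hN' : (81 : ℝ) ≤ N := by exact_mod_cast hN
  have hL : 1 ≤ Real.log N := one_le_log_of_three_le (by linarith)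
  have h1 := hψ 1 1 N N one_ne_zero (Nat.coprime_one_right _) hN' le_rfl
  rw [psiMod_one, Nat.totient_one, Nat.cast_one, div_one, pow_one, mul_one] at h1
  have h2 := sum_vonMangoldt_mul_log_sub_le N
  have h3 := sum_vonMangoldt_mul_log_sub_self_le (N := N) (by omega)
  have h4 : 2 * √N * Real.log N ^ 2 ≤ 16 * N := by
    have h := log_pow_le_sqrt 2 (show (1 : ℝ) ≤ N by linarith)
    have hs : √(N : ℝ) * √N = N := Real.mul_self_sqrt (by linarith)
    norm_num [Nat.factorial] at h
    nlinarith [mul_le_mul_of_nonneg_left h (Real.sqrt_nonneg (N : ℝ))]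
  have h5 : 0 ≤ ∑ n ∈ Finset.Icc 1 N, Λ n * (Real.log N - Λ n) := by
    refine Finset.sum_nonneg fun n hn => mul_nonneg ArithmeticFunction.vonMangoldt_nonneg ?_
    have hn' := Finset.mem_Icc.1 hn
    have : Real.log n ≤ Real.log N :=
      Real.log_le_log (by exact_mod_cast hn'.1) (by exact_mod_cast hn'.2)
    linarith [ArithmeticFunction.vonMangoldt_le_log (n := n)]
  have h6 : ∑ n ∈ Finset.Icc 1 N, Λ n * (Real.log N - Λ n) =
      ∑ n ∈ Finset.Icc 1 N, Λ n * (Real.log N - Real.log n) +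
        ∑ n ∈ Finset.Icc 1 N, Λ n * (Real.log n - Λ n) := by
    rw [← Finset.sum_add_distrib]
    exact Finset.sum_congr rfl fun n _ => by ring
  have h7 : ∑ n ∈ Finset.Icc 1 N, Λ n * (Real.log N - Λ n) =
      (∑ n ∈ Finset.Icc 1 N, Λ n) * Real.log N - ∑ n ∈ Finset.Icc 1 N, Λ n ^ 2 := by
    rw [Finset.sum_mul, ← Finset.sum_sub_distrib]
    exact Finset.sum_congr rfl fun n _ => by ring
  have h8 : |(∑ n ∈ Finset.Icc 1 N, Λ n - N) * Real.log N| ≤ C * N := by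
    rw [abs_mul, abs_of_nonneg (by linarith : 0 ≤ Real.log (N : ℝ))]
    exact (le_div_iff₀ (by linarith)).1 h1
  rw [abs_le] at h8 ⊢
  constructor <;> nlinarith [Real.log_nonneg (show (1 : ℝ) ≤ 4 by norm_num)]

lemma abs_sum_vonMangoldt_sq_sub_le :
    ∃ C : ℝ, 1 ≤ C ∧ ∀ x : ℝ, 81 ≤ x →
      |∑ n ∈ Finset.Icc 1 ⌊x⌋₊, Λ n ^ 2 - x * Real.log x| ≤ C * x := by
  obtain ⟨C, hC, h⟩ := abs_sum_vonMangoldt_sq_sub_natCast_le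
  refine ⟨C + 2, by linarith, fun x hx => ?_⟩
  have hN : 81 ≤ ⌊x⌋₊ := Nat.le_floor (by exact_mod_cast hx)
  have h1 := h ⌊x⌋₊ hN
  have hNx : (⌊x⌋₊ : ℝ) ≤ x := Nat.floor_le (by linarith)
  have hxN : x < ⌊x⌋₊ + 1 := Nat.lt_floor_add_one x
  have hN0 : (81 : ℝ) ≤ ⌊x⌋₊ := by exact_mod_cast hN
  obtain ⟨N, hNdef⟩ : ∃ N : ℝ, N = (⌊x⌋₊ : ℝ) := ⟨_, rfl⟩
  rw [← hNdef] at h1 hNx hxN hN0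
  have hlog : Real.log N ≤ Real.log x := Real.log_le_log (by linarith) hNx
  have hlogx : Real.log x ≤ x := (Real.log_le_sub_one_of_pos (by linarith)).trans (by linarith)
  have hlogx0 : 0 ≤ Real.log x := Real.log_nonneg (by linarith)
  have hd : N * (Real.log x - Real.log N) ≤ 1 := by
    rw [← Real.log_div (by linarith) (by linarith)]
    have h2 : Real.log (x / N) ≤ x / N - 1 := Real.log_le_sub_one_of_pos (by
      have : 0 < N := by linarith
      positivity)
    calc N * Real.log (x / N) ≤ N * (x / N - 1) := mul_le_mul_of_nonneg_left h2 (by linarith)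
      _ = x - N := by
          have : N ≠ 0 := by linarith
          field_simp
      _ ≤ 1 := by linarith
  have hd0 : 0 ≤ N * (Real.log x - Real.log N) := mul_nonneg (by linarith) (by linarith)
  have he : (x - N) * Real.log x ≤ x := by nlinarith
  have he0 : 0 ≤ (x - N) * Real.log x := mul_nonneg (by linarith) hlogx0
  have hC' : C * N ≤ C * x := mul_le_mul_of_nonneg_left hNx (by linarith)
  rw [abs_le] at h1 ⊢
  constructor <;> linarith

lemma abs_varV_sub_le (t : ℕ) :
    ∃ C : ℝ, 1 ≤ C ∧ ∀ x Q : ℝ, C ≤ x → 4 ≤ Q → Q ≤ x →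
      |varV (fun n => Λ n) x Q - Q / 2 * ∑ n ∈ Finset.Icc 1 ⌊x⌋₊, Λ n ^ 2| ≤
        C * (x ^ 2 / Real.log x ^ t + Q * x * Real.log (2 * x / Q) ^ 2) := by
  obtain ⟨C₁, hC₁, h₁⟩ := abs_varV_sub_le_of_log_pow t (t + 5)
  obtain ⟨C₂, hC₂, h₂⟩ := varV_le_of_lt_log_pow t
  refine ⟨C₁ + C₂ + 81, by linarith, fun x Q hx hQ4 hQx => ?_⟩
  have hL : 1 ≤ Real.log x := one_le_log_of_three_le (by linarith)
  obtain ⟨L, hLdef⟩ : ∃ L, L = Real.log x := ⟨_, rfl⟩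
  have hx0 : 0 < x := by linarith
  have hE : 0 ≤ x ^ 2 / Real.log x ^ t := by positivity
  have hF : 0 ≤ Q * x * Real.log (2 * x / Q) ^ 2 := by positivity
  rcases le_total (x / Real.log x ^ (t + 5)) Q with hQ | hQ
  · exact (h₁ x Q (by linarith) hQ4 hQ hQx).trans
      (mul_le_mul_of_nonneg_right (by linarith) (by linarith))
  · have hV := h₂ x Q (by linarith) hQ4 hQ
    have hV0 := varV_nonneg (fun n => Λ n) x Q
    have hS := sum_vonMangoldt_sq_le (by linarith : 1 ≤ x) (Nat.floor_le hx0.le)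
    have hS0 := sum_vonMangoldt_sq_nonneg ⌊x⌋₊
    have hQS : Q / 2 * ∑ n ∈ Finset.Icc 1 ⌊x⌋₊, Λ n ^ 2 ≤ x ^ 2 / Real.log x ^ t := by
      calc _ ≤ x / Real.log x ^ (t + 5) * (x * Real.log x ^ 2) :=
            mul_le_mul (by linarith) hS hS0 (by positivity)
        _ = x ^ 2 / Real.log x ^ t / Real.log x ^ 3 := by
            rw [← hLdef] at hL ⊢
            field_simp
            ring
        _ ≤ _ := div_le_self hE (one_le_pow₀ hL)
    have hQS0 : 0 ≤ Q / 2 * ∑ n ∈ Finset.Icc 1 ⌊x⌋₊, Λ n ^ 2 := mul_nonneg (by linarith) hS0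
    have hbig : (C₂ + 1) * (x ^ 2 / Real.log x ^ t) ≤
        (C₁ + C₂ + 81) * (x ^ 2 / Real.log x ^ t + Q * x * Real.log (2 * x / Q) ^ 2) :=
      mul_le_mul (by linarith) (by linarith) hE (by linarith)
    refine le_trans ?_ hbig
    rw [abs_le]
    constructor <;> nlinarith

end VarianceBDH

open ArithmeticFunction in
/-- The von Mangoldt example from the introduction: fix `A > 0`; for `x` large and
`x^{0.51} ≤ Q ≤ x`,
`V(Λ,x,Q) = (Q/2) Σ_{n ≤ x} Λ(n)² + O_A(x²/log^A x + Qx log²(2x/Q))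
          = (Qx log x)/2 + O_A(x²/log^A x + Qx log²(2x/Q))`. -/
theorem statement_13 (A : ℝ) (hA : 0 < A) :
    ∃ C : ℝ, 0 < C ∧ ∀ x Q : ℝ, C ≤ x → x ^ (0.51 : ℝ) ≤ Q → Q ≤ x →
      |varV (fun n => Λ n) x Q - Q / 2 * ∑ n ∈ Finset.Icc 1 ⌊x⌋₊, Λ n ^ 2|
          ≤ C * (x ^ 2 / Real.log x ^ A + Q * x * Real.log (2 * x / Q) ^ 2) ∧
      |varV (fun n => Λ n) x Q - Q * x * Real.log x / 2|
          ≤ C * (x ^ 2 / Real.log x ^ A + Q * x * Real.log (2 * x / Q) ^ 2) := by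
  obtain ⟨C₁, hC₁, h₁⟩ := VarianceBDH.abs_varV_sub_le ⌈A⌉₊
  obtain ⟨C₂, hC₂, h₂⟩ := VarianceBDH.abs_sum_vonMangoldt_sq_sub_le
  refine ⟨C₁ + 2 * C₂ + 81, by linarith, fun x Q hx hxQ hQx => ?_⟩
  have hx81 : 81 ≤ x := by linarith
  have hQ4 : 4 ≤ Q := by
    refine le_trans ?_ hxQ
    calc (4 : ℝ) ≤ √x := Real.le_sqrt_of_sq_le (by linarith)
      _ = x ^ (1 / 2 : ℝ) := Real.sqrt_eq_rpow x
      _ ≤ x ^ (0.51 : ℝ) := Real.rpow_le_rpow_of_exponent_le (by linarith) (by norm_num)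
  have hL : 1 ≤ Real.log x := VarianceBDH.one_le_log_of_three_le (by linarith)
  have hpow : x ^ 2 / Real.log x ^ ⌈A⌉₊ ≤ x ^ 2 / Real.log x ^ A := by
    refine div_le_div_of_nonneg_left (by positivity) (by positivity) ?_
    rw [← Real.rpow_natCast]
    exact Real.rpow_le_rpow_of_exponent_le hL (Nat.le_ceil A)
  have hE : 0 ≤ x ^ 2 / Real.log x ^ A := by positivity
  have hF : 0 ≤ Q * x := by nlinarith
  have hl := VarianceBDH.half_le_log_two_mul_div (by linarith : 0 < Q) hQx
  have hF' : Q * x ≤ 4 * (Q * x * Real.log (2 * x / Q) ^ 2) := by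
    have : 1 ≤ 4 * Real.log (2 * x / Q) ^ 2 := by nlinarith
    nlinarith
  have hV := h₁ x Q (by linarith) hQ4 hQx
  have hS := h₂ x hx81
  have hV' : |varV (fun n => Λ n) x Q - Q / 2 * ∑ n ∈ Finset.Icc 1 ⌊x⌋₊, Λ n ^ 2| ≤
      C₁ * (x ^ 2 / Real.log x ^ A + Q * x * Real.log (2 * x / Q) ^ 2) :=
    hV.trans (mul_le_mul_of_nonneg_left (by linarith) (by linarith))
  have hS' : |Q / 2 * ∑ n ∈ Finset.Icc 1 ⌊x⌋₊, Λ n ^ 2 - Q * x * Real.log x / 2| ≤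
      2 * C₂ * (x ^ 2 / Real.log x ^ A + Q * x * Real.log (2 * x / Q) ^ 2) := by
    calc _ = Q / 2 * |∑ n ∈ Finset.Icc 1 ⌊x⌋₊, Λ n ^ 2 - x * Real.log x| := by
          rw [← abs_of_nonneg (by linarith : 0 ≤ Q / 2), ← abs_mul,
            abs_of_nonneg (by linarith : 0 ≤ Q / 2)]
          congr 1
          ring
      _ ≤ Q / 2 * (C₂ * x) := mul_le_mul_of_nonneg_left hS (by linarith)
      _ = C₂ / 2 * (Q * x) := by ring
      _ ≤ C₂ / 2 * (4 * (x ^ 2 / Real.log x ^ A + Q * x * Real.log (2 * x / Q) ^ 2)) :=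
          mul_le_mul_of_nonneg_left (by linarith) (by linarith)
      _ = _ := by ring
  have hB : 0 ≤ x ^ 2 / Real.log x ^ A + Q * x * Real.log (2 * x / Q) ^ 2 := by linarith
  constructor
  · exact hV'.trans (mul_le_mul_of_nonneg_right (by linarith) hB)
  · refine (abs_sub_le _ (Q / 2 * ∑ n ∈ Finset.Icc 1 ⌊x⌋₊, Λ n ^ 2) _).trans
      ((add_le_add hV' hS').trans ?_)
    rw [← add_mul]
    exact mul_le_mul_of_nonneg_right (by linarith) hB
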